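/- Let n > 2, N ≥ 1, p > 1, and let Ω ⊂ ℝⁿ be open. Let u : Ω → ℝ^N be locally Lipschitz and a local minimizer of the functional w ↦ ∫ exp(|Dw|^p) dx. Then there is a constant c = c(n,N,p) such that for every ball B = B_r(x₀) with B ⋐ Ω one has ‖Du‖_{L^∞(B_{r/2}(x₀))}^p ≤ c·log(⨍_B exp(|Du|^p) dx) + c. -/

import Mathlib

open MeasureTheory Metric Set
open scoped ENNReal NNReal
noncomputable section

/-- `u` is locally Lipschitz on `s`: Lipschitz on every compact subset of `s`. -/
def LocLipOn {n : ℕ} {F : Type*} [PseudoMetricSpace F]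
    (s : Set (EuclideanSpace ℝ (Fin n))) (u : EuclideanSpace ℝ (Fin n) → F) : Prop :=
  ∀ K : Set (EuclideanSpace ℝ (Fin n)), IsCompact K → K ⊆ s → ∃ C : ℝ≥0, LipschitzOnWith C u K

/-- The Euclidean (Frobenius) norm `|Du|` of the Jacobian of a map
`u : ℝⁿ → ℝ^N`: `|Du(x)| = (∑ᵢ |∇uᵢ(x)|²)^{1/2}`. -/
def jacNorm {n N : ℕ} (u : EuclideanSpace ℝ (Fin n) → EuclideanSpace ℝ (Fin N))
    (x : EuclideanSpace ℝ (Fin n)) : ℝ :=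
  Real.sqrt (∑ i : Fin N, ‖gradient (fun y => u y i) x‖ ^ 2)

/-- `u` is a local minimizer of `w ↦ ∫ exp(|Dw|^p) dx` on `Ω` among locally Lipschitz maps. -/
def IsLocMinimizerExp {n N : ℕ} (Ω : Set (EuclideanSpace ℝ (Fin n))) (p : ℝ)
    (u : EuclideanSpace ℝ (Fin n) → EuclideanSpace ℝ (Fin N)) : Prop :=
  ∀ B' : Set (EuclideanSpace ℝ (Fin n)), IsOpen B' → IsCompact (closure B') →
    closure B' ⊆ Ω →
    ∀ w : EuclideanSpace ℝ (Fin n) → EuclideanSpace ℝ (Fin N), LocLipOn Ω w →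
      IsCompact (closure {x | w x ≠ u x}) → closure {x | w x ≠ u x} ⊆ B' →
      ∫ x in B', Real.exp (jacNorm u x ^ p) ≤ ∫ x in B', Real.exp (jacNorm w x ^ p)

namespace ExpLip

section

open Filter Topology

/-- A Lipschitz vector of a one-parameter group of isometries is differentiable at `0`. -/
theorem exists_tendsto_of_lipschitz_orbit {H : Type*} [NormedAddCommGroup H]
    [InnerProductSpace ℝ H] [CompleteSpace H] (U : ℝ → H →ₗᵢ[ℝ] H)
    (hU : ∀ s t w, U (s + t) w = U s (U t w)) (v : H) (C : ℝ)
    (hv : ∀ h, ‖U h v - v‖ ≤ C * |h|) :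
    ∃ g, Tendsto (fun h : ℝ => h⁻¹ • (U h v - v)) (𝓝[≠] 0) (𝓝 g) := by
  have hC : 0 ≤ C := by simpa using (norm_nonneg _).trans (hv 1)
  have hlip : LipschitzWith C.toNNReal (fun s => U s v) := by
    refine LipschitzWith.of_dist_le_mul fun a b => ?_
    have : U a v - U b v = U b (U (a - b) v - v) := by
      rw [map_sub, ← hU]; simp
    rw [dist_eq_norm, this, LinearIsometry.norm_map, Real.dist_eq, Real.coe_toNNReal _ hC]
    exact hv _
  have hcont : Continuous (fun s => U s v) := hlip.continuous
  set d : ℝ → H := fun h => h⁻¹ • (U h v - v) with hd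
  have hUd : ∀ s h, U s (d h) = h⁻¹ • (U (s + h) v - U s v) := by
    intro s h; simp [hd, hU]
  have hUdc : ∀ h, Continuous (fun s => U s (d h)) := by
    intro h; simp only [hUd]
    exact (((hcont.comp (continuous_add_const h)).sub hcont).const_smul _)
  have hdC : ∀ h, ‖d h‖ ≤ C := by
    intro h
    rcases eq_or_ne h 0 with rfl | h0
    · simpa [hd] using hC
    · rw [hd]; simp only [norm_smul, norm_inv, Real.norm_eq_abs]
      rw [inv_mul_le_iff₀ (abs_pos.2 h0), mul_comm]; exact hv h
  have havg : ∀ t : ℝ, 0 < t → ∀ w, ‖t⁻¹ • ∫ s in (0:ℝ)..t, U s w‖ ≤ ‖w‖ := by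
    intro t ht w
    have := intervalIntegral.norm_integral_le_of_norm_le_const (a := 0) (b := t)
      (f := fun s => U s w) (C := ‖w‖) (by intro s _; simp)
    rw [norm_smul, norm_inv, Real.norm_eq_abs, abs_of_pos ht, inv_mul_le_iff₀ ht]
    simpa [abs_of_pos ht, mul_comm] using this
  have hlim : ∀ t : ℝ, 0 < t →
      Tendsto (fun h => t⁻¹ • ∫ s in (0:ℝ)..t, U s (d h)) (𝓝[≠] 0) (𝓝 (d t)) := by
    intro t ht
    have hG : ∀ x, HasDerivAt (fun y => ∫ s in (0:ℝ)..y, U s v) (U x v) x := fun x =>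
      intervalIntegral.integral_hasDerivAt_right (hcont.intervalIntegrable _ _)
        (hcont.stronglyMeasurableAtFilter _ _) hcont.continuousAt
    have h1 := (hasDerivAt_iff_tendsto_slope_zero.1 (hG t)).sub
      (hasDerivAt_iff_tendsto_slope_zero.1 (hG 0))
    have h2 := h1.const_smul t⁻¹
    have hU0 : U 0 v = v := by
      have := hv 0; simp only [abs_zero, mul_zero] at this
      exact sub_eq_zero.1 (norm_le_zero_iff.1 this)
    rw [hU0] at h2
    refine h2.congr fun h => ?_
    simp only [hUd, intervalIntegral.integral_smul]
    have hch : Continuous (fun s => U (s + h) v) := hcont.comp (continuous_add_const h)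
    rw [intervalIntegral.integral_sub (hch.intervalIntegrable _ _)
      (hcont.intervalIntegrable _ _), ← smul_sub]
    congr 2
    rw [intervalIntegral.integral_comp_add_right (fun s => U s v)]
    simp only [zero_add, intervalIntegral.integral_same, sub_zero]
    rw [← intervalIntegral.integral_interval_sub_left (hcont.intervalIntegrable 0 (t + h))
      (hcont.intervalIntegrable 0 h)]
    abel
  obtain ⟨S, hS⟩ : ∃ S, IsLUB (range fun t : Ioi (0:ℝ) => ‖d t‖) S :=
    Real.exists_isLUB ⟨_, ⟨⟨1, by simp⟩, rfl⟩⟩ ⟨C, by rintro _ ⟨t, rfl⟩; exact hdC t⟩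
  have hdneg : ∀ h, ‖d (-h)‖ = ‖d h‖ := by
    intro h
    have : d (-h) = U (-h) (d h) := by
      have hU0 : U 0 v = v := by
        have := hv 0; simp only [abs_zero, mul_zero] at this
        exact sub_eq_zero.1 (norm_le_zero_iff.1 this)
      rw [hUd]; simp only [hd, neg_add_cancel, hU0, inv_neg, neg_smul, ← smul_neg, neg_sub]
    rw [this, LinearIsometry.norm_map]
  have hS0 : 0 ≤ S := (norm_nonneg _).trans (hS.1 ⟨⟨1, by simp⟩, rfl⟩)
  have hdS : ∀ h, ‖d h‖ ≤ S := by
    intro h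
    rcases lt_trichotomy h 0 with h0 | h0 | h0
    · rw [← hdneg]; exact hS.1 ⟨⟨-h, by simpa using h0⟩, rfl⟩
    · simpa [h0, hd] using hS0
    · exact hS.1 ⟨⟨h, h0⟩, rfl⟩
  have hcauchy : Cauchy (map d (𝓝[≠] 0)) := by
    refine Metric.cauchy_iff.2 ⟨inferInstance, fun ε hε => ?_⟩
    obtain ⟨δ, hδ, hδε⟩ : ∃ δ > 0, 16 * S * δ < ε ^ 2 := by
      refine ⟨ε ^ 2 / (16 * S + 1), by positivity, ?_⟩
      rw [← mul_div_assoc, div_lt_iff₀ (by positivity)]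
      nlinarith [sq_pos_of_pos hε]
    obtain ⟨_, ⟨⟨t, ht⟩, rfl⟩, htS, -⟩ := hS.exists_between (show S - δ < S by linarith)
    simp only at htS
    have hnear := (hlim t ht) (Metric.ball_mem_nhds _ hδ)
    refine ⟨d '' _, image_mem_map hnear, ?_⟩
    rintro _ ⟨h, hh, rfl⟩ _ ⟨k, hk, rfl⟩
    simp only [mem_preimage, Metric.mem_ball, dist_eq_norm] at hh hk
    have key := havg t ht (d h + d k)
    have e1 : t⁻¹ • ∫ s in (0:ℝ)..t, U s (d h + d k) =
        t⁻¹ • (∫ s in (0:ℝ)..t, U s (d h)) + t⁻¹ • (∫ s in (0:ℝ)..t, U s (d k)) := by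
      simp only [map_add]
      rw [intervalIntegral.integral_add ((hUdc h).intervalIntegrable _ _)
        ((hUdc k).intervalIntegrable _ _), smul_add]
    rw [e1] at key
    set A := t⁻¹ • ∫ s in (0:ℝ)..t, U s (d h)
    set B := t⁻¹ • ∫ s in (0:ℝ)..t, U s (d k)
    have e2 : 2 * ‖d t‖ ≤ ‖A + B‖ + ‖A - d t‖ + ‖B - d t‖ := by
      have : (2:ℝ) • d t = (A + B) - (A - d t) - (B - d t) := by module
      have h3 : ‖(2:ℝ) • d t‖ = 2 * ‖d t‖ := by rw [norm_smul]; norm_num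
      rw [← h3, this]
      exact (norm_sub_le _ _).trans (by gcongr; exact norm_sub_le _ _)
    have e3 : 2 * S - 4 * δ ≤ ‖d h + d k‖ := by linarith
    have par := parallelogram_law_with_norm ℝ (d h) (d k)
    have hh' := hdS h
    have hk' := hdS k
    rw [dist_eq_norm]
    have : ‖d h - d k‖ ^ 2 < ε ^ 2 := by
      have h4 : ‖d h‖ * ‖d h‖ ≤ S * S := by gcongr
      have h5 : ‖d k‖ * ‖d k‖ ≤ S * S := by gcongr
      by_cases hc : 0 ≤ 2 * S - 4 * δ
      · have : (2 * S - 4 * δ) * (2 * S - 4 * δ) ≤ ‖d h + d k‖ * ‖d h + d k‖ := by gcongr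
        nlinarith
      · nlinarith [norm_nonneg (d h + d k)]
    exact lt_of_pow_lt_pow_left₀ 2 hε.le this
  exact CompleteSpace.complete hcauchy

end

section

open Filter Topology

abbrev Eu (n : ℕ) := EuclideanSpace ℝ (Fin n)

/-- `g` is the derivative of `f` in direction `e`, as an `L²` limit of difference quotients. -/
structure HasL2Deriv {n : ℕ} (f g : Eu n → ℝ) (e : Eu n) : Prop where
  memLp : MemLp f 2 volume
  memLp_deriv : MemLp g 2 volume
  tendsto : Tendsto (fun h : ℝ => eLpNorm (fun x => h⁻¹ * (f (x + h • e) - f x) - g x) 2 volume)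
    (𝓝[≠] 0) (𝓝 0)

theorem mp_add {n : ℕ} (v : Eu n) : MeasurePreserving (fun x : Eu n => x + v) volume volume :=
  measurePreserving_add_right volume v

theorem exists_hasL2Deriv {n : ℕ} {f : Eu n → ℝ} (e : Eu n) (hf : MemLp f 2 volume) (C δ : ℝ)
    (hδ : 0 < δ) (hC : ∀ h : ℝ, |h| < δ →
      eLpNorm (fun x => f (x + h • e) - f x) 2 volume ≤ ENNReal.ofReal (C * |h|)) :
    ∃ g, HasL2Deriv f g e := by
  let U : ℝ → Lp ℝ 2 (volume : Measure (Eu n)) →ₗᵢ[ℝ] Lp ℝ 2 (volume : Measure (Eu n)) :=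
    fun h => Lp.compMeasurePreservingₗᵢ ℝ (fun x => x + h • e) (mp_add _)
  have hUc : ∀ h w, (U h w : Eu n → ℝ) =ᵐ[volume] fun x => w (x + h • e) := fun h w =>
    Lp.coeFn_compMeasurePreserving w (mp_add _)
  have hU : ∀ s t w, U (s + t) w = U s (U t w) := by
    intro s t w
    refine Lp.ext ?_
    have h1 := (mp_add (s • e)).quasiMeasurePreserving.ae_eq_comp (hUc t w)
    filter_upwards [hUc (s + t) w, hUc s (U t w), h1] with x h2 h3 h4
    rw [h2, h3]
    simp only [Function.comp] at h4
    rw [h4]; congr 1; module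
  let v := hf.toLp f
  have hvf : (v : Eu n → ℝ) =ᵐ[volume] f := hf.coeFn_toLp
  have hUv : ∀ h, (U h v : Eu n → ℝ) =ᵐ[volume] fun x => f (x + h • e) := by
    intro h
    filter_upwards [hUc h v, (mp_add (h • e)).quasiMeasurePreserving.ae_eq_comp hvf] with x h1 h2
    rw [h1]; exact h2
  have hUvn : ∀ h, ‖U h v - v‖ = (eLpNorm (fun x => f (x + h • e) - f x) 2 volume).toReal := by
    intro h
    rw [Lp.norm_def]
    congr 1
    refine eLpNorm_congr_ae ?_
    filter_upwards [Lp.coeFn_sub (U h v) v, hUv h, hvf] with x h1 h2 h3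
    rw [h1, Pi.sub_apply, h2, h3]
  obtain ⟨g, hg⟩ := exists_tendsto_of_lipschitz_orbit U hU v (max C (2 * ‖v‖ / δ)) (by
    intro h
    rcases lt_or_ge |h| δ with h1 | h1
    · rw [hUvn]
      have hC0 : 0 ≤ max C (2 * ‖v‖ / δ) := le_max_of_le_right (by positivity)
      refine ENNReal.toReal_le_of_le_ofReal (by positivity) ((hC h h1).trans ?_)
      gcongr; exact le_max_left _ _
    · calc ‖U h v - v‖ ≤ ‖U h v‖ + ‖v‖ := norm_sub_le _ _
        _ = 2 * ‖v‖ / δ * δ := by rw [LinearIsometry.norm_map]; field_simp; ring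
        _ ≤ _ := by gcongr; exact le_max_right _ _)
  refine ⟨g, hf, Lp.memLp g, ?_⟩
  have h1 : Tendsto (fun h : ℝ => ENNReal.ofReal ‖h⁻¹ • (U h v - v) - g‖) (𝓝[≠] 0) (𝓝 0) := by
    have := (tendsto_iff_norm_sub_tendsto_zero.1 hg)
    have h2 := (ENNReal.continuous_ofReal.tendsto 0).comp this
    rwa [ENNReal.ofReal_zero] at h2
  refine h1.congr fun h => ?_
  rw [Lp.norm_def, ENNReal.ofReal_toReal (Lp.eLpNorm_ne_top _)]
  refine eLpNorm_congr_ae ?_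
  filter_upwards [Lp.coeFn_sub (U h v) v, hUv h, hvf, Lp.coeFn_sub (h⁻¹ • (U h v - v)) g,
    Lp.coeFn_smul h⁻¹ (U h v - v)] with x h1 h2 h3 h4 h5
  rw [h4, Pi.sub_apply, h5, Pi.smul_apply, h1, Pi.sub_apply, h2, h3, smul_eq_mul]

theorem abs_integral_mul_le {α : Type*} [MeasurableSpace α] {μ : Measure α} {a b : α → ℝ}
    (ha : MemLp a 2 μ) (hb : MemLp b 2 μ) :
    |∫ x, a x * b x ∂μ| ≤ (eLpNorm a 2 μ).toReal * (eLpNorm b 2 μ).toReal := by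
  have h1 : eLpNorm (a • b) 1 μ ≤ eLpNorm a 2 μ * eLpNorm b 2 μ :=
    eLpNorm_smul_le_mul_eLpNorm hb.1 ha.1
  rw [← ENNReal.toReal_mul]
  refine (norm_integral_le_lintegral_norm (G := ℝ) (fun x => a x * b x)).trans ?_
  refine ENNReal.toReal_mono (ENNReal.mul_ne_top ha.2.ne hb.2.ne) (le_of_eq_of_le ?_ h1)
  rw [eLpNorm_one_eq_lintegral_enorm]
  refine lintegral_congr fun x => ?_
  rw [ofReal_norm]; rfl

/-- Integration by parts. -/
theorem HasL2Deriv.integral_mul {n : ℕ} {f g ζ : Eu n → ℝ} {e : Eu n} (H : HasL2Deriv f g e)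
    (hf : Integrable f volume) (hζ : ContDiff ℝ 1 ζ) (hc : HasCompactSupport ζ) :
    ∫ x, f x * fderiv ℝ ζ x e = - ∫ x, g x * ζ x := by
  have hζ2 : MemLp ζ 2 volume := hζ.continuous.memLp_of_hasCompactSupport hc
  obtain ⟨hb, hbd⟩ := hc.exists_bound_of_continuous hζ.continuous
  obtain ⟨C, hCl⟩ := hζ.lipschitzWith_of_hasCompactSupport hc (by norm_num)
  have e1 : Tendsto (fun h : ℝ => ∫ x, (h⁻¹ * (f (x + h • e) - f x)) * ζ x) (𝓝[≠] 0)
      (𝓝 (∫ x, g x * ζ x)) := by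
    rw [tendsto_iff_norm_sub_tendsto_zero]
    have hm : ∀ h : ℝ, MemLp (fun x => h⁻¹ * (f (x + h • e) - f x)) 2 volume := fun h =>
      ((H.memLp.comp_measurePreserving (mp_add (h • e))).sub H.memLp).const_mul _
    have hb : ∀ h : ℝ, ‖(∫ x, (h⁻¹ * (f (x + h • e) - f x)) * ζ x) - ∫ x, g x * ζ x‖ ≤
        (eLpNorm (fun x => h⁻¹ * (f (x + h • e) - f x) - g x) 2 volume).toReal *
          (eLpNorm ζ 2 volume).toReal := by
      intro h
      have hs := integral_sub (f := fun x => (h⁻¹ * (f (x + h • e) - f x)) * ζ x)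
        (g := fun x => g x * ζ x) ((hm h).integrable_mul hζ2) (H.memLp_deriv.integrable_mul hζ2)
      rw [← hs]
      have h2 : MemLp (fun x => h⁻¹ * (f (x + h • e) - f x) - g x) 2 volume :=
        (hm h).sub H.memLp_deriv
      refine le_of_eq_of_le ?_ (abs_integral_mul_le h2 hζ2)
      rw [Real.norm_eq_abs]
      congr 2; ext x; ring
    refine squeeze_zero (fun _ => norm_nonneg _) hb ?_
    have := ((ENNReal.tendsto_toReal ENNReal.zero_ne_top).comp H.tendsto).mul_const
      ((eLpNorm ζ 2 volume).toReal)
    simpa using this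
  have e2 : Tendsto (fun h : ℝ => ∫ x, (h⁻¹ * (f (x + h • e) - f x)) * ζ x) (𝓝[>] 0)
      (𝓝 (-∫ x, f x * fderiv ℝ ζ x e)) := by
    have := LipschitzWith.integral_inv_smul_sub_mul_tendsto_integral_lineDeriv_mul hCl hf (-e)
    have hl : ∫ x, lineDeriv ℝ ζ x (-e) * f x = -∫ x, f x * fderiv ℝ ζ x e := by
      rw [← integral_neg]
      congr 1; ext x
      rw [(hζ.differentiable (by norm_num) x).lineDeriv_eq_fderiv, map_neg]; ring
    rw [hl] at this
    refine this.congr fun h => ?_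
    have hi1 : Integrable (fun x => f (x + h • e) * ζ x) volume :=
      (((mp_add (h • e)).integrable_comp_of_integrable hf).bdd_mul
        (c := hb) hζ.continuous.aestronglyMeasurable (.of_forall hbd)).congr (.of_forall fun x => by
          simp [mul_comm])
    have hi2 : Integrable (fun x => f x * ζ x) volume := 
      (hf.bdd_mul (c := hb) hζ.continuous.aestronglyMeasurable
        (.of_forall hbd)).congr (.of_forall fun x => by simp [mul_comm])
    have hi3 : Integrable (fun x => f x * ζ (x + h • (-e))) volume :=
      (hf.bdd_mul (c := hb) (hζ.continuous.comp (continuous_add_const (h • (-e)))).aestronglyMeasurable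
        (.of_forall fun x => hbd _)).congr (.of_forall fun x => by simp [mul_comm])
    have ht : ∫ x, f (x + h • e) * ζ x = ∫ x, f x * ζ (x + h • (-e)) := by
      rw [← integral_add_right_eq_self (fun x => f x * ζ (x + h • (-e))) (h • e)]
      congr 1; ext x; congr 2; module
    have l1 : ∫ x, (h⁻¹ * (f (x + h • e) - f x)) * ζ x =
        h⁻¹ * ((∫ x, f (x + h • e) * ζ x) - ∫ x, f x * ζ x) := by
      rw [← integral_sub hi1 hi2, ← integral_const_mul]
      congr 1; ext x; ring
    have l2 : ∫ x, (h⁻¹ • (ζ (x + h • (-e)) - ζ x)) * f x =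
        h⁻¹ * ((∫ x, f x * ζ (x + h • (-e))) - ∫ x, f x * ζ x) := by
      rw [← integral_sub hi3 hi2, ← integral_const_mul]
      congr 1; ext x; simp only [smul_eq_mul]; ring
    rw [l1, l2, ht]
  have e1' := e1.mono_left (nhdsWithin_mono 0 (fun x (hx : 0 < x) => hx.ne') : 𝓝[>] (0:ℝ) ≤ 𝓝[≠] 0)
  linarith [tendsto_nhds_unique e1' e2]

theorem exists_common_subseq {n : ℕ} {ι : Type*} [Finite ι] {f g : ι → Eu n → ℝ} {e : ι → Eu n}
    (H : ∀ j, HasL2Deriv (f j) (g j) (e j)) (h : ℕ → ℝ) (h0 : ∀ k, h k ≠ 0)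
    (hl : Tendsto h atTop (𝓝 0)) :
    ∃ φ : ℕ → ℕ, StrictMono φ ∧ ∀ j, ∀ᵐ x, Tendsto
      (fun k => (h (φ k))⁻¹ * (f j (x + h (φ k) • e j) - f j x)) atTop (𝓝 (g j x)) := by
  have := Fintype.ofFinite ι
  classical
  suffices ∀ s : Finset ι, ∃ φ : ℕ → ℕ, StrictMono φ ∧ ∀ j ∈ s, ∀ᵐ x, Tendsto
      (fun k => (h (φ k))⁻¹ * (f j (x + h (φ k) • e j) - f j x)) atTop (𝓝 (g j x)) by
    obtain ⟨φ, h1, h2⟩ := this Finset.univ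
    exact ⟨φ, h1, fun j => h2 j (Finset.mem_univ j)⟩
  intro s
  induction s using Finset.induction_on with
  | empty => exact ⟨id, strictMono_id, by simp⟩
  | insert a s ha ih =>
    obtain ⟨φ, hφ, hs⟩ := ih
    have hw : Tendsto (fun k => h (φ k)) atTop (𝓝[≠] 0) :=
      tendsto_nhdsWithin_iff.2 ⟨hl.comp hφ.tendsto_atTop, .of_forall fun k => h0 _⟩
    have hm : ∀ t : ℝ, AEStronglyMeasurable (fun x => t⁻¹ * (f a (x + t • e a) - f a x)) volume :=
      fun t => ((((H a).memLp.comp_measurePreserving (mp_add (t • e a))).sub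
        (H a).memLp).const_mul _).1
    have := tendstoInMeasure_of_tendsto_eLpNorm (p := 2) (by norm_num)
      (f := fun k x => (h (φ k))⁻¹ * (f a (x + h (φ k) • e a) - f a x)) (g := g a)
      (fun k => hm _) (H a).memLp_deriv.1 ((H a).tendsto.comp hw)
    obtain ⟨ψ, hψ, hae⟩ := this.exists_seq_tendsto_ae
    refine ⟨φ ∘ ψ, hφ.comp hψ, fun j hj => ?_⟩
    rcases Finset.mem_insert.1 hj with rfl | hj
    · exact hae
    · filter_upwards [hs j hj] with x hx
      exact hx.comp hψ.tendsto_atTop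

end

section

open Filter Topology
open scoped Convolution

theorem HasL2Deriv.ae_eq_zero {n : ℕ} {f g : Eu n → ℝ} {e : Eu n} (H : HasL2Deriv f g e)
    {x₀ : Eu n} {R : ℝ} (hf : ∀ x, x ∉ closedBall x₀ R → f x = 0) :
    ∀ᵐ x, x ∉ closedBall x₀ R → g x = 0 := by
  obtain ⟨ψ, hψ, hae⟩ := exists_common_subseq (ι := Unit) (f := fun _ => f) (g := fun _ => g)
    (e := fun _ => e) (fun _ => H) (fun k => 1 / ((k : ℝ) + 1)) (fun k => by positivity)
    tendsto_one_div_add_atTop_nhds_zero_nat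
  filter_upwards [hae ()] with x hx hxR
  refine tendsto_nhds_unique hx (tendsto_const_nhds.congr' ?_)
  have hl : Tendsto (fun k => x + (1 / ((ψ k : ℝ) + 1)) • e) atTop (𝓝 x) := by
    have := ((tendsto_one_div_add_atTop_nhds_zero_nat (𝕜 := ℝ)).comp hψ.tendsto_atTop).smul_const e
    simpa using this.const_add x
  filter_upwards [hl (isClosed_closedBall.isOpen_compl.mem_nhds hxR)] with k hk
  rw [hf _ hk, hf x hxR]; simp

theorem integrable_of_memLp_two {n : ℕ} {f : Eu n → ℝ} (hf : MemLp f 2 volume) {x₀ : Eu n} {R : ℝ}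
    (h0 : ∀ᵐ x, x ∉ closedBall x₀ R → f x = 0) : Integrable f volume := by
  have h1 : IntegrableOn f (closedBall x₀ R) volume := by
    have h2 : MemLp f 2 (volume.restrict (closedBall x₀ R)) := hf.restrict _
    have : IsFiniteMeasure (volume.restrict (closedBall x₀ R)) :=
      ⟨by simpa using measure_closedBall_lt_top⟩
    exact h2.integrable (by norm_num)
  exact h1.integrable_of_ae_notMem_eq_zero h0

/-- A fixed sequence of shrinking bumps. -/
def bump (n k : ℕ) : ContDiffBump (0 : Eu n) where
  rIn := 1 / ((k : ℝ) + 1) / 2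
  rOut := 1 / ((k : ℝ) + 1)
  rIn_pos := by positivity
  rIn_lt_rOut := half_lt_self (by positivity)

/-- Mollification. -/
def moll {n : ℕ} (k : ℕ) (f : Eu n → ℝ) (x : Eu n) : ℝ :=
  ∫ y, (bump n k).normed volume (x - y) * f y

theorem moll_eq {n : ℕ} (k : ℕ) (f : Eu n → ℝ) :
    moll k f = ((bump n k).normed volume ⋆[ContinuousLinearMap.lsmul ℝ ℝ, volume] f) := by
  ext x; exact (convolution_lsmul_swap (𝕜 := ℝ) (f := (bump n k).normed volume) (g := f)).symm

theorem moll_tendsto {n : ℕ} {f : Eu n → ℝ} (hf : LocallyIntegrable f volume) :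
    ∀ᵐ x, Tendsto (fun k => moll k f x) atTop (𝓝 (f x)) := by
  simp only [moll_eq]
  refine ContDiffBump.ae_convolution_tendsto_right_of_locallyIntegrable (K := 2) ?_ ?_ hf
  · exact tendsto_one_div_add_atTop_nhds_zero_nat
  · refine .of_forall fun k => ?_
    simp only [bump]; linarith

theorem moll_contDiff {n : ℕ} {f : Eu n → ℝ} (k : ℕ) (hf : LocallyIntegrable f volume)
    {m : ℕ∞} : ContDiff ℝ m (moll k f) := by
  rw [moll_eq]
  exact (bump n k).hasCompactSupport_normed.contDiff_convolution_left _
    (bump n k).contDiff_normed hf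

theorem normed_eq_zero {n : ℕ} (k : ℕ) {x : Eu n} (hx : 1 / ((k : ℝ) + 1) ≤ ‖x‖) :
    (bump n k).normed volume x = 0 := by
  rw [← Function.notMem_support, (bump n k).support_normed_eq]
  simpa [bump] using hx

theorem moll_eq_zero {n : ℕ} {f : Eu n → ℝ} (k : ℕ) {x₀ : Eu n} {R : ℝ}
    (hf : ∀ x, x ∉ closedBall x₀ R → f x = 0) {x : Eu n}
    (hx : x ∉ closedBall x₀ (R + 1 / ((k : ℝ) + 1))) : moll k f x = 0 := by
  refine integral_eq_zero_of_ae (.of_forall fun y => ?_)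
  simp only [mem_closedBall, not_le] at hx hf
  by_cases hy : R < dist y x₀
  · simp [hf y hy]
  · have h1 := dist_triangle x y x₀
    rw [dist_eq_norm x y] at h1
    simp [normed_eq_zero k (x := x - y) (by linarith)]

theorem integrable_normed_mul {n : ℕ} {f : Eu n → ℝ} (k : ℕ) (hf : Integrable f volume) (x : Eu n) :
    Integrable (fun y => (bump n k).normed volume (x - y) * f y) volume := by
  obtain ⟨C, hC⟩ := ((bump n k).hasCompactSupport_normed (μ := volume)).exists_bound_of_continuous
    (bump n k).continuous_normed
  exact hf.bdd_mul (c := C) ((bump n k).continuous_normed.comp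
    (continuous_const.sub continuous_id)).aestronglyMeasurable (.of_forall fun y => hC _)

theorem HasL2Deriv.fderiv_moll {n : ℕ} {f g : Eu n → ℝ} {e : Eu n} (H : HasL2Deriv f g e)
    (hf : Integrable f volume) (k : ℕ) (x : Eu n) : fderiv ℝ (moll k f) x e = moll k g x := by
  set ρ := (bump n k).normed volume with hρ
  have hρs : ContDiff ℝ 1 ρ := (bump n k).contDiff_normed
  have hρc : HasCompactSupport ρ := (bump n k).hasCompactSupport_normed
  have h1 := hρc.hasFDerivAt_convolution_left (ContinuousLinearMap.lsmul ℝ ℝ) hρs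
    hf.locallyIntegrable x
  have hm := moll_eq k f
  rw [← hρ] at hm
  rw [← hm] at h1
  rw [h1.fderiv, convolution_eq_swap, ContinuousLinearMap.integral_apply]
  · have hd : ∀ y, fderiv ℝ (fun y => ρ (x - y)) y e = - fderiv ℝ ρ (x - y) e := by
      intro y
      have hs : HasFDerivAt (fun y : Eu n => x - y) (-ContinuousLinearMap.id ℝ (Eu n)) y := by
        simpa using (hasFDerivAt_id y).const_sub x
      have := ((hρs.differentiable (by norm_num) (x - y)).hasFDerivAt.comp y hs).fderiv
      simp only [Function.comp_def] at this
      rw [this]; simp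
    have := H.integral_mul hf (ζ := fun y => ρ (x - y)) (hρs.comp (contDiff_const.sub contDiff_id))
      (hρc.comp_homeomorph (Homeomorph.subLeft x))
    simp only [hd] at this
    have e2 : ∫ y, f y * -(fderiv ℝ ρ (x - y) e) = - ∫ y, f y * (fderiv ℝ ρ (x - y) e) := by
      rw [← integral_neg]; congr 1; ext y; ring
    rw [e2, neg_inj] at this
    simp only [ContinuousLinearMap.precompL_apply, ContinuousLinearMap.lsmul_apply, smul_eq_mul, moll]
    calc _ = ∫ y, f y * (fderiv ℝ ρ (x - y) e) := by congr 1; ext y; ring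
      _ = _ := by rw [this]; congr 1; ext y; ring
  · have := (hρc.fderiv (𝕜 := ℝ)).convolutionExists_left
      ((ContinuousLinearMap.lsmul ℝ ℝ).precompL (Eu n)) (hρs.continuous_fderiv (by norm_num))
      hf.locallyIntegrable x
    exact this.integrable_swap

theorem integral_mul_moll {n : ℕ} {q g : Eu n → ℝ} (k : ℕ) {M : ℝ} (hg : Integrable g volume)
    (hq : Measurable q) (hqM : ∀ x, |q x| ≤ M) :
    ∫ x, q x * moll k g x = ∫ x, moll k q x * g x := by
  set ρ := (bump n k).normed volume with hρ
  have hρc : Continuous ρ := (bump n k).continuous_normed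
  have hρi : Integrable ρ volume := (bump n k).integrable_normed
  have hint : Integrable (fun z : Eu n × Eu n => q z.1 * (ρ (z.1 - z.2) * g z.2))
      (volume.prod volume) := by
    have h1 : Integrable (fun z : Eu n × Eu n => ρ (z.1 - z.2) * g z.2) (volume.prod volume) := by
      have := hg.convolution_integrand (ContinuousLinearMap.mul ℝ ℝ) hρi
      refine (this.congr (.of_forall fun z => ?_))
      simp [mul_comm]
    exact h1.bdd_mul (c := M) (hq.comp measurable_fst).aestronglyMeasurable (.of_forall fun z => hqM _)
  simp only [moll, ← integral_const_mul, ← integral_mul_const]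
  rw [integral_integral_swap hint]
  congr 1; ext y; congr 1; ext x
  have : ρ (x - y) = ρ (y - x) := by rw [hρ, ← ContDiffBump.normed_neg, neg_sub]
  rw [← hρ, this]; ring

theorem abs_moll_le {n : ℕ} {q : Eu n → ℝ} (k : ℕ) {M : ℝ} (hqM : ∀ x, |q x| ≤ M) (x : Eu n) :
    |moll k q x| ≤ M := by
  have hi : Integrable (fun y => (bump n k).normed volume (x - y) * M) volume :=
    (((bump n k).integrable_normed (μ := volume)).comp_sub_left x).mul_const M
  have : ∫ y, (bump n k).normed volume (x - y) * M = M := by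
    rw [integral_mul_const, integral_sub_left_eq_self (fun y => (bump n k).normed volume y) volume x,
      (bump n k).integral_normed, one_mul]
  rw [← this]
  refine (norm_integral_le_of_norm_le (G := ℝ) hi (.of_forall fun y => ?_))
  rw [norm_mul, Real.norm_eq_abs, Real.norm_eq_abs, abs_of_nonneg ((bump n k).nonneg_normed _)]
  exact mul_le_mul_of_nonneg_left (hqM y) ((bump n k).nonneg_normed _)

/-- Divergence-free bounded fields annihilate compactly supported weak gradients. -/
theorem sum_integral_mul_eq_zero {n : ℕ} {ι : Type*} [Fintype ι] {q g : ι → Eu n → ℝ}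
    {e : ι → Eu n} {f : Eu n → ℝ} {x₀ : Eu n} {R R' M : ℝ} (hR : R < R')
    (hq : ∀ i, Measurable (q i)) (hqM : ∀ i x, |q i x| ≤ M)
    (hq0 : ∀ ζ : Eu n → ℝ, ContDiff ℝ (⊤ : ℕ∞) ζ → (∀ x, x ∉ closedBall x₀ R' → ζ x = 0) →
      ∑ i, ∫ x, q i x * fderiv ℝ ζ x (e i) = 0)
    (hf : ∀ x, x ∉ closedBall x₀ R → f x = 0) (H : ∀ i, HasL2Deriv f (g i) (e i)) :
    ∑ i, ∫ x, q i x * g i x = 0 := by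
  rcases isEmpty_or_nonempty ι with hι | ⟨⟨i₀⟩⟩
  · simp
  have hfi : Integrable f volume := integrable_of_memLp_two (H i₀).memLp (.of_forall hf)
  have hgi : ∀ i, Integrable (g i) volume := fun i =>
    integrable_of_memLp_two (H i).memLp_deriv ((H i).ae_eq_zero hf)
  have hlim : Tendsto (fun k => ∑ i, ∫ x, moll k (q i) x * g i x) atTop
      (𝓝 (∑ i, ∫ x, q i x * g i x)) := by
    refine tendsto_finsetSum _ fun i _ => ?_
    have hqi : LocallyIntegrable (q i) volume :=
      (memLp_top_of_bound (hq i).aestronglyMeasurable M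
        (.of_forall (hqM i))).locallyIntegrable le_top
    refine tendsto_integral_of_dominated_convergence (fun x => M * |g i x|) (fun k => ?_)
      ((hgi i).abs.const_mul M) (fun k => .of_forall fun x => ?_) ?_
    · exact ((moll_contDiff (m := 0) k hqi).continuous.aestronglyMeasurable).mul (hgi i).1
    · rw [norm_mul]; exact mul_le_mul_of_nonneg_right (abs_moll_le k (hqM i) x) (norm_nonneg _)
    · filter_upwards [moll_tendsto hqi] with x hx
      exact hx.mul_const _
  refine tendsto_nhds_unique hlim (tendsto_const_nhds.congr' ?_)
  have hsm : ∀ᶠ k : ℕ in atTop, 1 / ((k : ℝ) + 1) < R' - R :=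
    tendsto_one_div_add_atTop_nhds_zero_nat.eventually (gt_mem_nhds (by linarith))
  filter_upwards [hsm] with k hk
  have := hq0 (moll k f) (moll_contDiff k hfi.locallyIntegrable) fun x hx => moll_eq_zero k hf
    fun hx' => hx (closedBall_subset_closedBall (by linarith) hx')
  rw [← this]
  refine Finset.sum_congr rfl fun i _ => ?_
  simp only [(H i).fderiv_moll hfi]
  exact integral_mul_moll k (hgi i) (hq i) (hqM i)

end

section

open Filter Topology
open scoped Convolution

theorem integrable_moll {n : ℕ} {f : Eu n → ℝ} (k : ℕ) (hf : Integrable f volume) :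
    Integrable (moll k f) volume := by
  rw [moll_eq]
  exact ((bump n k).integrable_normed (μ := volume)).integrable_convolution _ hf

theorem sq_moll_le {n : ℕ} {f : Eu n → ℝ} (k : ℕ) (hf : Integrable f volume)
    (hf2 : Integrable (fun x => f x ^ 2) volume) (x : Eu n) :
    moll k f x ^ 2 ≤ moll k (fun x => f x ^ 2) x := by
  set a := moll k f x with ha
  have h1 : Integrable (fun y => (bump n k).normed volume (x - y)) volume :=
    ((bump n k).integrable_normed (μ := volume)).comp_sub_left x
  have h0 : 0 ≤ ∫ y, (bump n k).normed volume (x - y) * (f y - a) ^ 2 :=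
    integral_nonneg fun y => mul_nonneg ((bump n k).nonneg_normed _) (sq_nonneg _)
  have h2 : ∫ y, (bump n k).normed volume (x - y) = 1 := by
    rw [integral_sub_left_eq_self (fun y => (bump n k).normed volume y) volume x,
      (bump n k).integral_normed]
  have h3 : ∫ y, (bump n k).normed volume (x - y) * (f y - a) ^ 2 =
      moll k (fun x => f x ^ 2) x - 2 * a * moll k f x + a ^ 2 * 1 := by
    rw [← h2]
    unfold moll
    rw [← integral_const_mul, ← integral_const_mul, ← integral_sub, ← integral_add]
    · congr 1; ext y; ring
    · exact (integrable_normed_mul k hf2 x).sub ((integrable_normed_mul k hf x).const_mul _)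
    · exact h1.const_mul _
    · exact integrable_normed_mul k hf2 x
    · exact (integrable_normed_mul k hf x).const_mul _
  rw [h3, ← ha] at h0
  linarith

theorem eLpNorm_moll_le {n : ℕ} {f : Eu n → ℝ} (k : ℕ) (hf : Integrable f volume)
    (hf2 : MemLp f 2 volume) : eLpNorm (moll k f) 2 volume ≤ eLpNorm f 2 volume := by
  have hi := hf2.integrable_sq
  have hm : AEStronglyMeasurable (moll k f) volume :=
    (moll_contDiff (m := 0) k hf.locallyIntegrable).continuous.aestronglyMeasurable
  have hmi : Integrable (fun x => moll k f x ^ 2) volume :=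
    (integrable_moll k hi).mono' (hm.pow 2) (.of_forall fun x => by
      rw [Real.norm_eq_abs, abs_of_nonneg (sq_nonneg _)]; exact sq_moll_le k hf hi x)
  have hm2 : MemLp (moll k f) 2 volume := (memLp_two_iff_integrable_sq hm).2 hmi
  have hle : ∫ x, moll k f x ^ 2 ≤ ∫ x, f x ^ 2 := by
    have h1 : ∫ x, moll k (fun x => f x ^ 2) x = ∫ x, f x ^ 2 := by
      have := integral_mul_moll k (q := fun _ => 1) (M := 1) hi measurable_const (by simp)
      have h3 : ∀ x, moll k (fun _ : Eu n => (1 : ℝ)) x = 1 := fun x => by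
        simp only [moll, mul_one]
        rw [integral_sub_left_eq_self (fun y => (bump n k).normed volume y) volume x,
          (bump n k).integral_normed]
      simpa [h3] using this
    rw [← h1]
    exact integral_mono hmi (integrable_moll k hi) (sq_moll_le k hf hi)
  rw [hm2.eLpNorm_eq_integral_rpow_norm (by norm_num) (by norm_num),
    hf2.eLpNorm_eq_integral_rpow_norm (by norm_num) (by norm_num)]
  refine ENNReal.ofReal_le_ofReal ?_
  simp only [ENNReal.toReal_ofNat, Real.rpow_ofNat, Real.norm_eq_abs, sq_abs]
  exact Real.rpow_le_rpow (integral_nonneg fun _ => sq_nonneg _) hle (by norm_num)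

/-- The basis vectors of Euclidean space. -/
def ee {n : ℕ} (i : Fin n) : Eu n := EuclideanSpace.single i 1

theorem norm_clm_le_sum {n : ℕ} (L : Eu n →L[ℝ] ℝ) : ‖L‖ ≤ ∑ i, ‖L (ee i)‖ := by
  refine L.opNorm_le_bound (by positivity) fun x => ?_
  have hx : x = ∑ i, x i • ee i := by
    ext j; simp [ee, Pi.single_apply]
  rw [Finset.sum_mul]
  conv_lhs => rw [hx, map_sum]
  refine (norm_sum_le _ _).trans (Finset.sum_le_sum fun i _ => ?_)
  rw [map_smul, norm_smul, mul_comm]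
  gcongr
  exact PiLp.norm_apply_le x i

/-- Sobolev's inequality. -/
theorem exists_sobolev {n : ℕ} (hn : 2 < n) : ∃ C : ℝ≥0, ∀ (f : Eu n → ℝ) (g : Fin n → Eu n → ℝ)
    (x₀ : Eu n) (R : ℝ), (∀ x, x ∉ closedBall x₀ R → f x = 0) →
    (∀ i, HasL2Deriv f (g i) (ee i)) →
    eLpNorm f (2 * n / (n - 2) : ℝ≥0) volume ≤ C * ∑ i, eLpNorm (g i) 2 volume := by
  refine ⟨eLpNormLESNormFDerivOfEqInnerConst (volume : Measure (Eu n)) ((2 : ℝ≥0) : ℝ), fun f g x₀ R hf H => ?_⟩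
  set C := eLpNormLESNormFDerivOfEqInnerConst (volume : Measure (Eu n)) ((2 : ℝ≥0) : ℝ)
  have hfi : Integrable f volume :=
    integrable_of_memLp_two (H ⟨0, by omega⟩).memLp (.of_forall hf)
  have hgi : ∀ i, Integrable (g i) volume := fun i =>
    integrable_of_memLp_two (H i).memLp_deriv ((H i).ae_eq_zero hf)
  have hs : ∀ k, ContDiff ℝ 1 (moll k f) := fun k => moll_contDiff (m := 1) k hfi.locallyIntegrable
  refine (Lp.eLpNorm_lim_le_liminf_eLpNorm (fun k => (hs k).continuous.aestronglyMeasurable) f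
    (moll_tendsto hfi.locallyIntegrable)).trans ?_
  refine liminf_le_of_le (by isBoundedDefault) fun b hb => ?_
  obtain ⟨k, hk⟩ := hb.exists
  refine hk.trans ?_
  have hn' : (2 : ℝ) < n := by exact_mod_cast hn
  have h1 := eLpNorm_le_eLpNorm_fderiv_of_eq_inner (volume : Measure (Eu n)) (hs k)
    (HasCompactSupport.intro (isCompact_closedBall x₀ (R + 1 / ((k : ℝ) + 1)))
      fun x hx => moll_eq_zero k hf hx)
    (p := 2) (p' := (2 * n / (n - 2) : ℝ≥0)) (by norm_num) (by simp; omega) (by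
      have : ((2 * n / (n - 2) : ℝ≥0) : ℝ) = 2 * n / (n - 2) := by
        rw [NNReal.coe_div, NNReal.coe_sub (by exact_mod_cast hn.le)]; simp
      rw [this]
      simp only [finrank_euclideanSpace, Fintype.card_fin, NNReal.coe_inv, NNReal.coe_ofNat]
      have h2 : (n : ℝ) - 2 ≠ 0 := by linarith
      field_simp)
  refine h1.trans (mul_le_mul_right ?_ _)
  calc eLpNorm (fderiv ℝ (moll k f)) 2 volume
      ≤ eLpNorm (fun x => ∑ i, ‖moll k (g i) x‖) 2 volume := by
        refine eLpNorm_mono fun x => ?_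
        rw [Real.norm_of_nonneg (by positivity)]
        refine (norm_clm_le_sum _).trans_eq ?_
        refine Finset.sum_congr rfl fun i _ => ?_
        rw [(H i).fderiv_moll hfi]
    _ ≤ ∑ i, eLpNorm (fun x => ‖moll k (g i) x‖) 2 volume := by
        have := eLpNorm_sum_le (s := Finset.univ) (f := fun i x => ‖moll k (g i) x‖)
          (p := 2) (μ := volume) (fun i _ =>
            (moll_contDiff (m := 0) k (hgi i).locallyIntegrable).continuous.norm.aestronglyMeasurable)
          (by norm_num)
        refine le_of_eq_of_le ?_ this
        congr 1; ext x; simp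
    _ ≤ _ := by
        refine Finset.sum_le_sum fun i _ => ?_
        rw [eLpNorm_norm]
        exact eLpNorm_moll_le k (hgi i) (H i).memLp_deriv

end

section

open Filter Topology

section

variable {V : Type*} [NormedAddCommGroup V]

/-- The exponential integrand. -/
def FF (p : ℝ) (z : V) : ℝ := Real.exp (‖z‖ ^ p)

/-- The radial coefficient of the gradient of the integrand. -/
def aa (p : ℝ) (z : V) : ℝ := p * ‖z‖ ^ (p - 2) * FF p z

theorem FF_pos (p : ℝ) (z : V) : 0 < FF p z := Real.exp_pos _

theorem one_le_FF (p : ℝ) (z : V) : 1 ≤ FF p z := Real.one_le_exp (by positivity)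

end

variable {V : Type*} [NormedAddCommGroup V] [InnerProductSpace ℝ V]

theorem convexOn_exp_sub_sq : ConvexOn ℝ (Ici 0) fun x : ℝ => Real.exp x - x ^ 2 / 2 := by
  have hd : ∀ x : ℝ, HasDerivAt (fun x : ℝ => Real.exp x - x ^ 2 / 2) (Real.exp x - x) x := by
    intro x
    exact ((Real.hasDerivAt_exp x).sub ((hasDerivAt_pow 2 x).div_const 2)).congr_deriv
      (by norm_num)
  have hd' : deriv (fun x : ℝ => Real.exp x - x ^ 2 / 2) = fun x => Real.exp x - x :=
    funext fun x => (hd x).deriv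
  have hd2 : ∀ x : ℝ, HasDerivAt (fun x : ℝ => Real.exp x - x) (Real.exp x - 1) x := fun x =>
    (Real.hasDerivAt_exp x).sub (hasDerivAt_id x)
  refine MonotoneOn.convexOn_of_deriv (convex_Ici 0) (by fun_prop) (fun x _ =>
    (hd x).differentiableAt.differentiableWithinAt) ?_
  rw [hd']
  refine monotoneOn_of_deriv_nonneg (convex_Ici 0 |>.interior) (by fun_prop)
    (fun x _ => (hd2 x).differentiableAt.differentiableWithinAt) fun x hx => ?_
  rw [(hd2 x).deriv]
  simp only [interior_Ici, interior_Ioi, mem_Ioi] at hx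
  linarith [Real.add_one_le_exp x]

theorem monotoneOn_exp_sub_sq : MonotoneOn (fun x : ℝ => Real.exp x - x ^ 2 / 2) (Ici 0) := by
  have hd : ∀ x : ℝ, HasDerivAt (fun x : ℝ => Real.exp x - x ^ 2 / 2) (Real.exp x - x) x := by
    intro x
    exact ((Real.hasDerivAt_exp x).sub ((hasDerivAt_pow 2 x).div_const 2)).congr_deriv
      (by norm_num)
  refine monotoneOn_of_deriv_nonneg (convex_Ici 0) (by fun_prop)
    (fun x _ => (hd x).differentiableAt.differentiableWithinAt) fun x hx => ?_
  rw [(hd x).deriv]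
  linarith [Real.add_one_le_exp x]

theorem half_rpow_add_le {q x y : ℝ} (hq : 1 ≤ q) (hx : 0 ≤ x) (hy : 0 ≤ y) :
    ((x + y) / 2) ^ q ≤ (x ^ q + y ^ q) / 2 := by
  have h0 := (convexOn_rpow hq).2
  have := h0 hx hy (by norm_num : (0 : ℝ) ≤ 1 / 2) (by norm_num : (0 : ℝ) ≤ 1 / 2) (by norm_num)
  simp only [smul_eq_mul] at this
  have e : (x + y) / 2 = 1 / 2 * x + 1 / 2 * y := by ring
  rw [e]; linarith

theorem FF_gap_aux {p : ℝ} (hp : 1 < p) (a b : V) :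
    FF p ((1 / 2 : ℝ) • (a + b)) + (1 / 8) * ((‖a‖ ^ 2 + ‖b‖ ^ 2) / 2) ^ (p - 1) * ‖a - b‖ ^ 2 ≤
      (FF p a + FF p b) / 2 := by
  set m := (1 / 2 : ℝ) • (a + b) with hm
  set s := (‖a‖ ^ 2 + ‖b‖ ^ 2) / 2 with hs
  have hs' : s = ‖m‖ ^ 2 + ‖a - b‖ ^ 2 / 4 := by
    have := parallelogram_law_with_norm ℝ a b
    rw [hm, norm_smul, Real.norm_of_nonneg (by norm_num), hs]; linarith
  have hs0 : 0 ≤ s := by positivity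
  have h1 : FF p m - (‖m‖ ^ p) ^ 2 / 2 ≤
      (FF p a - (‖a‖ ^ p) ^ 2 / 2) / 2 + (FF p b - (‖b‖ ^ p) ^ 2 / 2) / 2 := by
    have hmle : ‖m‖ ^ p ≤ (‖a‖ ^ p + ‖b‖ ^ p) / 2 := by
      refine le_trans ?_ (half_rpow_add_le hp.le (norm_nonneg a) (norm_nonneg b))
      refine Real.rpow_le_rpow (norm_nonneg _) ?_ (by linarith)
      rw [hm, norm_smul, Real.norm_of_nonneg (by norm_num)]
      linarith [norm_add_le a b]
    have ha : 0 ≤ ‖a‖ ^ p := by positivity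
    have hb : 0 ≤ ‖b‖ ^ p := by positivity
    have h2 := monotoneOn_exp_sub_sq (by simp; positivity : ‖m‖ ^ p ∈ Ici (0:ℝ))
      (by simp; positivity : (‖a‖ ^ p + ‖b‖ ^ p) / 2 ∈ Ici (0:ℝ)) hmle
    have h0 := convexOn_exp_sub_sq.2
    have h3 := h0 ha hb (by norm_num : (0 : ℝ) ≤ 1 / 2) (by norm_num : (0 : ℝ) ≤ 1 / 2)
      (by norm_num)
    simp only [smul_eq_mul] at h2 h3
    have h4 : (1 / 2 : ℝ) * ‖a‖ ^ p + 1 / 2 * ‖b‖ ^ p = (‖a‖ ^ p + ‖b‖ ^ p) / 2 := by ring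
    rw [h4] at h3
    unfold FF
    linarith
  have hpow : ∀ x : ℝ, 0 ≤ x → (x ^ p) ^ 2 = (x ^ 2) ^ p := fun x hx => by
    rw [← Real.rpow_natCast, ← Real.rpow_mul hx, mul_comm, Real.rpow_mul hx, Real.rpow_natCast]
  have h5 : s ^ p ≤ ((‖a‖ ^ p) ^ 2 + (‖b‖ ^ p) ^ 2) / 2 := by
    rw [hpow _ (norm_nonneg a), hpow _ (norm_nonneg b)]
    exact half_rpow_add_le hp.le (by positivity) (by positivity)
  have h6 : (‖m‖ ^ p) ^ 2 + ‖a - b‖ ^ 2 / 4 * s ^ (p - 1) ≤ s ^ p := by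
    rcases hs0.eq_or_lt with h0 | h0
    · have hm0 : ‖m‖ ^ 2 = 0 := by nlinarith [sq_nonneg ‖m‖, sq_nonneg ‖a - b‖]
      have hd0 : ‖a - b‖ ^ 2 = 0 := by nlinarith [sq_nonneg ‖m‖, sq_nonneg ‖a - b‖]
      rw [hpow _ (norm_nonneg m), hm0, hd0, ← h0]; simp
    · have e1 : s ^ p = s * s ^ (p - 1) := by
        rw [← Real.rpow_one_add' hs0 (by linarith)]; congr 1; ring
      have e2 : (‖m‖ ^ p) ^ 2 = ‖m‖ ^ 2 * (‖m‖ ^ 2) ^ (p - 1) := by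
        rw [hpow _ (norm_nonneg m), ← Real.rpow_one_add' (by positivity) (by linarith)]; congr 1; ring
      have e3 : (‖m‖ ^ 2) ^ (p - 1) ≤ s ^ (p - 1) :=
        Real.rpow_le_rpow (by positivity) (by rw [hs']; nlinarith [sq_nonneg ‖a - b‖]) (by linarith)
      rw [e1, e2]
      calc _ ≤ ‖m‖ ^ 2 * s ^ (p - 1) + ‖a - b‖ ^ 2 / 4 * s ^ (p - 1) := by gcongr
        _ = s * s ^ (p - 1) := by rw [← add_mul, ← hs']
  linarith

theorem FF_midpoint {p : ℝ} (hp : 1 < p) (a b : V) :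
    FF p ((1 / 2 : ℝ) • (a + b)) ≤ (FF p a + FF p b) / 2 := by
  have := FF_gap_aux hp a b
  have h2 : 0 ≤ (1 / 8) * ((‖a‖ ^ 2 + ‖b‖ ^ 2) / 2) ^ (p - 1) * ‖a - b‖ ^ 2 := by positivity
  linarith

theorem FF_gap {p : ℝ} (hp : 1 < p) (a b : V) (hab : 1 ≤ ‖a‖ ∨ 1 ≤ ‖b‖) :
    FF p ((1 / 2 : ℝ) • (a + b)) + (1 / 8) * (1 / 2) ^ (p - 1) * ‖a - b‖ ^ 2 ≤
      (FF p a + FF p b) / 2 := by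
  refine le_trans ?_ (FF_gap_aux hp a b)
  gcongr
  rcases hab with h | h <;> nlinarith [sq_nonneg ‖a‖, sq_nonneg ‖b‖]

theorem hasFDerivAt_FF {p : ℝ} (hp : 1 < p) (z : V) :
    HasFDerivAt (FF p : V → ℝ) (aa p z • innerSL ℝ z) z := by
  have := (hasFDerivAt_norm_rpow z hp).exp
  rw [smul_smul] at this
  refine this.congr_fderiv ?_
  congr 1
  simp only [aa, FF]; ring

theorem contDiff_FF {p : ℝ} (hp : 1 < p) : ContDiff ℝ 1 (FF p : V → ℝ) :=
  (contDiff_norm_rpow hp).exp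

theorem exp_taylor_aux {T D a t ε A ω h : ℝ} (ha0 : 0 < a) (ht0 : 0 ≤ t) (htT : t ≤ T)
    (hD1 : 1 ≤ D) (hε : ε = 2 * h * A + h ^ 2 * ω) (hω : ω ≤ D ^ 2)
    (hεD : |ε| ≤ D * |h|) (hh1 : |h| * D < 1 / 2) (hh2 : |h| * (2 * (a * D + 1) * (T + 1)) < 1) :
    Real.exp (t * (1 + ε) ^ a) ≤ Real.exp t + h * (Real.exp t * (t * a * (2 * A))) +
      Real.exp T * (T * a * D ^ 2 + T * a ^ 2 * D ^ 2 + 4 * T ^ 2 * a ^ 2 * D ^ 2) * h ^ 2 := by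
  have hT0 : 0 ≤ T := ht0.trans htT
  have hε1 : |ε| < 1 / 2 := by linarith
  have hε2 : ε ^ 2 ≤ D ^ 2 * h ^ 2 := by
    rw [← sq_abs ε, ← sq_abs h, ← mul_pow]; gcongr
  obtain ⟨hε3, hε4⟩ := abs_lt.1 hε1
  have haε : |a * ε| ≤ 1 / 2 := by
    rw [abs_mul, abs_of_pos ha0]
    have : a * |ε| ≤ a * (D * |h|) := by gcongr
    have h3 : |h| * (2 * (a * D + 1) * 1) ≤ |h| * (2 * (a * D + 1) * (T + 1)) := by
      gcongr; linarith
    have h4 : |h| * (2 * (a * D + 1) * 1) = 2 * (a * (D * |h|)) + 2 * |h| := by ring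
    linarith [abs_nonneg h]
  have hbin : (1 + ε) ^ a ≤ 1 + a * ε + (a * ε) ^ 2 := by
    rw [Real.rpow_def_of_pos (by linarith)]
    have h1 : Real.log (1 + ε) * a ≤ a * ε := by
      have := Real.log_le_sub_one_of_pos (show 0 < 1 + ε by linarith)
      have h2 := mul_le_mul_of_nonneg_right this ha0.le
      linarith
    have h2 := abs_le.1 (Real.abs_exp_sub_one_sub_id_le (x := a * ε) (by linarith))
    linarith [Real.exp_le_exp.2 h1, h2.2]
  obtain ⟨y, hy⟩ : ∃ y, y = t * (a * ε + (a * ε) ^ 2) := ⟨_, rfl⟩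
  have hyb : |y| ≤ 2 * T * a * (D * |h|) := by
    rw [hy, abs_mul, abs_of_nonneg ht0]
    have e1 : |a * ε + (a * ε) ^ 2| ≤ 2 * (a * |ε|) := by
      refine (abs_add_le _ _).trans ?_
      rw [abs_pow]
      have e3 : |a * ε| = a * |ε| := by rw [abs_mul, abs_of_pos ha0]
      have e4 : |a * ε| ^ 2 ≤ |a * ε| := by
        rw [sq]; exact mul_le_of_le_one_left (abs_nonneg _) (by linarith)
      linarith
    calc t * |a * ε + (a * ε) ^ 2| ≤ T * (2 * (a * |ε|)) := by gcongr
      _ ≤ T * (2 * (a * (D * |h|))) := by gcongr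
      _ = _ := by ring
  have hy1 : |y| ≤ 1 := by
    refine hyb.trans (le_trans ?_ hh2.le)
    have : |h| * (2 * (a * D + 1) * (T + 1)) - 2 * T * a * (D * |h|) =
      |h| * (2 * a * D + 2 * (T + 1)) := by ring
    have h0 : 0 ≤ |h| * (2 * a * D + 2 * (T + 1)) := by positivity
    linarith
  have hy2 : y ^ 2 ≤ 4 * T ^ 2 * a ^ 2 * D ^ 2 * h ^ 2 := by
    rw [← sq_abs y, ← sq_abs h]
    calc |y| ^ 2 ≤ (2 * T * a * (D * |h|)) ^ 2 := by gcongr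
      _ = _ := by ring
  have hexp : Real.exp (t * (1 + ε) ^ a) ≤ Real.exp t * (1 + y + y ^ 2) := by
    have h2 := abs_le.1 (Real.abs_exp_sub_one_sub_id_le hy1)
    calc Real.exp (t * (1 + ε) ^ a) ≤ Real.exp (t + y) := by
          refine Real.exp_le_exp.2 ?_
          have := mul_le_mul_of_nonneg_left hbin ht0
          rw [hy]; linarith
      _ = Real.exp t * Real.exp y := Real.exp_add _ _
      _ ≤ _ := by gcongr; linarith [h2.2]
  have hyexp : y ≤ t * a * (2 * h * A) + T * a * D ^ 2 * h ^ 2 + T * a ^ 2 * D ^ 2 * h ^ 2 := by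
    have e1 : y = t * a * (2 * h * A) + t * a * (h ^ 2 * ω) + t * a ^ 2 * ε ^ 2 := by
      rw [hy, hε]; ring
    have e2 : t * a * (h ^ 2 * ω) ≤ T * a * (h ^ 2 * D ^ 2) := by
      calc t * a * (h ^ 2 * ω) ≤ t * a * (h ^ 2 * D ^ 2) := by gcongr
        _ ≤ _ := by gcongr
    have e3 : t * a ^ 2 * ε ^ 2 ≤ T * a ^ 2 * (D ^ 2 * h ^ 2) := by gcongr
    rw [e1]; linarith
  have hexpT : Real.exp t ≤ Real.exp T := Real.exp_le_exp.2 htT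
  calc _ ≤ Real.exp t * (1 + y + y ^ 2) := hexp
    _ ≤ Real.exp t * (1 + (t * a * (2 * h * A) + T * a * D ^ 2 * h ^ 2 + T * a ^ 2 * D ^ 2 * h ^ 2)
        + 4 * T ^ 2 * a ^ 2 * D ^ 2 * h ^ 2) := by gcongr
    _ = Real.exp t + h * (Real.exp t * (t * a * (2 * A))) + Real.exp t * ((T * a * D ^ 2 +
        T * a ^ 2 * D ^ 2 + 4 * T ^ 2 * a ^ 2 * D ^ 2) * h ^ 2) := by ring
    _ ≤ Real.exp t + h * (Real.exp t * (t * a * (2 * A))) + Real.exp T * ((T * a * D ^ 2 +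
        T * a ^ 2 * D ^ 2 + 4 * T ^ 2 * a ^ 2 * D ^ 2) * h ^ 2) := by gcongr
    _ = _ := by ring

theorem FF_taylor {p : ℝ} (hp : 1 < p) (M C : ℝ) (hC : 0 ≤ C) : ∃ K > 0, ∃ δ > 0, ∀ (z w : V) (h : ℝ),
    ‖z‖ ≤ M → ‖w‖ ≤ C * ‖z‖ → |h| < δ →
      FF p (z + h • w) ≤ FF p z + h * (aa p z * inner ℝ z w) + K * h ^ 2 := by
  obtain ⟨T, hT⟩ : ∃ T, T = (max M 0) ^ p := ⟨_, rfl⟩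
  have hT0 : 0 ≤ T := by rw [hT]; positivity
  obtain ⟨D, hD⟩ : ∃ D, D = 2 * C + C ^ 2 + 1 := ⟨_, rfl⟩
  have hD1 : 1 ≤ D := by nlinarith [sq_nonneg C]
  have hCD : C ^ 2 ≤ D ^ 2 := by gcongr; nlinarith
  obtain ⟨a, ha⟩ : ∃ a, a = p / 2 := ⟨_, rfl⟩
  have ha0 : 0 < a := by linarith
  refine ⟨Real.exp T * (T * a * D ^ 2 + T * a ^ 2 * D ^ 2 + 4 * T ^ 2 * a ^ 2 * D ^ 2) + 1,
    by positivity, min (1 / (2 * D)) (1 / (2 * (a * D + 1) * (T + 1))), by positivity,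
    fun z w h hz hw hh => ?_⟩
  have hh1 : |h| * D < 1 / 2 := by
    have := hh.trans_le (min_le_left _ _)
    rw [lt_div_iff₀ (by positivity)] at this; linarith
  have hh2 : |h| * (2 * (a * D + 1) * (T + 1)) < 1 := by
    have := hh.trans_le (min_le_right _ _)
    rw [lt_div_iff₀ (by positivity)] at this; linarith
  rcases eq_or_ne z 0 with rfl | hz0
  · have : w = 0 := by simpa using hw
    subst this; simp
    positivity
  have hzp : 0 < ‖z‖ := norm_pos_iff.2 hz0
  obtain ⟨A, hA⟩ : ∃ A, A = inner ℝ z w / ‖z‖ ^ 2 := ⟨_, rfl⟩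
  obtain ⟨ω, hω⟩ : ∃ ω, ω = ‖w‖ ^ 2 / ‖z‖ ^ 2 := ⟨_, rfl⟩
  obtain ⟨ε, hε⟩ : ∃ ε, ε = 2 * h * A + h ^ 2 * ω := ⟨_, rfl⟩
  have hAC : |A| ≤ C := by
    rw [hA, abs_div, abs_of_pos (by positivity : 0 < ‖z‖ ^ 2), div_le_iff₀ (by positivity)]
    calc _ ≤ ‖z‖ * ‖w‖ := abs_real_inner_le_norm z w
      _ ≤ ‖z‖ * (C * ‖z‖) := by gcongr
      _ = _ := by ring
  have hwz : ω ≤ C ^ 2 := by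
    rw [hω, div_le_iff₀ (by positivity), ← mul_pow]; gcongr
  have hwz0 : 0 ≤ ω := by rw [hω]; positivity
  have hhs : |h| ≤ 1 := by nlinarith [abs_nonneg h]
  have hεD : |ε| ≤ D * |h| := by
    have e1 : |2 * h * A| ≤ 2 * |h| * C := by
      rw [abs_mul, abs_mul, abs_two]; gcongr
    have e2 : |h ^ 2 * ω| ≤ |h| * C ^ 2 := by
      rw [abs_mul, abs_of_nonneg hwz0, abs_pow]
      have : |h| ^ 2 ≤ |h| := by nlinarith [abs_nonneg h]
      gcongr
    rw [hε]
    refine (abs_add_le _ _).trans ((add_le_add e1 e2).trans ?_)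
    rw [hD]; nlinarith [abs_nonneg h]
  have hε3 : -(1 / 2) < ε := (abs_lt.1 (by linarith : |ε| < 1 / 2)).1
  obtain ⟨t, ht⟩ : ∃ t, t = ‖z‖ ^ p := ⟨_, rfl⟩
  have ht0 : 0 ≤ t := by rw [ht]; positivity
  have htT : t ≤ T := by
    rw [ht, hT]
    exact Real.rpow_le_rpow (norm_nonneg _) (hz.trans (le_max_left _ _)) (by linarith)
  have hnorm : ‖z + h • w‖ ^ 2 = ‖z‖ ^ 2 * (1 + ε) := by
    rw [norm_add_sq_real, inner_smul_right, norm_smul, mul_pow, Real.norm_eq_abs, sq_abs, hε, hA, hω]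
    field_simp
    ring
  have hnormp : ‖z + h • w‖ ^ p = t * (1 + ε) ^ a := by
    have e1 : ∀ y : ℝ, 0 ≤ y → y ^ p = (y ^ 2) ^ a := fun y hy => by
      rw [← Real.rpow_natCast, ← Real.rpow_mul hy]; congr 1; rw [ha]; push_cast; ring
    rw [e1 _ (norm_nonneg _), hnorm, Real.mul_rpow (by positivity) (by linarith), ← e1 _ hzp.le, ht]
  have hlin : aa p z * inner ℝ z w = Real.exp t * (t * a * (2 * A)) := by
    have e1 : ‖z‖ ^ (p - 2) = t / ‖z‖ ^ 2 := by
      rw [ht, Real.rpow_sub hzp]; norm_num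
    simp only [aa, FF, e1, hA, ha, ← ht]; field_simp
  have key := exp_taylor_aux ha0 ht0 htT hD1 hε (hwz.trans hCD) hεD hh1 hh2
  rw [hlin, FF, FF, hnormp, ← ht]
  nlinarith [sq_nonneg h]

/-- The gradient of the integrand. -/
def sig (p : ℝ) (z : V) : V := aa p z • z

theorem contDiffAt_aa {p : ℝ} (hp : 1 < p) {z : V} (hz : z ≠ 0) : ContDiffAt ℝ 1 (aa p : V → ℝ) z := by
  have h1 : ContDiffAt ℝ 1 (fun z : V => ‖z‖ ^ (p - 2)) z :=
    (contDiffAt_norm ℝ hz).rpow_const_of_ne (norm_ne_zero_iff.2 hz)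
  exact (contDiffAt_const.mul h1).mul (contDiff_FF hp).contDiffAt

theorem contDiffAt_sig {p : ℝ} (hp : 1 < p) {z : V} (hz : z ≠ 0) : ContDiffAt ℝ 1 (sig p : V → V) z :=
  (contDiffAt_aa hp hz).smul contDiffAt_id

theorem norm_sig_le {p : ℝ} (hp : 1 < p) {M : ℝ} {z : V} (hz : ‖z‖ ≤ M) :
    ‖sig p z‖ ≤ p * M ^ (p - 1) * Real.exp (M ^ p) := by
  have hM : 0 ≤ M := (norm_nonneg z).trans hz
  rcases eq_or_ne z 0 with rfl | hz0
  · simp only [sig, smul_zero, norm_zero]; positivity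
  have hzp : 0 < ‖z‖ := norm_pos_iff.2 hz0
  have e : ‖sig p z‖ = p * ‖z‖ ^ (p - 1) * Real.exp (‖z‖ ^ p) := by
    rw [sig, norm_smul, aa, Real.norm_of_nonneg (by unfold FF; positivity), FF]
    have : ‖z‖ ^ (p - 1) = ‖z‖ ^ (p - 2) * ‖z‖ := by
      rw [← Real.rpow_add_one hzp.ne']; congr 1; ring
    rw [this]; ring
  rw [e]
  have h1 : ‖z‖ ^ (p - 1) ≤ M ^ (p - 1) := Real.rpow_le_rpow (norm_nonneg _) hz (by linarith)
  have h2 : ‖z‖ ^ p ≤ M ^ p := Real.rpow_le_rpow (norm_nonneg _) hz (by linarith)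
  gcongr

theorem norm_sig_sub_le [FiniteDimensional ℝ V] {p : ℝ} (hp : 1 < p) (M : ℝ) :
    ∃ C ≥ 0, ∀ α β : V, 1 ≤ ‖α‖ → ‖α‖ ≤ M → ‖β‖ ≤ M → ‖sig p β - sig p α‖ ≤ C * ‖β - α‖ := by
  have hcomp : IsCompact (closedBall (0 : V) M ∩ (ball 0 (1 / 2))ᶜ) :=
    (isCompact_closedBall _ _).inter_right isOpen_ball.isClosed_compl
  have hne : ∀ z ∈ closedBall (0 : V) M ∩ (ball 0 (1 / 2))ᶜ, z ≠ 0 := by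
    rintro z ⟨-, hz⟩ rfl
    simp at hz
  have hcont : ContinuousOn (fun z : V => ‖fderiv ℝ (sig p) z‖)
      (closedBall (0 : V) M ∩ (ball 0 (1 / 2))ᶜ) := fun z hz =>
    ((contDiffAt_sig hp (hne z hz)).continuousAt_fderiv one_ne_zero).norm.continuousWithinAt
  obtain ⟨C, hC⟩ := hcomp.bddAbove_image hcont
  rw [mem_upperBounds] at hC
  obtain ⟨L, hL⟩ : ∃ L, L = p * M ^ (p - 1) * Real.exp (M ^ p) := ⟨_, rfl⟩
  refine ⟨max C 0 + 4 * |L|, by positivity, fun α β h1 hα hβ => ?_⟩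
  rcases le_or_gt (1 / 2) ‖β - α‖ with h | h
  · have h3 := norm_sig_le hp hα
    have h4 := norm_sig_le hp hβ
    rw [← hL] at h3 h4
    calc _ ≤ ‖sig p β‖ + ‖sig p α‖ := norm_sub_le _ _
      _ ≤ 4 * |L| * (1 / 2) := by linarith [le_abs_self L]
      _ ≤ 4 * |L| * ‖β - α‖ := by gcongr
      _ ≤ _ := by gcongr; linarith [le_max_right C 0]
  · have hseg : segment ℝ α β ⊆ closedBall (0 : V) M ∩ (ball 0 (1 / 2))ᶜ := by
      intro z hz
      refine ⟨(convex_closedBall (0 : V) M).segment_subset (by simpa) (by simpa) hz, ?_⟩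
      have : ‖z - α‖ ≤ ‖β - α‖ := by
        have h5 := (convex_closedBall α ‖β - α‖).segment_subset (by simp)
          (by simp [dist_eq_norm]) hz
        simpa [dist_eq_norm] using h5
      simp only [mem_compl_iff, mem_ball, dist_zero_right, not_lt]
      have h6 := norm_sub_norm_le α z
      rw [norm_sub_rev] at h6
      linarith
    have := (convex_segment α β).norm_image_sub_le_of_norm_hasFDerivWithin_le (𝕜 := ℝ)
      (f := sig p) (f' := fderiv ℝ (sig p)) (C := max C 0) (x := α) (y := β)
      (fun z hz => ((contDiffAt_sig hp (hne z (hseg hz))).differentiableAt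
        one_ne_zero).hasFDerivAt.hasFDerivWithinAt)
      (fun z hz => (hC _ (mem_image_of_mem _ (hseg hz))).trans (le_max_left _ _))
      (left_mem_segment ℝ α β) (right_mem_segment ℝ α β)
    refine this.trans ?_
    gcongr
    linarith [abs_nonneg L]

end

section

open Filter Topology

theorem exists_abs_deriv_smoothTransition_le :
    ∃ C > 0, ∀ x, |deriv Real.smoothTransition x| ≤ C := by
  have hc : Continuous (deriv Real.smoothTransition) :=
    (Real.smoothTransition.contDiff (n := 1)).continuous_deriv le_rfl
  obtain ⟨C, hC⟩ := (isCompact_Icc (a := (0 : ℝ)) (b := 1)).bddAbove_image hc.abs.continuousOn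
  rw [mem_upperBounds] at hC
  refine ⟨max C 1, by positivity, fun x => ?_⟩
  by_cases hx : x ∈ Icc (0 : ℝ) 1
  · exact (hC _ (mem_image_of_mem _ hx)).trans (le_max_left _ _)
  · have : deriv Real.smoothTransition x = 0 := by
      rcases lt_or_ge x 0 with h | h
      · have : Real.smoothTransition =ᶠ[𝓝 x] fun _ => 0 := by
          filter_upwards [Iio_mem_nhds h] with y hy
          exact Real.smoothTransition.zero_of_nonpos (le_of_lt hy)
        rw [this.deriv_eq]; simp
      · have h1 : 1 < x := by
          by_contra h1
          exact hx ⟨h, not_lt.1 h1⟩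
        have : Real.smoothTransition =ᶠ[𝓝 x] fun _ => 1 := by
          filter_upwards [Ioi_mem_nhds h1] with y hy
          exact Real.smoothTransition.one_of_one_le (le_of_lt hy)
        rw [this.deriv_eq]; simp
    rw [this]; simp

/-- Smooth cutoff functions between concentric balls, with the natural gradient bound. -/
theorem exists_cutoff : ∃ C > 0, ∀ (n : ℕ) (x₀ : Eu n) (ρ R : ℝ), 0 < ρ → ρ < R →
    ∃ η : Eu n → ℝ, ContDiff ℝ (⊤ : ℕ∞) η ∧ (∀ x, 0 ≤ η x) ∧ (∀ x, η x ≤ 1) ∧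
      (∀ x ∈ closedBall x₀ ρ, η x = 1) ∧ (∀ x ∉ closedBall x₀ R, η x = 0) ∧
      ∀ x, ‖fderiv ℝ η x‖ ≤ C / (R - ρ) := by
  obtain ⟨C, hC0, hC⟩ := exists_abs_deriv_smoothTransition_le
  refine ⟨2 * C, by positivity, fun n x₀ ρ R hρ hR => ?_⟩
  have hd : 0 < R ^ 2 - ρ ^ 2 := by nlinarith
  have hq : ContDiff ℝ (⊤ : ℕ∞) fun x : Eu n => (R ^ 2 - ‖x - x₀‖ ^ 2) / (R ^ 2 - ρ ^ 2) := by
    have : ContDiff ℝ (⊤ : ℕ∞) fun x : Eu n => ‖x - x₀‖ ^ 2 := (contDiff_id.sub contDiff_const).norm_sq ℝ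
    exact (contDiff_const.sub this).div_const _
  refine ⟨fun x => Real.smoothTransition ((R ^ 2 - ‖x - x₀‖ ^ 2) / (R ^ 2 - ρ ^ 2)),
    Real.smoothTransition.contDiff.comp hq, fun x => Real.smoothTransition.nonneg _,
    fun x => Real.smoothTransition.le_one _, fun x hx => ?_, fun x hx => ?_, fun x => ?_⟩
  · refine Real.smoothTransition.one_of_one_le ?_
    rw [mem_closedBall, dist_eq_norm] at hx
    rw [le_div_iff₀ hd, one_mul]
    gcongr
  · refine Real.smoothTransition.zero_of_nonpos ?_
    rw [mem_closedBall, dist_eq_norm, not_le] at hx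
    refine div_nonpos_of_nonpos_of_nonneg ?_ hd.le
    have : R ^ 2 ≤ ‖x - x₀‖ ^ 2 := by gcongr; linarith
    linarith
  · by_cases hx : ‖x - x₀‖ ≤ R
    · have h1 : HasFDerivAt (fun x : Eu n => ‖x - x₀‖ ^ 2) (2 • (innerSL ℝ (x - x₀))) x := by
        have := ((hasFDerivAt_id x).sub_const x₀).norm_sq
        simpa using this
      have h2 := (h1.const_sub (R ^ 2)).mul_const (R ^ 2 - ρ ^ 2)⁻¹
      have h3 : HasDerivAt Real.smoothTransition _ ((R ^ 2 - ‖x - x₀‖ ^ 2) * (R ^ 2 - ρ ^ 2)⁻¹) :=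
        ((Real.smoothTransition.contDiff (n := 1)).differentiable one_ne_zero _).hasDerivAt
      have h4 := h3.comp_hasFDerivAt x h2
      have h5 : (fun x : Eu n => Real.smoothTransition ((R ^ 2 - ‖x - x₀‖ ^ 2) / (R ^ 2 - ρ ^ 2))) =
        Real.smoothTransition ∘ fun x : Eu n => (R ^ 2 - ‖x - x₀‖ ^ 2) * (R ^ 2 - ρ ^ 2)⁻¹ := by
        ext; simp [div_eq_mul_inv]
      rw [h5, h4.fderiv, norm_smul, norm_smul, norm_neg, ← Nat.cast_smul_eq_nsmul ℝ, norm_smul,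
        innerSL_apply_norm]
      have h6 : ‖(R ^ 2 - ρ ^ 2)⁻¹‖ = ((R - ρ) * (R + ρ))⁻¹ := by
        rw [Real.norm_of_nonneg (by positivity)]; congr 1; ring
      have h7 : (0 : ℝ) < R - ρ := by linarith
      have h8 : (0 : ℝ) < R + ρ := by linarith
      rw [h6]
      calc _ ≤ C * (((R - ρ) * (R + ρ))⁻¹ * (2 * R)) := by
            gcongr
            · exact hC _
            · simp
        _ ≤ C * (((R - ρ) * (R + ρ))⁻¹ * (2 * (R + ρ))) := by gcongr; linarith
        _ = _ := by field_simp
    · have : (fun x : Eu n => Real.smoothTransition ((R ^ 2 - ‖x - x₀‖ ^ 2) / (R ^ 2 - ρ ^ 2)))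
          =ᶠ[𝓝 x] fun _ => 0 := by
        have ho : IsOpen {x : Eu n | R < ‖x - x₀‖} := isOpen_lt continuous_const (by fun_prop)
        filter_upwards [ho.mem_nhds (not_le.1 hx)] with y hy
        refine Real.smoothTransition.zero_of_nonpos (div_nonpos_of_nonpos_of_nonneg ?_ hd.le)
        have : R ^ 2 ≤ ‖y - x₀‖ ^ 2 := by
          have : R < ‖y - x₀‖ := hy
          have : 0 ≤ R := by linarith
          gcongr
        linarith
      rw [this.fderiv_eq]
      simp
      have : 0 < R - ρ := by linarith
      positivity

/-- Shear maps with small amplitude are changes of variables. -/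
theorem exists_shear {n : ℕ} {η : Eu n → ℝ} (hη : ContDiff ℝ 1 η) {C : ℝ≥0} (hC : ∀ x, ‖fderiv ℝ η x‖₊ ≤ C)
    (s : Fin n) {h : ℝ} (hh : |h| * C < 1) :
    (∀ x, 0 < 1 + h * fderiv ℝ η x (ee s)) ∧
    (∀ P : Eu n → Prop, (∀ᵐ y, P y) → ∀ᵐ x, P (x + (h * η x) • ee s)) ∧
    (∀ G : Eu n → ℝ, ∫ x, (1 + h * fderiv ℝ η x (ee s)) * G (x + (h * η x) • ee s) = ∫ y, G y) ∧
    ∀ G : Eu n → ℝ, Integrable G → Integrable fun x =>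
      (1 + h * fderiv ℝ η x (ee s)) * G (x + (h * η x) • ee s) := by
  have he : ‖(ee s : Eu n)‖ = 1 := by simp [ee]
  have hpos : ∀ x, 0 < 1 + h * fderiv ℝ η x (ee s) := fun x => by
    have h1 : |fderiv ℝ η x (ee s)| ≤ C := by
      have := (fderiv ℝ η x).le_opNorm (ee s)
      rw [he, mul_one] at this
      exact this.trans (by exact_mod_cast hC x)
    have h2 : |h * fderiv ℝ η x (ee s)| < 1 := by
      rw [abs_mul]
      exact lt_of_le_of_lt (by gcongr) hh
    linarith [(abs_lt.1 h2).1]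
  set Ψ : Eu n → Eu n := fun x => x + (h * η x) • ee s with hΨ
  set Ψ' : Eu n → Eu n →L[ℝ] Eu n := fun x =>
    ContinuousLinearMap.id ℝ _ + (h • fderiv ℝ η x).smulRight (ee s) with hΨ'
  have hd : ∀ x, HasFDerivAt Ψ (Ψ' x) x := fun x => by
    have h1 : HasFDerivAt (fun x => h * η x) (h • fderiv ℝ η x) x :=
      (hη.differentiable one_ne_zero x).hasFDerivAt.const_mul h
    exact (hasFDerivAt_id x).add (h1.smul_const (ee s))
  have hdet : ∀ x, (Ψ' x).det = 1 + h * fderiv ℝ η x (ee s) := fun x => by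
    have : ((Ψ' x : Eu n →L[ℝ] Eu n) : Eu n →ₗ[ℝ] Eu n) =
        LinearMap.transvection (h • (fderiv ℝ η x : Eu n →ₗ[ℝ] ℝ)) (ee s) := by
      ext y
      simp [hΨ', LinearMap.transvection]
    rw [ContinuousLinearMap.det, this, LinearMap.transvection.det]
    simp
  have hlip : LipschitzWith C η := lipschitzWith_of_nnnorm_fderiv_le
    (hη.differentiable one_ne_zero) hC
  have happ : ApproximatesLinearOn Ψ ((ContinuousLinearEquiv.refl ℝ (Eu n) : Eu n ≃L[ℝ] Eu n) : Eu n →L[ℝ] Eu n)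
      univ (‖h‖₊ * C) := by
    refine LipschitzOnWith.approximatesLinearOn (lipschitzOnWith_univ.2 ?_)
    refine LipschitzWith.of_dist_le_mul fun x y => ?_
    have := hlip.dist_le_mul x y
    rw [Real.dist_eq] at this
    simp only [hΨ, dist_eq_norm, Pi.sub_apply, ContinuousLinearEquiv.coe_refl,
      ContinuousLinearMap.coe_id', id, add_sub_cancel_left]
    rw [← sub_smul, norm_smul, he, mul_one, ← mul_sub, norm_mul, Real.norm_eq_abs (η x - η y)]
    push_cast
    rw [mul_assoc]
    gcongr
    rwa [dist_eq_norm] at this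
  have hc : Subsingleton (Eu n) ∨ ‖h‖₊ * C <
      ‖((ContinuousLinearEquiv.refl ℝ (Eu n)).symm : Eu n →L[ℝ] Eu n)‖₊⁻¹ := by
    right
    have hnt : Nontrivial (Eu n) := ⟨⟨ee s, 0, by rw [← norm_ne_zero_iff, he]; simp⟩⟩
    have h1 : ‖((ContinuousLinearEquiv.refl ℝ (Eu n)).symm : Eu n →L[ℝ] Eu n)‖₊ = 1 := by
      simp only [ContinuousLinearEquiv.refl_symm, ContinuousLinearEquiv.coe_refl]
      exact ContinuousLinearMap.nnnorm_id
    rw [h1, inv_one]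
    have : ((‖h‖₊ * C : ℝ≥0) : ℝ) < 1 := by push_cast; simpa using hh
    exact_mod_cast this
  have hinj : InjOn Ψ univ := happ.injOn hc
  have hsurj : Ψ '' univ = univ := by rw [image_univ]; exact (happ.surjective hc).range_eq
  refine ⟨hpos, fun P hP => ?_, fun G => ?_, fun G hG => ?_⟩
  · have hm : Measurable Ψ := by
      have : Continuous Ψ := continuous_iff_continuousAt.2 fun x => (hd x).continuousAt
      exact this.measurable
    set T := toMeasurable volume {y | ¬ P y}
    have hT : volume T = 0 := by rw [measure_toMeasurable]; exact hP
    have h1 := lintegral_abs_det_fderiv_eq_addHaar_image volume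
      (hm (measurableSet_toMeasurable volume {y | ¬ P y}))
      (fun x _ => (hd x).hasFDerivWithinAt) (hinj.mono (subset_univ _))
    have h2 : volume (Ψ '' (Ψ ⁻¹' T)) = 0 := measure_mono_null (image_preimage_subset _ _) hT
    rw [h2] at h1
    have hmeas : Measurable fun x => ENNReal.ofReal |(Ψ' x).det| := by
      simp only [hdet]
      have : Continuous fun x => fderiv ℝ η x (ee s) :=
        (hη.continuous_fderiv one_ne_zero).clm_apply continuous_const
      fun_prop
    rw [lintegral_eq_zero_iff hmeas] at h1
    have h3 : ∀ᵐ x ∂volume.restrict (Ψ ⁻¹' T), False := by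
      filter_upwards [h1] with x hx
      simp only [Pi.zero_apply, ENNReal.ofReal_eq_zero, hdet] at hx
      have := abs_pos.2 (hpos x).ne'
      linarith
    have h4 : volume (Ψ ⁻¹' T) = 0 := by
      rw [ae_iff] at h3
      simpa using h3
    refine measure_mono_null (fun x hx => ?_) h4
    exact subset_toMeasurable volume _ hx
  · have := integral_image_eq_integral_abs_det_fderiv_smul volume MeasurableSet.univ
      (fun x _ => (hd x).hasFDerivWithinAt) hinj G
    rw [hsurj, setIntegral_univ, setIntegral_univ] at this
    rw [this]
    refine integral_congr_ae (Eventually.of_forall fun x => ?_)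
    simp only [hdet, abs_of_pos (hpos x), smul_eq_mul, hΨ]
  · have := (integrableOn_image_iff_integrableOn_abs_det_fderiv_smul volume MeasurableSet.univ
      (fun x _ => (hd x).hasFDerivWithinAt) hinj G).1 (by rwa [hsurj, integrableOn_univ])
    rw [integrableOn_univ] at this
    refine this.congr (Eventually.of_forall fun x => ?_)
    simp only [hdet, abs_of_pos (hpos x), smul_eq_mul, hΨ]

end

section

open Filter Topology

/-- Matrices with the Frobenius norm. -/
abbrev Mat (n N : ℕ) := EuclideanSpace ℝ (Fin n × Fin N)

/-- The Jacobian matrix of a map given by its components. -/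
def grd {n N : ℕ} (U : Fin N → Eu n → ℝ) (x : Eu n) : Mat n N :=
  WithLp.toLp 2 fun q => fderiv ℝ (U q.2) x (ee q.1)

theorem grd_apply {n N : ℕ} (U : Fin N → Eu n → ℝ) (x : Eu n) (i : Fin n) (α : Fin N) :
    grd U x (i, α) = fderiv ℝ (U α) x (ee i) := rfl

theorem measurable_grd {n N : ℕ} (U : Fin N → Eu n → ℝ) : Measurable (grd U) :=
  (WithLp.measurable_toLp 2 _).comp
    (measurable_pi_lambda _ fun q => measurable_fderiv_apply_const ℝ (U q.2) (ee q.1))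

theorem norm_ee {n : ℕ} (i : Fin n) : ‖(ee i : Eu n)‖ = 1 := by simp [ee]

theorem exists_norm_grd_le {n N : ℕ} {U : Fin N → Eu n → ℝ} (hU : ∀ α, ∃ C, LipschitzWith C (U α)) :
    ∃ M, ∀ x, ‖grd U x‖ ≤ M := by
  choose C hC using hU
  refine ⟨√(∑ q : Fin n × Fin N, (C q.2 : ℝ) ^ 2), fun x => ?_⟩
  rw [EuclideanSpace.norm_eq]
  gcongr with q
  have := (fderiv ℝ (U q.2) x).le_of_opNorm_le (norm_fderiv_le_of_lipschitz ℝ (hC q.2)) (ee q.1)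
  rwa [norm_ee, mul_one] at this

/-- Globally Lipschitz maps (with gradient bounded by `M`) minimizing the exponential energy in the
ball `ball x₀ r` among Lipschitz competitors which agree outside a smaller ball. -/
structure LMin {n N : ℕ} (p : ℝ) (U : Fin N → Eu n → ℝ) (x₀ : Eu n) (r M : ℝ) : Prop where
  lip : ∀ α, ∃ C, LipschitzWith C (U α)
  bdd : ∀ x, ‖grd U x‖ ≤ M
  minimal : ∀ W : Fin N → Eu n → ℝ, (∀ α, ∃ C, LipschitzWith C (W α)) → ∀ ρ < r,
    (∀ α, ∀ x ∉ closedBall x₀ ρ, W α x = U α x) →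
    ∫ x in ball x₀ r, FF p (grd U x) ≤ ∫ x in ball x₀ r, FF p (grd W x)

theorem ae_differentiableAt {n N : ℕ} {U : Fin N → Eu n → ℝ} (hU : ∀ α, ∃ C, LipschitzWith C (U α)) :
    ∀ᵐ x, ∀ α, DifferentiableAt ℝ (U α) x := by
  rw [ae_all_iff]
  intro α
  obtain ⟨C, hC⟩ := hU α
  exact hC.ae_differentiableAt

theorem continuous_FF {p : ℝ} (hp : 1 < p) {V : Type*} [NormedAddCommGroup V] [InnerProductSpace ℝ V] :
    Continuous (FF p : V → ℝ) := (contDiff_FF hp).continuous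

theorem FF_le {p : ℝ} (hp : 1 < p) {V : Type*} [NormedAddCommGroup V] {z : V} {M : ℝ} (hz : ‖z‖ ≤ M) :
    FF p z ≤ Real.exp (M ^ p) :=
  Real.exp_le_exp.2 (Real.rpow_le_rpow (norm_nonneg _) hz (by linarith))

theorem measurable_sig {p : ℝ} (hp : 1 < p) {n N : ℕ} : Measurable (sig p : Mat n N → Mat n N) := by
  have : Measurable (aa p : Mat n N → ℝ) := by
    unfold aa
    exact (measurable_const.mul (measurable_norm.pow_const _)).mul (continuous_FF hp).measurable
  exact this.smul measurable_id

/-- The Euler-Lagrange system. -/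
theorem LMin.euler {n N : ℕ} {p : ℝ} (hp : 1 < p) {U : Fin N → Eu n → ℝ} {x₀ : Eu n} {r M : ℝ}
    (H : LMin p U x₀ r M) (α : Fin N) {ρ : ℝ} (hρ : ρ < r) {ζ : Eu n → ℝ} (hζ : ContDiff ℝ 1 ζ)
    (hζ0 : ∀ x ∉ closedBall x₀ ρ, ζ x = 0) :
    ∑ i, ∫ x, sig p (grd U x) (i, α) * fderiv ℝ ζ x (ee i) = 0 := by
  classical
  have hcs : HasCompactSupport ζ :=
    HasCompactSupport.intro (isCompact_closedBall x₀ ρ) fun x hx => hζ0 x hx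
  obtain ⟨Cζ, hCζ⟩ := hζ.lipschitzWith_of_hasCompactSupport hcs one_ne_zero
  set Z : Eu n → Mat n N := fun x => WithLp.toLp 2 fun q => if q.2 = α then fderiv ℝ ζ x (ee q.1) else 0
    with hZ
  have hZm : Measurable Z := by
    refine (WithLp.measurable_toLp 2 _).comp (measurable_pi_lambda _ fun q => ?_)
    split_ifs
    · exact measurable_fderiv_apply_const ℝ ζ (ee q.1)
    · exact measurable_const
  obtain ⟨MZ, hMZ⟩ : ∃ MZ, ∀ x, ‖Z x‖ ≤ MZ := by
    refine ⟨√(∑ q : Fin n × Fin N, (Cζ : ℝ) ^ 2), fun x => ?_⟩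
    rw [EuclideanSpace.norm_eq]
    gcongr with q
    have := (fderiv ℝ ζ x).le_of_opNorm_le (norm_fderiv_le_of_lipschitz ℝ hCζ) (ee q.1)
    rw [norm_ee, mul_one] at this
    simp only [hZ]
    split_ifs
    · exact this
    · simp
  have hMZ0 : 0 ≤ MZ := (norm_nonneg _).trans (hMZ x₀)
  have hfin : IsFiniteMeasure (volume.restrict (ball x₀ r)) := ⟨by
    rw [Measure.restrict_apply_univ]; exact measure_ball_lt_top⟩
  set g : ℝ → ℝ := fun h => ∫ x in ball x₀ r, FF p (grd U x + h • Z x) with hg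
  have hmin : IsLocalMin g 0 := by
    refine Eventually.of_forall fun h => ?_
    have h1 := H.minimal (fun β x => U β x + h * if β = α then ζ x else 0) (fun β => by
        obtain ⟨C, hC⟩ := H.lip β
        by_cases hβ : β = α
        · refine ⟨C + ‖h‖₊ * Cζ, ?_⟩
          simp only [hβ, if_true]
          rw [hβ] at hC
          refine hC.add ?_
          refine LipschitzWith.of_dist_le_mul fun x y => ?_
          have := hCζ.dist_le_mul x y
          rw [Real.dist_eq] at this ⊢
          rw [← mul_sub, abs_mul]
          push_cast
          rw [mul_assoc, Real.norm_eq_abs]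
          gcongr
        · refine ⟨C, ?_⟩
          simpa [hβ] using hC) ρ hρ (fun β x hx => by simp [hζ0 x hx])
    have h2 : ∀ᵐ x, grd (fun β x => U β x + h * if β = α then ζ x else 0) x = grd U x + h • Z x := by
      filter_upwards [ae_differentiableAt H.lip] with x hx
      ext ⟨i, β⟩
      simp only [grd_apply, PiLp.add_apply, PiLp.smul_apply, hZ, smul_eq_mul]
      by_cases hβ : β = α
      · simp only [hβ, if_true]
        have h3 := (hx α).hasFDerivAt.add (((hζ.differentiable one_ne_zero) x).hasFDerivAt.const_mul h)
        have h4 : HasFDerivAt (fun x => U α x + h * ζ x) _ x := h3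
        rw [h4.fderiv]
        simp
      · simp [hβ]
    have h3 : ∫ x in ball x₀ r, FF p (grd (fun β x => U β x + h * if β = α then ζ x else 0) x) = g h :=
      integral_congr_ae (ae_restrict_of_ae (h2.mono fun x hx => by simp only [hx]))
    rw [h3] at h1
    simpa [hg] using h1
  have hD : HasDerivAt g (∫ x in ball x₀ r, aa p (grd U x + (0 : ℝ) • Z x) *
      inner ℝ (grd U x + (0 : ℝ) • Z x) (Z x)) 0 := by
    have hbound : ∀ x, ∀ h ∈ ball (0 : ℝ) 1, ‖grd U x + h • Z x‖ ≤ M + MZ := by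
      intro x h hh
      rw [mem_ball_zero_iff] at hh
      calc _ ≤ ‖grd U x‖ + ‖h‖ * ‖Z x‖ := by rw [← norm_smul]; exact norm_add_le _ _
        _ ≤ M + 1 * MZ := by
          gcongr
          · exact H.bdd x
          · exact hMZ x
        _ = _ := by ring
    have hmF : ∀ h : ℝ, AEStronglyMeasurable (fun x => FF p (grd U x + h • Z x))
        (volume.restrict (ball x₀ r)) := fun h =>
      ((continuous_FF hp).measurable.comp ((measurable_grd U).add (hZm.const_smul h))).aestronglyMeasurable
    refine (hasDerivAt_integral_of_dominated_loc_of_deriv_le (μ := volume.restrict (ball x₀ r))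
      (F := fun h x => FF p (grd U x + h • Z x))
      (F' := fun h x => aa p (grd U x + h • Z x) * inner ℝ (grd U x + h • Z x) (Z x))
      (bound := fun _ => p * (M + MZ) ^ (p - 1) * Real.exp ((M + MZ) ^ p) * MZ)
      (ball_mem_nhds _ one_pos) (Eventually.of_forall hmF) ?_ ?_ ?_ ?_ ?_).2
    · refine Integrable.of_bound (hmF 0) (Real.exp ((M + MZ) ^ p)) (Eventually.of_forall fun x => ?_)
      rw [Real.norm_of_nonneg (FF_pos _ _).le]
      exact FF_le hp (hbound x 0 (by simp))
    · have h1 : Measurable fun x => grd U x + (0 : ℝ) • Z x := by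
        simpa using measurable_grd U
      have h2 : Measurable (aa p : Mat n N → ℝ) := by
        unfold aa
        exact (measurable_const.mul (measurable_norm.pow_const _)).mul (continuous_FF hp).measurable
      exact ((h2.comp h1).mul (h1.inner hZm)).aestronglyMeasurable
    · refine Eventually.of_forall fun x h hh => ?_
      rw [← real_inner_smul_left]
      refine (norm_inner_le_norm _ _).trans ?_
      have h0 : 0 ≤ M + MZ := (norm_nonneg _).trans (hbound x h hh)
      gcongr
      · exact norm_sig_le hp (hbound x h hh)
      · exact hMZ x
    · exact integrable_const _
    · refine Eventually.of_forall fun x h _ => ?_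
      have h1 := (hasFDerivAt_FF hp (grd U x + h • Z x)).comp_hasDerivAt h
        (((hasDerivAt_id h).smul_const (Z x)).const_add (grd U x))
      refine h1.congr_deriv ?_
      simp only [one_smul]
      rfl
  have h0 := hmin.hasDerivAt_eq_zero hD
  have hsig : ∀ x, ‖sig p (grd U x)‖ ≤ p * M ^ (p - 1) * Real.exp (M ^ p) := fun x => norm_sig_le hp (H.bdd x)
  have hzero : ∀ x ∉ ball x₀ r, fderiv ℝ ζ x = 0 := fun x hx => by
    have ho : IsOpen (closedBall x₀ ρ)ᶜ := isClosed_closedBall.isOpen_compl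
    have : ζ =ᶠ[𝓝 x] fun _ => 0 := by
      filter_upwards [ho.mem_nhds (show x ∈ (closedBall x₀ ρ)ᶜ from fun h => hx
        (closedBall_subset_ball hρ h))] with y hy
      exact hζ0 y hy
    rw [this.fderiv_eq]; simp
  have hint : ∀ i, Integrable fun x => sig p (grd U x) (i, α) * fderiv ℝ ζ x (ee i) := fun i => by
    have hc : Continuous fun x => fderiv ℝ ζ x (ee i) :=
      (hζ.continuous_fderiv one_ne_zero).clm_apply continuous_const
    refine Integrable.bdd_mul (c := p * M ^ (p - 1) * Real.exp (M ^ p)) ?_ ?_ ?_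
    · refine hc.integrable_of_hasCompactSupport ?_
      refine HasCompactSupport.intro (isCompact_closedBall x₀ r) fun x hx => ?_
      rw [hzero x (fun h => hx (ball_subset_closedBall h))]; simp
    · have : Measurable fun x => sig p (grd U x) (i, α) :=
        (measurable_pi_apply (i, α)).comp ((WithLp.measurable_ofLp 2 _).comp
          ((measurable_sig hp).comp (measurable_grd U)))
      exact this.aestronglyMeasurable
    · exact Eventually.of_forall fun x => (PiLp.norm_apply_le _ _).trans (hsig x)
  rw [← integral_finsetSum _ fun i _ => hint i, ← h0]
  rw [← setIntegral_eq_integral_of_forall_compl_eq_zero (s := ball x₀ r)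
    (fun x hx => by simp [hzero x hx])]
  refine integral_congr_ae (Eventually.of_forall fun x => ?_)
  simp only [zero_smul, add_zero]
  rw [← real_inner_smul_left, PiLp.inner_apply, Fintype.sum_prod_type]
  refine Finset.sum_congr rfl fun i _ => ?_
  rw [Finset.sum_eq_single α]
  · simp [hZ, sig, mul_comm]
  · intro β _ hβ
    simp [hZ, hβ]
  · simp

end

section

open Filter Topology

variable {n N : ℕ}

/-- Inner variation of a map in a coordinate direction. -/
def shift (U : Fin N → Eu n → ℝ) (η : Eu n → ℝ) (s : Fin n) (h : ℝ) (β : Fin N) (x : Eu n) : ℝ :=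
  U β (x + (h * η x) • ee s)

/-- First order change of the gradient under an inner variation. -/
def shiftDer (s : Fin n) (l : Eu n →L[ℝ] ℝ) (z : Mat n N) : Mat n N :=
  WithLp.toLp 2 fun q => l (ee q.1) * z (s, q.2)

/-- The column of the energy-momentum tensor in direction `s`. -/
def emt (p : ℝ) (s : Fin n) (z : Mat n N) : Eu n :=
  (∑ i, (∑ α, sig p z (i, α) * z (s, α)) • ee i) - FF p z • ee s

theorem abs_apply_le {ι : Type*} [Fintype ι] (z : EuclideanSpace ℝ ι) (q : ι) : |z q| ≤ ‖z‖ := by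
  have := PiLp.norm_apply_le z q
  simpa using this

theorem norm_shiftDer_le (s : Fin n) (l : Eu n →L[ℝ] ℝ) (z : Mat n N) :
    ‖shiftDer s l z‖ ≤ n * ‖l‖ * ‖z‖ := by
  refine le_of_sq_le_sq ?_ (by positivity)
  rw [EuclideanSpace.norm_sq_eq, Fintype.sum_prod_type]
  have h1 : ∀ i : Fin n, ∑ α : Fin N, ‖shiftDer s l z (i, α)‖ ^ 2 ≤ ‖l‖ ^ 2 * ‖z‖ ^ 2 := fun i => by
    have h2 : ∑ α, ‖z (s, α)‖ ^ 2 ≤ ‖z‖ ^ 2 := by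
      rw [EuclideanSpace.norm_sq_eq, Fintype.sum_prod_type]
      exact Finset.single_le_sum (f := fun i => ∑ α, ‖z (i, α)‖ ^ 2)
        (fun i _ => by positivity) (Finset.mem_univ s)
    have h3 : ‖l (ee i)‖ ≤ ‖l‖ := by simpa [norm_ee] using l.le_opNorm (ee i)
    calc _ = ‖l (ee i)‖ ^ 2 * ∑ α, ‖z (s, α)‖ ^ 2 := by
          rw [Finset.mul_sum]; simp [shiftDer, mul_pow]
      _ ≤ _ := by gcongr
  calc _ ≤ ∑ i : Fin n, ‖l‖ ^ 2 * ‖z‖ ^ 2 := Finset.sum_le_sum fun i _ => h1 i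
    _ = n * (‖l‖ * ‖z‖) ^ 2 := by simp [mul_pow]
    _ ≤ (n : ℝ) ^ 2 * (‖l‖ * ‖z‖) ^ 2 := by
      gcongr
      exact_mod_cast Nat.le_self_pow two_ne_zero n
    _ = _ := by ring

theorem inner_shiftDer (p : ℝ) (s : Fin n) (l : Eu n →L[ℝ] ℝ) (z : Mat n N) :
    aa p z * inner ℝ z (shiftDer s l z) = l (emt p s z) + FF p z * l (ee s) := by
  simp only [emt, map_sub, map_sum, map_smul, smul_eq_mul, sub_add_cancel]
  rw [← real_inner_smul_left, PiLp.inner_apply, Fintype.sum_prod_type]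
  refine Finset.sum_congr rfl fun i _ => ?_
  rw [Finset.sum_mul]
  refine Finset.sum_congr rfl fun α _ => ?_
  simp [shiftDer, sig]; ring

theorem exists_norm_emt_le {p : ℝ} (hp : 1 < p) (s : Fin n) (M : ℝ) :
    ∃ C ≥ 0, ∀ z : Mat n N, ‖z‖ ≤ M → ‖emt p s z‖ ≤ C := by
  refine ⟨∑ _i : Fin n, ∑ _α : Fin N, p * |M| ^ (p - 1) * Real.exp (|M| ^ p) * |M| + Real.exp (|M| ^ p),
    by positivity, fun z hz => ?_⟩
  replace hz := hz.trans (le_abs_self M)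
  refine (norm_sub_le _ _).trans (add_le_add ((norm_sum_le _ _).trans (Finset.sum_le_sum fun i _ => ?_)) ?_)
  · rw [norm_smul, norm_ee, mul_one]
    refine (norm_sum_le _ _).trans (Finset.sum_le_sum fun α _ => ?_)
    rw [norm_mul]
    gcongr
    · exact (abs_apply_le _ _).trans (norm_sig_le hp hz)
    · exact (abs_apply_le _ _).trans hz
  · rw [norm_smul, norm_ee, mul_one, Real.norm_of_nonneg (FF_pos _ _).le]
    exact FF_le hp hz

theorem measurable_coord {ι : Type*} [Fintype ι] (q : ι) :
    Measurable fun z : EuclideanSpace ℝ ι => z q :=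
  (measurable_pi_apply q).comp (WithLp.measurable_ofLp 2 _)

theorem emt_apply (p : ℝ) (s : Fin n) (z : Mat n N) (i : Fin n) :
    emt p s z i = ∑ α, sig p z (i, α) * z (s, α) - FF p z * if i = s then 1 else 0 := by
  simp [emt, ee, Finset.sum_apply, Pi.single_apply]

theorem measurable_emt {p : ℝ} (hp : 1 < p) (s : Fin n) : Measurable (emt p s : Mat n N → Eu n) := by
  have h2 : ∀ q : Fin n × Fin N, Measurable fun z : Mat n N => sig p z q := fun q =>
    (measurable_coord q).comp (measurable_sig hp)
  have h5 : ∀ i, Measurable fun z : Mat n N => emt p s z i := fun i => by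
    simp only [emt_apply]
    have h6 : Measurable fun z : Mat n N => ∑ α, sig p z (i, α) * z (s, α) :=
      Finset.measurable_fun_sum _ fun α _ => (h2 _).mul (measurable_coord _)
    exact h6.sub ((continuous_FF hp).measurable.mul_const _)
  exact (WithLp.measurable_toLp 2 _).comp (measurable_pi_lambda _ h5)

theorem shift_lipschitz {U : Fin N → Eu n → ℝ} (hU : ∀ α, ∃ C, LipschitzWith C (U α))
    {η : Eu n → ℝ} {C : ℝ≥0} (hη : LipschitzWith C η) (s : Fin n) (h : ℝ) (β : Fin N) :
    ∃ C, LipschitzWith C (shift U η s h β) := by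
  obtain ⟨D, hD⟩ := hU β
  refine ⟨D * (1 + ‖h‖₊ * C), hD.comp (LipschitzWith.id.add ?_)⟩
  refine LipschitzWith.of_dist_le_mul fun x y => ?_
  have := hη.dist_le_mul x y
  rw [Real.dist_eq] at this
  rw [dist_eq_norm, ← sub_smul, norm_smul, norm_ee, mul_one, ← mul_sub, norm_mul]
  push_cast
  rw [mul_assoc]
  gcongr
  exact this

theorem grd_shift {U : Fin N → Eu n → ℝ} {η : Eu n → ℝ} (hη : ContDiff ℝ 1 η) (s : Fin n) (h : ℝ)
    {x : Eu n} (hx : ∀ α, DifferentiableAt ℝ (U α) (x + (h * η x) • ee s)) :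
    grd (shift U η s h) x = grd U (x + (h * η x) • ee s) +
      h • shiftDer s (fderiv ℝ η x) (grd U (x + (h * η x) • ee s)) := by
  ext ⟨i, α⟩
  have h1 : HasFDerivAt (fun x => h * η x) (h • fderiv ℝ η x) x :=
    (hη.differentiable one_ne_zero x).hasFDerivAt.const_mul h
  have h2 := (hasFDerivAt_id x).add (h1.smul_const (ee s))
  have h3 : HasFDerivAt (shift U η s h α) _ x := (hx α).hasFDerivAt.comp x h2
  rw [grd_apply, h3.fderiv]
  simp [grd_apply, shiftDer]
  ring

theorem LMin.shift_energy_le {p : ℝ} (hp : 1 < p) {U : Fin N → Eu n → ℝ} {x₀ : Eu n} {r M : ℝ}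
    (H : LMin p U x₀ r M) {R : ℝ} (hR : R < r) (s : Fin n) {η : Eu n → ℝ}
    (hη : ContDiff ℝ 2 η) (hη0 : ∀ x, 0 ≤ η x) (hη1 : ∀ x, η x ≤ 1) (hηR : ∀ x ∉ closedBall x₀ R, η x = 0) :
    ∃ I K δ : ℝ, 0 < δ ∧ ∀ h, |h| < δ →
      ∫ x in ball x₀ r, FF p (grd (shift U η s h) x) ≤
        (∫ x in ball x₀ r, FF p (grd U x)) + h * I + K * h ^ 2 := by
  have hcs : HasCompactSupport η :=
    HasCompactSupport.intro (isCompact_closedBall x₀ R) fun x hx => hηR x hx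
  have hη' : ContDiff ℝ 1 η := hη.of_le (by norm_num)
  obtain ⟨C0, hC0⟩ := hη'.lipschitzWith_of_hasCompactSupport hcs one_ne_zero
  obtain ⟨C2, hC2⟩ := (hη.fderiv_right (m := 1) (by norm_num)).lipschitzWith_of_hasCompactSupport
    (hcs.fderiv ℝ) one_ne_zero
  have hdη : ∀ x, ‖fderiv ℝ η x‖ ≤ C0 := fun x => norm_fderiv_le_of_lipschitz ℝ hC0
  obtain ⟨C1, hC1, hemt⟩ := exists_norm_emt_le (N := N) hp s M
  obtain ⟨K, hK, δ, hδ, htay⟩ := FF_taylor (V := Mat n N) hp M (n * C0) (by positivity)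
  set B := ball x₀ r with hB
  have hfin : IsFiniteMeasure (volume.restrict B) := ⟨by
    rw [Measure.restrict_apply_univ]; exact measure_ball_lt_top⟩
  have hcd : Continuous (fderiv ℝ η) := hη'.continuous_fderiv one_ne_zero
  have hL1m : Measurable fun y => fderiv ℝ η y (emt p s (grd U y)) := by
    have h1 : Measurable fun y => emt p s (grd U y) := (measurable_emt hp s).comp (measurable_grd U)
    have : Continuous fun q : (Eu n →L[ℝ] ℝ) × Eu n => q.1 q.2 := by fun_prop
    exact this.measurable.comp (hcd.measurable.prodMk h1)
  have hL1b : ∀ y, |fderiv ℝ η y (emt p s (grd U y))| ≤ C0 * C1 := fun y =>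
    ((fderiv ℝ η y).le_opNorm _).trans (by
      gcongr
      · exact hdη y
      · exact hemt _ (H.bdd y))
  have hFm : Measurable fun y => FF p (grd U y) := (continuous_FF hp).measurable.comp (measurable_grd U)
  have hFi : IntegrableOn (fun y => FF p (grd U y)) B :=
    Integrable.of_bound hFm.aestronglyMeasurable (Real.exp (M ^ p)) (Eventually.of_forall fun y => by
      rw [Real.norm_of_nonneg (FF_pos _ _).le]; exact FF_le hp (H.bdd y))
  have hLi : IntegrableOn (fun y => fderiv ℝ η y (emt p s (grd U y))) B :=
    Integrable.of_bound hL1m.aestronglyMeasurable _ (Eventually.of_forall hL1b)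
  refine ⟨∫ y in B, fderiv ℝ η y (emt p s (grd U y)), (C2 * C1 + C0 * C0 * C1 + K) * volume.real B,
    min δ (min (r - R) (1 / (C0 + 1))), by have : 0 < r - R := by linarith
                                           positivity, fun h hh => ?_⟩
  have hh1 : |h| < δ := hh.trans_le (min_le_left _ _)
  have hh2 : |h| < r - R := hh.trans_le ((min_le_right _ _).trans (min_le_left _ _))
  have hh3 : |h| * C0 < 1 := by
    have := hh.trans_le ((min_le_right _ _).trans (min_le_right _ _))
    rw [lt_div_iff₀ (by positivity)] at this
    linarith [abs_nonneg h]
  obtain ⟨hpos, hnull, hcov, hcovi⟩ := exists_shear hη' (C := C0) (fun x => hdη x) s hh3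
  set Ψ : Eu n → Eu n := fun x => x + (h * η x) • ee s with hΨ
  have hΨB : ∀ x, Ψ x ∈ B ↔ x ∈ B := fun x => by
    by_cases hx : x ∈ closedBall x₀ R
    · have h1 : x ∈ B := closedBall_subset_ball hR hx
      have h2 : Ψ x ∈ B := by
        rw [mem_closedBall, dist_eq_norm] at hx
        rw [hB, mem_ball, dist_eq_norm]
        have h3 : ‖(h * η x) • (ee s : Eu n)‖ ≤ |h| := by
          rw [norm_smul, norm_ee, mul_one, norm_mul, Real.norm_eq_abs, Real.norm_of_nonneg (hη0 x)]
          exact mul_le_of_le_one_right (abs_nonneg _) (hη1 x)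
        calc ‖Ψ x - x₀‖ = ‖(x - x₀) + (h * η x) • ee s‖ := by rw [hΨ]; congr 1; simp only; abel
          _ ≤ ‖x - x₀‖ + ‖(h * η x) • (ee s : Eu n)‖ := norm_add_le _ _
          _ < r := by linarith
      exact ⟨fun _ => h1, fun _ => h2⟩
    · simp [hΨ, hηR x hx]
  set G : Eu n → ℝ := B.indicator fun y => FF p (grd U y) + h * fderiv ℝ η y (emt p s (grd U y)) with hG
  have hGi : Integrable G := (integrable_indicator_iff measurableSet_ball).2 (hFi.add (hLi.const_mul h))
  have hpt : ∀ᵐ x, x ∈ B → FF p (grd (shift U η s h) x) ≤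
      (1 + h * fderiv ℝ η x (ee s)) * G (Ψ x) + (C2 * C1 + C0 * C0 * C1 + K) * h ^ 2 := by
    filter_upwards [hnull _ (ae_differentiableAt H.lip)] with x hx hxB
    rw [grd_shift hη' s h hx]
    set z := grd U (x + (h * η x) • ee s) with hz
    have hzM : ‖z‖ ≤ M := H.bdd _
    set l := fderiv ℝ η x
    set l' := fderiv ℝ η (Ψ x) with hl'
    have hGx : G (Ψ x) = FF p z + h * l' (emt p s z) := by
      rw [hG, indicator_of_mem ((hΨB x).2 hxB)]
    rw [hGx]
    have h1 := htay z (shiftDer s l z) h hzM ((norm_shiftDer_le s l z).trans (by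
      gcongr; exact hdη x)) hh1
    rw [inner_shiftDer] at h1
    have h2 : |l (emt p s z) - l' (emt p s z)| ≤ C2 * |h| * C1 := by
      rw [← sub_apply]
      refine ((l - l').le_opNorm _).trans ?_
      gcongr
      · have := hC2.dist_le_mul x (Ψ x)
        rw [dist_eq_norm, dist_eq_norm] at this
        refine this.trans ?_
        gcongr
        rw [hΨ]
        simp only [sub_add_cancel_left, norm_neg]
        rw [norm_smul, norm_ee, mul_one, norm_mul, Real.norm_eq_abs, Real.norm_of_nonneg (hη0 x)]
        exact mul_le_of_le_one_right (abs_nonneg _) (hη1 x)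
      · exact hemt z hzM
    have h3 : |l' (emt p s z) * l (ee s)| ≤ C0 * C1 * C0 := by
      rw [abs_mul]
      gcongr
      · exact hL1b (Ψ x)
      · have := l.le_opNorm (ee s)
        rw [norm_ee, mul_one] at this
        exact this.trans (hdη x)
    have h4 : h * (l (emt p s z) - l' (emt p s z)) ≤ C2 * C1 * h ^ 2 := by
      refine (le_abs_self _).trans ?_
      rw [abs_mul, ← sq_abs h]
      calc _ ≤ |h| * (C2 * |h| * C1) := by gcongr
        _ = _ := by ring
    have h5 : -(h ^ 2 * (l' (emt p s z) * l (ee s))) ≤ h ^ 2 * (C0 * C1 * C0) := by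
      rw [← mul_neg]
      gcongr
      exact (neg_le_abs _).trans h3
    calc _ ≤ _ := h1
      _ = (1 + h * l (ee s)) * (FF p z + h * l' (emt p s z)) +
          (h * (l (emt p s z) - l' (emt p s z)) + -(h ^ 2 * (l' (emt p s z) * l (ee s))) + K * h ^ 2) := by
        ring
      _ ≤ _ := by
        have : (C2 * C1 + C0 * C0 * C1 + K) * h ^ 2 = C2 * C1 * h ^ 2 + h ^ 2 * (C0 * C1 * C0) + K * h ^ 2 := by
          ring
        linarith
  have hi : Integrable (fun x => (1 + h * fderiv ℝ η x (ee s)) * G (Ψ x)) := hcovi G hGi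
  calc ∫ x in B, FF p (grd (shift U η s h) x)
      ≤ ∫ x in B, ((1 + h * fderiv ℝ η x (ee s)) * G (Ψ x) + (C2 * C1 + C0 * C0 * C1 + K) * h ^ 2) := by
        refine integral_mono_of_nonneg (Eventually.of_forall fun x => (FF_pos _ _).le)
          (hi.integrableOn.add (integrable_const _)) ?_
        exact (ae_restrict_iff' measurableSet_ball).2 hpt
    _ = (∫ x in B, (1 + h * fderiv ℝ η x (ee s)) * G (Ψ x)) +
        (C2 * C1 + C0 * C0 * C1 + K) * volume.real B * h ^ 2 := by
        rw [integral_add hi.integrableOn (integrable_const _)]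
        simp; ring
    _ = (∫ x, (1 + h * fderiv ℝ η x (ee s)) * G (Ψ x)) +
        (C2 * C1 + C0 * C0 * C1 + K) * volume.real B * h ^ 2 := by
        rw [setIntegral_eq_integral_of_forall_compl_eq_zero]
        intro x hx
        rw [hG, indicator_of_notMem (fun h => hx ((hΨB x).1 h)), mul_zero]
    _ = _ := by
        have hcG : ∫ x, (1 + h * fderiv ℝ η x (ee s)) * G (Ψ x) = ∫ x, G x := hcov G
        rw [hcG, hG, integral_indicator measurableSet_ball, integral_add hFi (hLi.const_mul h),
          integral_const_mul]

open Classical in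
/-- Squared gradient difference, set to zero where both gradients are small. -/
def gap (U : Fin N → Eu n → ℝ) (x y : Eu n) : ℝ :=
  if 1 ≤ ‖grd U x‖ ∨ 1 ≤ ‖grd U y‖ then ‖grd U x - grd U y‖ ^ 2 else 0

theorem gap_nonneg (U : Fin N → Eu n → ℝ) (x y : Eu n) : 0 ≤ gap U x y := by
  unfold gap; split_ifs <;> positivity

theorem gap_le {U : Fin N → Eu n → ℝ} {M : ℝ} (hM : ∀ x, ‖grd U x‖ ≤ M) (x y : Eu n) :
    gap U x y ≤ (2 * M) ^ 2 := by
  unfold gap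
  split_ifs
  · gcongr
    linarith [norm_sub_le (grd U x) (grd U y), hM x, hM y]
  · positivity

theorem measurable_gap (U : Fin N → Eu n → ℝ) : Measurable fun q : Eu n × Eu n => gap U q.1 q.2 := by
  have h1 : Measurable fun q : Eu n × Eu n => grd U q.1 := (measurable_grd U).comp measurable_fst
  have h2 : Measurable fun q : Eu n × Eu n => grd U q.2 := (measurable_grd U).comp measurable_snd
  exact Measurable.ite ((measurableSet_le measurable_const h1.norm).union
    (measurableSet_le measurable_const h2.norm)) ((h1.sub h2).norm.pow_const 2) measurable_const

theorem measurable_gap_translate (U : Fin N → Eu n → ℝ) (a b : Eu n) :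
    Measurable fun x => gap U (x + a) (x + b) := by
  have ha : Measurable fun x : Eu n => x + a := (continuous_id.add continuous_const).measurable
  have hb : Measurable fun x : Eu n => x + b := (continuous_id.add continuous_const).measurable
  have h := Measurable.comp (g := fun q : Eu n × Eu n => gap U q.1 q.2) (measurable_gap U) (ha.prodMk hb)
  simpa only [Function.comp_def] using h

theorem integrableOn_gap {U : Fin N → Eu n → ℝ} {M : ℝ} (hM : ∀ x, ‖grd U x‖ ≤ M) (a b x₀ : Eu n)
    (ρ : ℝ) : IntegrableOn (fun x => gap U (x + a) (x + b)) (ball x₀ ρ) := by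
  have : IsFiniteMeasure (volume.restrict (ball x₀ ρ)) := ⟨by
    rw [Measure.restrict_apply_univ]; exact measure_ball_lt_top⟩
  refine Integrable.of_bound (measurable_gap_translate U a b).aestronglyMeasurable ((2 * M) ^ 2)
    (Eventually.of_forall fun x => ?_)
  rw [Real.norm_of_nonneg (gap_nonneg _ _ _)]
  exact gap_le hM _ _

theorem average_lipschitz {f g : Eu n → ℝ} (hf : ∃ C, LipschitzWith C f) (hg : ∃ C, LipschitzWith C g) :
    ∃ C, LipschitzWith C fun x => (1 / 2) * (f x + g x) := by
  obtain ⟨C, hC⟩ := hf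
  obtain ⟨C', hC'⟩ := hg
  refine ⟨(1 / 2) * (C + C'), LipschitzWith.of_dist_le_mul fun x y => ?_⟩
  have := (hC.add hC').dist_le_mul x y
  rw [Real.dist_eq] at this ⊢
  simp only [← mul_sub, abs_mul]
  push_cast at this ⊢
  rw [mul_assoc, abs_of_pos (by norm_num : (0 : ℝ) < 1 / 2)]
  gcongr

theorem LMin.inner_variation {p : ℝ} (hp : 1 < p) {U : Fin N → Eu n → ℝ} {x₀ : Eu n} {r M : ℝ}
    (H : LMin p U x₀ r M) {ρ : ℝ} (hρ0 : 0 < ρ) (hρ : ρ < r) (s : Fin n) :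
    ∃ C ≥ 0, ∃ δ > 0, ∀ h, |h| < δ →
      ∫ x in ball x₀ ρ, gap U (x + h • ee s) (x + (-h) • ee s) ≤ C * h ^ 2 := by
  obtain ⟨R, hR1, hR2⟩ := exists_between hρ
  obtain ⟨_, _, hcut⟩ := exists_cutoff
  obtain ⟨η, hη, hη0, hη1, hηρ, hηR, -⟩ := hcut n x₀ ρ R hρ0 hR1
  have hη2 : ContDiff ℝ 2 η := by exact_mod_cast contDiff_infty.1 hη 2
  have hη' : ContDiff ℝ 1 η := by exact_mod_cast contDiff_infty.1 hη 1
  have hcs : HasCompactSupport η :=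
    HasCompactSupport.intro (isCompact_closedBall x₀ R) fun x hx => hηR x hx
  obtain ⟨C0, hC0⟩ := hη'.lipschitzWith_of_hasCompactSupport hcs one_ne_zero
  obtain ⟨I, K, δ, hδ, hE⟩ := H.shift_energy_le hp hR2 s hη2 hη0 hη1 hηR
  set c : ℝ := (1 / 8) * (1 / 2) ^ (p - 1) with hc
  have hc0 : 0 < c := by positivity
  set B := ball x₀ r with hB
  have hfin : IsFiniteMeasure (volume.restrict B) := ⟨by
    rw [Measure.restrict_apply_univ]; exact measure_ball_lt_top⟩
  refine ⟨max (K / c) 0, le_max_right _ _, min δ (1 / (C0 + 1)), by positivity, fun h hh => ?_⟩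
  have hh1 : |h| < δ := hh.trans_le (min_le_left _ _)
  have hh3 : |h| * C0 < 1 := by
    have := hh.trans_le (min_le_right _ _)
    rw [lt_div_iff₀ (by positivity)] at this
    linarith [abs_nonneg h]
  have hlip := fun h => shift_lipschitz H.lip hC0 s h
  set W : Fin N → Eu n → ℝ := fun β x => (1 / 2) * (shift U η s h β x + shift U η s (-h) β x) with hW
  have hWlip : ∀ α, ∃ C, LipschitzWith C (W α) := fun β => average_lipschitz (hlip h β) (hlip (-h) β)
  have hmin := H.minimal W hWlip R hR2 (fun β x hx => by simp [hW, shift, hηR x hx]; ring)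
  have hdη : ∀ x, ‖fderiv ℝ η x‖ ≤ C0 := fun x => norm_fderiv_le_of_lipschitz ℝ hC0
  have hnull1 := (exists_shear hη' (C := C0) (fun x => hdη x) s hh3).2.1 _ (ae_differentiableAt H.lip)
  have hnull2 := (exists_shear hη' (C := C0) (fun x => hdη x) s (h := -h) (by rwa [abs_neg])).2.1 _
    (ae_differentiableAt H.lip)
  have hgrdW : ∀ᵐ x, grd W x = (1 / 2 : ℝ) • (grd (shift U η s h) x + grd (shift U η s (-h)) x) := by
    filter_upwards [ae_differentiableAt (hlip h), ae_differentiableAt (hlip (-h))] with x hx hx'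
    ext ⟨i, α⟩
    have h1 := ((hx α).hasFDerivAt.add (hx' α).hasFDerivAt).const_mul (1 / 2 : ℝ)
    have h2 : HasFDerivAt (W α) _ x := h1
    rw [grd_apply, h2.fderiv]
    simp [grd_apply]
  have hinner : ∀ x ∈ ball x₀ ρ, η x = 1 ∧ fderiv ℝ η x = 0 := fun x hx => by
    refine ⟨hηρ x (ball_subset_closedBall hx), ?_⟩
    have : η =ᶠ[𝓝 x] fun _ => 1 := by
      filter_upwards [isOpen_ball.mem_nhds hx] with y hy
      exact hηρ y (ball_subset_closedBall hy)
    rw [this.fderiv_eq]; simp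
  set gp : Eu n → ℝ := (ball x₀ ρ).indicator fun x => gap U (x + h • ee s) (x + (-h) • ee s) with hgp
  have hpt : ∀ᵐ x, FF p (grd W x) + c * gp x ≤
      (1 / 2) * (FF p (grd (shift U η s h) x) + FF p (grd (shift U η s (-h)) x)) := by
    filter_upwards [hgrdW, hnull1, hnull2] with x h1 h2 h3
    rw [h1]
    by_cases hx : x ∈ ball x₀ ρ
    · obtain ⟨e1, e2⟩ := hinner x hx
      have g1 := grd_shift hη' s h h2
      have g2 := grd_shift hη' s (-h) h3
      have hz : ∀ z : Mat n N, shiftDer s (0 : Eu n →L[ℝ] ℝ) z = 0 := fun z => by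
        ext q; simp [shiftDer]
      rw [e1, e2, hz, smul_zero, add_zero, mul_one] at g1 g2
      rw [hgp, indicator_of_mem hx, g1, g2]
      unfold gap
      split_ifs with hab
      · have := FF_gap hp _ _ hab
        rw [← hc] at this; linarith
      · have := FF_midpoint hp (grd U (x + h • ee s)) (grd U (x + (-h) • ee s))
        linarith
    · rw [hgp, indicator_of_notMem hx]
      have := FF_midpoint hp (grd (shift U η s h) x) (grd (shift U η s (-h)) x)
      linarith
  have hint : ∀ {V : Fin N → Eu n → ℝ}, (∀ α, ∃ C, LipschitzWith C (V α)) →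
      IntegrableOn (fun x => FF p (grd V x)) B := fun {V} hV => by
    obtain ⟨M', hM'⟩ := exists_norm_grd_le hV
    refine Integrable.of_bound ((continuous_FF hp).measurable.comp (measurable_grd V)).aestronglyMeasurable
      (Real.exp (M' ^ p)) (Eventually.of_forall fun y => ?_)
    rw [Real.norm_of_nonneg (FF_pos _ _).le]; exact FF_le hp (hM' y)
  have hgpi : Integrable gp := (integrable_indicator_iff measurableSet_ball).2 (integrableOn_gap H.bdd _ _ _ _)
  have h1 := integral_mono_ae (μ := volume.restrict B) ((hint hWlip).add (hgpi.integrableOn.const_mul c))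
    (((hint (hlip h)).add (hint (hlip (-h)))).const_mul (1 / 2)) (ae_restrict_of_ae hpt)
  simp only [Pi.add_apply] at h1
  rw [integral_add (hint hWlip) (hgpi.integrableOn.const_mul c), integral_const_mul, integral_const_mul,
    integral_add (hint (hlip h)) (hint (hlip (-h)))] at h1
  have h2 := hE h hh1
  have h3 := hE (-h) (by rwa [abs_neg])
  have h4 : ∫ x in B, gp x = ∫ x in ball x₀ ρ, gap U (x + h • ee s) (x + (-h) • ee s) := by
    rw [setIntegral_eq_integral_of_forall_compl_eq_zero, integral_indicator measurableSet_ball]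
    intro x hx
    exact indicator_of_notMem (fun h => hx (ball_subset_ball hρ.le h)) _
  rw [h4] at h1
  have h5 : c * ∫ x in ball x₀ ρ, gap U (x + h • ee s) (x + (-h) • ee s) ≤ K * h ^ 2 := by
    rw [neg_sq] at h3
    linarith
  calc _ = (c * ∫ x in ball x₀ ρ, gap U (x + h • ee s) (x + (-h) • ee s)) / c := by field_simp
    _ ≤ K * h ^ 2 / c := by gcongr
    _ = K / c * h ^ 2 := by ring
    _ ≤ _ := by gcongr; exact le_max_left _ _

theorem LMin.integral_gap_le {p : ℝ} (hp : 1 < p) {U : Fin N → Eu n → ℝ} {x₀ : Eu n} {r M : ℝ}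
    (H : LMin p U x₀ r M) {ρ : ℝ} (hρ0 : 0 < ρ) (hρ : ρ < r) (s : Fin n) :
    ∃ C ≥ 0, ∃ δ > 0, ∀ h, |h| < δ →
      ∫ x in ball x₀ ρ, gap U (x + h • ee s) x ≤ C * h ^ 2 := by
  obtain ⟨R, hR1, hR2⟩ := exists_between hρ
  obtain ⟨C, hC, δ, hδ, hh⟩ := H.inner_variation hp (hρ0.trans hR1) hR2 s
  refine ⟨C, hC, min δ (R - ρ), by have : 0 < R - ρ := by linarith
                                   positivity, fun h hlt => ?_⟩
  have hlt1 := hlt.trans_le (min_le_left _ _)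
  have hlt2 := hlt.trans_le (min_le_right _ _)
  have h2 : |h / 2| = |h| / 2 := by rw [abs_div, abs_two]
  have key := hh (h / 2) (by rw [h2]; linarith [abs_nonneg h])
  have htr : ∫ x in ball x₀ ρ, gap U (x + h • ee s) x =
      ∫ x in ball (x₀ + (h / 2) • ee s) ρ, gap U (x + (h / 2) • ee s) (x + (-(h / 2)) • ee s) := by
    rw [← (mp_add ((h / 2) • (ee s : Eu n))).setIntegral_preimage_emb (measurableEmbedding_addRight _)
      (fun x => gap U (x + (h / 2) • ee s) (x + (-(h / 2)) • ee s)) (ball (x₀ + (h / 2) • ee s) ρ)]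
    have : (fun x => x + (h / 2) • ee s) ⁻¹' ball (x₀ + (h / 2) • ee s) ρ = ball x₀ ρ := by
      ext x; simp
    rw [this]
    refine integral_congr_ae (Eventually.of_forall fun x => ?_)
    simp only
    congr 1
    · rw [add_assoc, ← add_smul]; norm_num
    · rw [add_assoc, ← add_smul]; norm_num
  rw [htr]
  have hsub : ball (x₀ + (h / 2) • (ee s : Eu n)) ρ ⊆ ball x₀ R := by
    refine ball_subset_ball' ?_
    rw [dist_eq_norm, add_sub_cancel_left, norm_smul, norm_ee, mul_one, Real.norm_eq_abs, h2]
    linarith [abs_nonneg h]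
  calc _ ≤ ∫ x in ball x₀ R, gap U (x + (h / 2) • ee s) (x + (-(h / 2)) • ee s) :=
        setIntegral_mono_set (integrableOn_gap H.bdd _ _ _ _) (Eventually.of_forall fun x => gap_nonneg _ _ _)
          (LE.le.eventuallyLE hsub)
    _ ≤ _ := key
    _ ≤ C * h ^ 2 := by gcongr ?_ * ?_; nlinarith [sq_nonneg h]

end

section

open Filter Topology

variable {n N : ℕ}

theorem eLpNorm_two_eq {X : Type*} [MeasurableSpace X] {μ : Measure X} {f : X → ℝ} (hf : MemLp f 2 μ) :
    eLpNorm f 2 μ = ENNReal.ofReal (√(∫ x, f x ^ 2 ∂μ)) := by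
  rw [hf.eLpNorm_eq_integral_rpow_norm two_ne_zero ENNReal.ofNat_ne_top, Real.sqrt_eq_rpow]
  norm_num

theorem memLp_two_of_bound {f : Eu n → ℝ} (hf : AEStronglyMeasurable f volume) {x₀ : Eu n} {R K : ℝ}
    (h0 : ∀ x ∉ closedBall x₀ R, f x = 0) (hK : ∀ x, |f x| ≤ K) : MemLp f 2 volume := by
  have : IsFiniteMeasure (volume.restrict (closedBall x₀ R)) := ⟨by
    rw [Measure.restrict_apply_univ]; exact measure_closedBall_lt_top⟩
  have h1 : MemLp f 2 (volume.restrict (closedBall x₀ R)) :=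
    MemLp.of_bound hf.restrict K (Eventually.of_forall hK)
  rw [← memLp_indicator_iff_restrict measurableSet_closedBall] at h1
  convert h1
  ext x
  by_cases hx : x ∈ closedBall x₀ R
  · rw [indicator_of_mem hx]
  · rw [indicator_of_notMem hx, h0 x hx]

theorem abs_le_of_lip {T : Mat n N → ℝ} {M L : ℝ} (hL : 0 ≤ L)
    (hT : ∀ a b, ‖a‖ ≤ M → ‖b‖ ≤ M → |T a - T b| ≤ L * ‖a - b‖) (hT0 : ∀ z, ‖z‖ ≤ 1 → T z = 0)
    {a : Mat n N} (ha : ‖a‖ ≤ M) : |T a| ≤ L * M := by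
  have h0 : ‖(0 : Mat n N)‖ ≤ M := by simpa using (norm_nonneg a).trans ha
  have := hT a 0 ha h0
  rw [hT0 0 (by simp), sub_zero, sub_zero] at this
  exact this.trans (by gcongr)

theorem LMin.exists_hasL2Deriv {p : ℝ} (hp : 1 < p) {U : Fin N → Eu n → ℝ} {x₀ : Eu n} {r M : ℝ}
    (H : LMin p U x₀ r M) {R : ℝ} (hR0 : 0 < R) (hR : R < r) {T : Mat n N → ℝ} (hTc : Continuous T)
    {L : ℝ} (hL : 0 ≤ L) (hT : ∀ a b, ‖a‖ ≤ M → ‖b‖ ≤ M → |T a - T b| ≤ L * ‖a - b‖)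
    (hT0 : ∀ z, ‖z‖ ≤ 1 → T z = 0) {ζ : Eu n → ℝ} (hζ : ContDiff ℝ 1 ζ)
    (hζ0 : ∀ x ∉ closedBall x₀ R, ζ x = 0) (i : Fin n) :
    ∃ g, HasL2Deriv (fun x => ζ x * T (grd U x)) g (ee i) := by
  have hcs : HasCompactSupport ζ :=
    HasCompactSupport.intro (isCompact_closedBall x₀ R) fun x hx => hζ0 x hx
  obtain ⟨C1, hC1⟩ := hζ.lipschitzWith_of_hasCompactSupport hcs one_ne_zero
  obtain ⟨C0, hC0⟩ := hcs.exists_bound_of_continuous hζ.continuous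
  have hC00 : 0 ≤ C0 := (norm_nonneg _).trans (hC0 x₀)
  have hM : 0 ≤ M := (norm_nonneg _).trans (H.bdd x₀)
  have hTm : Measurable fun x => T (grd U x) := hTc.measurable.comp (measurable_grd U)
  have hfm : Measurable fun x => ζ x * T (grd U x) := hζ.continuous.measurable.mul hTm
  have hTb : ∀ x, |T (grd U x)| ≤ L * M := fun x => abs_le_of_lip hL hT hT0 (H.bdd x)
  have hf2 : MemLp (fun x => ζ x * T (grd U x)) 2 volume :=
    memLp_two_of_bound hfm.aestronglyMeasurable (x₀ := x₀) (R := R) (K := C0 * (L * M))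
      (fun x hx => by rw [hζ0 x hx, zero_mul]) (fun x => by
        rw [abs_mul]
        gcongr
        · exact hC0 x
        · exact hTb x)
  obtain ⟨R', hR1, hR2⟩ := exists_between hR
  obtain ⟨Cg, hCg, δ, hδ, hgap⟩ := H.integral_gap_le hp (hR0.trans hR1) hR2 i
  set K : ℝ := 2 * (C1 * (L * M)) ^ 2 * volume.real (ball x₀ r) + 2 * (C0 * L) ^ 2 * Cg with hK
  have hK0 : 0 ≤ K := by positivity
  refine ExpLip.exists_hasL2Deriv (ee i) hf2 (√K) (min δ (r - R))
    (by have : 0 < r - R := by linarith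
        positivity) fun h hh => ?_
  have hh1 := hh.trans_le (min_le_left _ _)
  have hh2 := hh.trans_le (min_le_right _ _)
  have hD2 : MemLp (fun x => ζ (x + h • ee i) * T (grd U (x + h • ee i)) - ζ x * T (grd U x)) 2 volume :=
    (hf2.comp_measurePreserving (mp_add (h • ee i))).sub hf2
  rw [eLpNorm_two_eq hD2]
  refine ENNReal.ofReal_le_ofReal ?_
  rw [← Real.sqrt_sq (abs_nonneg h), ← Real.sqrt_mul hK0, sq_abs]
  refine Real.sqrt_le_sqrt ?_
  have hpt : ∀ x, (ζ (x + h • ee i) * T (grd U (x + h • ee i)) - ζ x * T (grd U x)) ^ 2 ≤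
      (ball x₀ r).indicator (fun _ => 2 * (C1 * (L * M)) ^ 2 * h ^ 2) x +
      (ball x₀ R').indicator (fun x => 2 * (C0 * L) ^ 2 * gap U (x + h • ee i) x) x := by
    intro x
    have hA : ((ζ (x + h • ee i) - ζ x) * T (grd U (x + h • ee i))) ^ 2 ≤
        (ball x₀ r).indicator (fun _ => (C1 * (L * M)) ^ 2 * h ^ 2) x := by
      by_cases hx : x ∈ ball x₀ r
      · rw [indicator_of_mem hx, ← sq_abs h, ← mul_pow, ← sq_abs, abs_mul]
        have h1 := hC1.dist_le_mul (x + h • ee i) x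
        rw [Real.dist_eq, dist_eq_norm, add_sub_cancel_left, norm_smul, norm_ee, mul_one,
          Real.norm_eq_abs] at h1
        refine pow_le_pow_left₀ (by positivity) ?_ 2
        calc _ ≤ (C1 * |h|) * (L * M) := by
              gcongr
              exact hTb _
          _ = _ := by ring
      · rw [indicator_of_notMem hx]
        have h1 : x ∉ closedBall x₀ R := fun h => hx (closedBall_subset_ball hR h)
        have h2 : x + h • ee i ∉ closedBall x₀ R := fun h3 => hx (by
          rw [mem_closedBall, dist_eq_norm] at h3
          rw [mem_ball, dist_eq_norm]
          have h4 : ‖h • (ee i : Eu n)‖ = |h| := by rw [norm_smul, norm_ee, mul_one, Real.norm_eq_abs]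
          calc ‖x - x₀‖ = ‖(x + h • ee i - x₀) - h • ee i‖ := by congr 1; abel
            _ ≤ _ := norm_sub_le _ _
            _ < r := by linarith)
        rw [hζ0 x h1, hζ0 _ h2]; simp
    have hB : (ζ x * (T (grd U (x + h • ee i)) - T (grd U x))) ^ 2 ≤
        (ball x₀ R').indicator (fun x => (C0 * L) ^ 2 * gap U (x + h • ee i) x) x := by
      by_cases hx : x ∈ closedBall x₀ R
      · rw [indicator_of_mem (closedBall_subset_ball hR1 hx)]
        unfold gap
        split_ifs with hab
        · rw [← mul_pow, ← sq_abs, abs_mul]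
          refine pow_le_pow_left₀ (by positivity) ?_ 2
          calc _ ≤ C0 * (L * ‖grd U (x + h • ee i) - grd U x‖) := by
                gcongr
                · exact hC0 x
                · exact hT _ _ (H.bdd _) (H.bdd _)
            _ = _ := by ring
        · push Not at hab
          rw [hT0 _ hab.1.le, hT0 _ hab.2.le]; simp
      · rw [hζ0 x hx, zero_mul]
        have : 0 ≤ (ball x₀ R').indicator (fun x => (C0 * L) ^ 2 * gap U (x + h • ee i) x) x :=
          indicator_nonneg (fun x _ => mul_nonneg (sq_nonneg _) (gap_nonneg _ _ _)) x
        simpa using this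
    have e1 : (ball x₀ r).indicator (fun _ => 2 * (C1 * (L * M)) ^ 2 * h ^ 2) x =
        2 * (ball x₀ r).indicator (fun _ => (C1 * (L * M)) ^ 2 * h ^ 2) x := by
      rw [← indicator_const_mul]; simp only [mul_assoc]
    have e2 : (ball x₀ R').indicator (fun x => 2 * (C0 * L) ^ 2 * gap U (x + h • ee i) x) x =
        2 * (ball x₀ R').indicator (fun x => (C0 * L) ^ 2 * gap U (x + h • ee i) x) x := by
      rw [← indicator_const_mul]; simp only [mul_assoc]
    rw [e1, e2]
    have := sq_nonneg ((ζ (x + h • ee i) - ζ x) * T (grd U (x + h • ee i)) -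
      ζ x * (T (grd U (x + h • ee i)) - T (grd U x)))
    nlinarith
  have hg' : IntegrableOn (fun x => gap U (x + h • ee i) x) (ball x₀ R') := by
    simpa using integrableOn_gap H.bdd (h • ee i) 0 x₀ R'
  have hi1 : Integrable ((ball x₀ r).indicator fun _ => 2 * (C1 * (L * M)) ^ 2 * h ^ 2) :=
    (integrable_indicator_iff measurableSet_ball).2 (integrableOn_const measure_ball_lt_top.ne)
  have hi2 : Integrable ((ball x₀ R').indicator fun x => 2 * (C0 * L) ^ 2 * gap U (x + h • ee i) x) :=
    (integrable_indicator_iff measurableSet_ball).2 (hg'.const_mul _)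
  calc _ ≤ _ := integral_mono_of_nonneg (Eventually.of_forall fun x => sq_nonneg _) (hi1.add hi2)
        (Eventually.of_forall hpt)
    _ = 2 * (C1 * (L * M)) ^ 2 * h ^ 2 * volume.real (ball x₀ r) +
        2 * (C0 * L) ^ 2 * ∫ x in ball x₀ R', gap U (x + h • ee i) x := by
      simp only [Pi.add_apply]
      rw [integral_add hi1 hi2, integral_indicator measurableSet_ball,
        integral_indicator measurableSet_ball, integral_const_mul (2 * (C0 * L) ^ 2)]
      simp; ring
    _ ≤ 2 * (C1 * (L * M)) ^ 2 * h ^ 2 * volume.real (ball x₀ r) + 2 * (C0 * L) ^ 2 * (Cg * h ^ 2) := by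
      gcongr; exact hgap h hh1
    _ = _ := by ring

end

section

open Filter Topology

variable {n N : ℕ}

/-- The power of the positive part. -/
def ppow (β y : ℝ) : ℝ := max y 0 ^ β

theorem ppow_of_pos {β y : ℝ} (hy : 0 ≤ y) : ppow β y = y ^ β := by rw [ppow, max_eq_left hy]

theorem ppow_of_nonpos {β y : ℝ} (hβ : 0 < β) (hy : y ≤ 0) : ppow β y = 0 := by
  rw [ppow, max_eq_right hy, Real.zero_rpow hβ.ne']

theorem ppow_nonneg (β y : ℝ) : 0 ≤ ppow β y := Real.rpow_nonneg (le_max_right _ _) _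

theorem continuous_ppow {β : ℝ} (hβ : 0 < β) : Continuous (ppow β) :=
  (continuous_id.max continuous_const).rpow_const fun _ => Or.inr hβ.le

theorem hasDerivAt_ppow {β : ℝ} (hβ : 1 < β) (y : ℝ) : HasDerivAt (ppow β) (β * ppow (β - 1) y) y := by
  rcases lt_trichotomy y 0 with hy | rfl | hy
  · rw [ppow_of_nonpos (by linarith) hy.le, mul_zero]
    refine (hasDerivAt_const y (0 : ℝ)).congr_of_eventuallyEq ?_
    filter_upwards [Iio_mem_nhds hy] with x hx
    exact ppow_of_nonpos (by linarith) (le_of_lt hx)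
  · rw [ppow_of_nonpos (by linarith) le_rfl, mul_zero]
    have h := hasDerivAt_abs_rpow 0 hβ
    rw [mul_zero, hasDerivAt_iff_isLittleO] at h
    rw [hasDerivAt_iff_isLittleO]
    refine Asymptotics.IsBigO.trans_isLittleO (Asymptotics.IsBigO.of_bound 1 (Eventually.of_forall fun x => ?_)) h
    rw [ppow_of_nonpos (y := 0) (by linarith) le_rfl]
    simp only [sub_zero, smul_zero, abs_zero]
    rw [Real.zero_rpow (by linarith), sub_zero, one_mul, Real.norm_of_nonneg (ppow_nonneg _ _),
      Real.norm_of_nonneg (by positivity)]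
    exact Real.rpow_le_rpow (le_max_right _ _) (max_le (le_abs_self _) (abs_nonneg _)) (by linarith)
  · rw [ppow_of_pos hy.le]
    refine (Real.hasDerivAt_rpow_const (Or.inl hy.ne')).congr_of_eventuallyEq ?_
    filter_upwards [Ioi_mem_nhds hy] with x hx
    exact ppow_of_pos (le_of_lt hx)

theorem contDiff_ppow {β : ℝ} (hβ : 1 < β) : ContDiff ℝ 1 (ppow β) := by
  rw [contDiff_one_iff_deriv]
  refine ⟨fun y => (hasDerivAt_ppow hβ y).differentiableAt, ?_⟩
  rw [funext fun y => (hasDerivAt_ppow hβ y).deriv]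
  exact continuous_const.mul (continuous_ppow (by linarith))

theorem exists_lip_of_contDiff {T : Mat n N → ℝ} (hT : ContDiff ℝ 1 T) (M : ℝ) :
    ∃ L ≥ 0, ∀ a b, ‖a‖ ≤ M → ‖b‖ ≤ M → |T a - T b| ≤ L * ‖a - b‖ := by
  obtain ⟨L, hL⟩ := (isCompact_closedBall (0 : Mat n N) M).exists_bound_of_continuousOn
    (hT.continuous_fderiv one_ne_zero).continuousOn
  refine ⟨max L 0, le_max_right _ _, fun a b ha hb => ?_⟩
  have := (convex_closedBall (0 : Mat n N) M).norm_image_sub_le_of_norm_fderiv_le (𝕜 := ℝ)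
    (fun x _ => hT.differentiable one_ne_zero x) hL (mem_closedBall_zero_iff.2 hb) (mem_closedBall_zero_iff.2 ha)
  refine this.trans ?_
  gcongr
  exact le_max_left _ _

theorem tendsto_of_quot {E : Type*} [NormedAddCommGroup E] [NormedSpace ℝ E] {h : ℕ → ℝ}
    (h0 : ∀ k, h k ≠ 0) (hl : Tendsto h atTop (𝓝 0)) {a : ℕ → E} {b v : E}
    (H : Tendsto (fun k => (h k)⁻¹ • (a k - b)) atTop (𝓝 v)) : Tendsto a atTop (𝓝 b) := by
  have := (hl.smul H).add_const b
  rw [zero_smul, zero_add] at this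
  refine this.congr fun k => ?_
  rw [smul_inv_smul₀ (h0 k), sub_add_cancel]

/-- Second derivatives of `U` where the gradient is not small, as limits of difference quotients. -/
structure SecDer (U : Fin N → Eu n → ℝ) (x₀ : Eu n) (ρ : ℝ) (B : Fin n → Eu n → Mat n N) (h : ℕ → ℝ) :
    Prop where
  ne : ∀ k, h k ≠ 0
  lim : Tendsto h atTop (𝓝 0)
  large : ∀ i, ∀ᵐ x, x ∈ ball x₀ ρ → 1 < ‖grd U x‖ →
    Tendsto (fun k => (h k)⁻¹ • (grd U (x + h k • ee i) - grd U x)) atTop (𝓝 (B i x))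
  small : ∀ i, ∀ᵐ x, x ∈ ball x₀ ρ → ‖grd U x‖ ≤ 1 →
    B i x = 0 ∧ ∀ᶠ k in atTop, ‖grd U (x + h k • ee i)‖ < 2

theorem tendsto_translate {h : ℕ → ℝ} (hl : Tendsto h atTop (𝓝 0)) (x e : Eu n) :
    Tendsto (fun k => x + h k • e) atTop (𝓝 x) := by
  have := (hl.smul_const e).const_add x
  simpa using this

theorem LMin.exists_secDer {p : ℝ} (hp : 1 < p) {U : Fin N → Eu n → ℝ} {x₀ : Eu n} {r M : ℝ}
    (H : LMin p U x₀ r M) {ρ : ℝ} (hρ0 : 0 < ρ) (hρ : ρ < r) : ∃ B h, SecDer U x₀ ρ B h := by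
  obtain ⟨R, hR1, hR2⟩ := exists_between hρ
  obtain ⟨_, _, hcut⟩ := exists_cutoff
  obtain ⟨ζ, hζ, -, -, hζρ, hζR, -⟩ := hcut n x₀ ρ R hρ0 hR1
  have hζ' : ContDiff ℝ 1 ζ := by exact_mod_cast contDiff_infty.1 hζ 1
  set T0 : Mat n N → ℝ := fun z => ppow 2 (‖z‖ ^ 2 - 1) with hT0
  have hT0c : ContDiff ℝ 1 T0 := (contDiff_ppow one_lt_two).comp ((contDiff_norm_sq ℝ).sub contDiff_const)
  have hcoord : ∀ q : Fin n × Fin N, ContDiff ℝ 1 fun z : Mat n N => z q := fun q =>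
    (EuclideanSpace.proj q : Mat n N →L[ℝ] ℝ).contDiff
  set T : Option (Fin n × Fin N) → Mat n N → ℝ := fun o => o.elim T0 fun q z => T0 z * z q with hT
  have hTc : ∀ o, ContDiff ℝ 1 (T o) := by
    rintro (_ | q)
    · exact hT0c
    · exact hT0c.mul (hcoord q)
  have hT00 : ∀ z : Mat n N, ‖z‖ ≤ 1 → T0 z = 0 := fun z hz =>
    ppow_of_nonpos two_pos (by nlinarith [norm_nonneg z])
  have hTz : ∀ o z, ‖z‖ ≤ 1 → T o z = 0 := by
    rintro (_ | q) z hz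
    · exact hT00 z hz
    · simp [hT, hT00 z hz]
  have hex : ∀ j : Fin n × Option (Fin n × Fin N),
      ∃ g, HasL2Deriv (fun x => ζ x * T j.2 (grd U x)) g (ee j.1) := fun j => by
    obtain ⟨L, hL, hTL⟩ := exists_lip_of_contDiff (hTc j.2) M
    exact H.exists_hasL2Deriv hp (hρ0.trans hR1) hR2 (hTc j.2).continuous hL hTL (hTz j.2) hζ' hζR j.1
  choose g hg using hex
  obtain ⟨φ, hφ, hlim⟩ := exists_common_subseq hg (fun k => 1 / ((k : ℝ) + 1)) (fun k => by positivity)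
    tendsto_one_div_add_atTop_nhds_zero_nat
  set h : ℕ → ℝ := fun k => 1 / ((φ k : ℝ) + 1) with hh
  have h0 : ∀ k, h k ≠ 0 := fun k => by positivity
  have hl : Tendsto h atTop (𝓝 0) := tendsto_one_div_add_atTop_nhds_zero_nat.comp hφ.tendsto_atTop
  have hone : ∀ i x, x ∈ ball x₀ ρ → ζ x = 1 ∧ ∀ᶠ k in atTop, ζ (x + h k • ee i) = 1 := fun i x hx => by
    refine ⟨hζρ x (ball_subset_closedBall hx), ?_⟩
    filter_upwards [(tendsto_translate hl x (ee i)).eventually (isOpen_ball.mem_nhds hx)] with k hk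
    exact hζρ _ (ball_subset_closedBall hk)
  have hlim' : ∀ i, ∀ᵐ x, x ∈ ball x₀ ρ → ∀ o, Tendsto
      (fun k => (h k)⁻¹ * (T o (grd U (x + h k • ee i)) - T o (grd U x))) atTop (𝓝 (g (i, o) x)) := fun i => by
    have := ae_all_iff.2 fun o => hlim (i, o)
    filter_upwards [this] with x hx hxρ o
    obtain ⟨h1, h2⟩ := hone i x hxρ
    refine (hx o).congr' ?_
    filter_upwards [h2] with k hk
    rw [hk, h1, one_mul, one_mul]
  classical
  refine ⟨fun i x => if 1 < ‖grd U x‖ then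
    WithLp.toLp 2 fun q => (g (i, some q) x - grd U x q * g (i, none) x) / T0 (grd U x) else 0, h, h0, hl,
    fun i => ?_, fun i => ?_⟩
  · filter_upwards [hlim' i] with x hx hxρ hx1
    rw [if_pos hx1]
    have hpos : 0 < T0 (grd U x) := by
      have : 0 < ‖grd U x‖ ^ 2 - 1 := by nlinarith
      rw [hT0]; simp only
      rw [ppow_of_pos this.le]; positivity
    have hn := hx hxρ none
    have ha : Tendsto (fun k => T0 (grd U (x + h k • ee i))) atTop (𝓝 (T0 (grd U x))) :=
      tendsto_of_quot h0 hl hn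
    have hq : ∀ q, Tendsto (fun k => (h k)⁻¹ * (grd U (x + h k • ee i) q - grd U x q)) atTop
        (𝓝 ((g (i, some q) x - grd U x q * g (i, none) x) / T0 (grd U x))) := fun q => by
      refine (((hx hxρ (some q)).sub (hn.const_mul (grd U x q))).div ha hpos.ne').congr' ?_
      filter_upwards [ha.eventually_ne hpos.ne'] with k hk
      simp only [hT, Option.elim, Pi.div_apply]
      field_simp
      ring
    refine ((PiLp.continuous_toLp 2 _).tendsto _).comp (tendsto_pi_nhds.2 hq) |>.congr fun k => ?_
    ext q; simp
  · filter_upwards [hlim' i] with x hx hxρ hx1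
    refine ⟨if_neg (not_lt.2 hx1), ?_⟩
    have ha : Tendsto (fun k => T0 (grd U (x + h k • ee i))) atTop (𝓝 (T0 (grd U x))) :=
      tendsto_of_quot h0 hl (hx hxρ none)
    rw [hT00 _ hx1] at ha
    filter_upwards [ha.eventually (gt_mem_nhds one_pos)] with k hk
    by_contra! hc
    have : 1 ≤ ‖grd U (x + h k • ee i)‖ ^ 2 - 1 := by nlinarith
    rw [hT0] at hk
    simp only at hk
    rw [ppow_of_pos (by linarith)] at hk
    exact absurd hk (not_lt.2 (Real.one_le_rpow this zero_le_two))

theorem SecDer.tendsto_comp {U : Fin N → Eu n → ℝ} {x₀ : Eu n} {ρ : ℝ} {B : Fin n → Eu n → Mat n N}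
    {h : ℕ → ℝ} (S : SecDer U x₀ ρ B h) {T : Mat n N → ℝ} (hT : ContDiff ℝ 1 T)
    (hT0 : ∀ z, ‖z‖ ≤ 2 → T z = 0) (i : Fin n) : ∀ᵐ x, x ∈ ball x₀ ρ →
      Tendsto (fun k => (h k)⁻¹ * (T (grd U (x + h k • ee i)) - T (grd U x))) atTop
        (𝓝 (fderiv ℝ T (grd U x) (B i x))) := by
  filter_upwards [S.large i, S.small i] with x hx1 hx2 hx
  rcases lt_or_ge 1 ‖grd U x‖ with h1 | h1
  · have h3 := hx1 hx h1
    have h4 := tendsto_sub_nhds_zero_iff.2 (tendsto_of_quot S.ne S.lim h3)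
    have := ((hT.differentiable one_ne_zero (grd U x)).hasFDerivAt.hasFDerivWithinAt (s := univ)).lim
      h4 (Eventually.of_forall fun _ => mem_univ _) h3
    refine this.congr fun k => ?_
    rw [smul_eq_mul]; congr 3; abel
  · obtain ⟨h2, h3⟩ := hx2 hx h1
    rw [h2, map_zero]
    refine tendsto_const_nhds.congr' ?_
    filter_upwards [h3] with k hk
    rw [hT0 _ hk.le, hT0 _ (by linarith)]; simp

theorem HasL2Deriv.congr_deriv {f g g' : Eu n → ℝ} {e : Eu n} (H : HasL2Deriv f g e) (hg : g =ᵐ[volume] g') :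
    HasL2Deriv f g' e := by
  refine ⟨H.memLp, H.memLp_deriv.ae_eq hg, H.tendsto.congr fun h => eLpNorm_congr_ae ?_⟩
  filter_upwards [hg] with x hx
  rw [hx]

theorem SecDer.chain {p : ℝ} (hp : 1 < p) {U : Fin N → Eu n → ℝ} {x₀ : Eu n} {r M : ℝ}
    (H : LMin p U x₀ r M) {ρ : ℝ} {B : Fin n → Eu n → Mat n N}
    {h : ℕ → ℝ} (S : SecDer U x₀ ρ B h) {T : Mat n N → ℝ} (hT : ContDiff ℝ 1 T)
    (hT0 : ∀ z, ‖z‖ ≤ 2 → T z = 0) {ρ' : ℝ} (hρ0 : 0 < ρ') (hρ' : ρ' < ρ) (hρ : ρ < r) {ζ : Eu n → ℝ}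
    (hζ : ContDiff ℝ 1 ζ) (hζ0 : ∀ x ∉ closedBall x₀ ρ', ζ x = 0) (i : Fin n) :
    HasL2Deriv (fun x => ζ x * T (grd U x))
      (fun x => fderiv ℝ ζ x (ee i) * T (grd U x) + ζ x * fderiv ℝ T (grd U x) (B i x)) (ee i) := by
  obtain ⟨L, hL, hTL⟩ := exists_lip_of_contDiff hT M
  obtain ⟨g, hg⟩ := H.exists_hasL2Deriv hp hρ0 (hρ'.trans hρ) hT.continuous hL hTL
    (fun z hz => hT0 z (by linarith)) hζ hζ0 i
  refine hg.congr_deriv ?_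
  obtain ⟨φ, hφ, hlim⟩ := exists_common_subseq (ι := Unit) (fun _ => hg) h S.ne S.lim
  filter_upwards [hlim (), S.tendsto_comp hT hT0 i] with x hx hx'
  have hl := S.lim.comp hφ.tendsto_atTop
  have hζx := (hζ.differentiable one_ne_zero x).hasFDerivAt
  by_cases hxρ : x ∈ ball x₀ ρ
  · have h1 := (hx' hxρ).comp hφ.tendsto_atTop
    have h2 := tendsto_of_quot (fun k => S.ne (φ k)) hl h1
    have h3 : Tendsto (fun k => (h (φ k))⁻¹ * (ζ (x + h (φ k) • ee i) - ζ x)) atTop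
        (𝓝 (fderiv ℝ ζ x (ee i))) := by
      refine (hζx.hasFDerivWithinAt (s := univ)).lim (d := fun k => h (φ k) • ee i) ?_
        (Eventually.of_forall fun _ => mem_univ _) ?_
      · simpa using hl.smul_const (ee i : Eu n)
      · refine tendsto_const_nhds.congr fun k => ?_
        rw [inv_smul_smul₀ (S.ne _)]
    refine tendsto_nhds_unique hx (((h3.mul h2).add (h1.const_mul (ζ x))).congr fun k => ?_)
    simp only [Function.comp]
    ring
  · have ho : IsOpen (closedBall x₀ ρ')ᶜ := isClosed_closedBall.isOpen_compl
    have hn : (closedBall x₀ ρ')ᶜ ∈ 𝓝 x := ho.mem_nhds fun h => hxρ (closedBall_subset_ball hρ' h)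
    have h1 : fderiv ℝ ζ x = 0 := by
      have : ζ =ᶠ[𝓝 x] fun _ => 0 := by
        filter_upwards [hn] with y hy
        exact hζ0 y hy
      rw [this.fderiv_eq]; simp
    rw [h1, hζ0 x (mem_of_mem_nhds hn)]
    simp only [_root_.zero_apply, zero_mul, add_zero]
    refine tendsto_nhds_unique hx (tendsto_const_nhds.congr' ?_)
    filter_upwards [(tendsto_translate hl x (ee i)).eventually hn] with k hk
    simp only [Function.comp] at hk
    rw [hζ0 _ hk, hζ0 x (mem_of_mem_nhds hn)]; simp

end

section

open Filter Topology

variable {n N : ℕ}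

theorem integral_fderiv_eq_zero {ζ : Eu n → ℝ} (hζ : ContDiff ℝ 1 ζ) (hc : HasCompactSupport ζ)
    (e : Eu n) : ∫ x, fderiv ℝ ζ x e = 0 := by
  obtain ⟨C, hC⟩ := hζ.lipschitzWith_of_hasCompactSupport hc one_ne_zero
  have := (LipschitzWith.const (1 : ℝ) : LipschitzWith 0 fun _ : Eu n => (1 : ℝ)).integral_lineDeriv_mul_eq
    (μ := volume) hC hc (-e)
  simp only [neg_neg, mul_one] at this
  have h1 : ∀ x v, lineDeriv ℝ (fun _ : Eu n => (1 : ℝ)) x v = 0 := fun x v => by simp [lineDeriv]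
  simp only [h1, zero_mul, integral_zero] at this
  rw [this]
  exact integral_congr_ae (Eventually.of_forall fun x =>
    ((hζ.differentiable one_ne_zero x).lineDeriv_eq_fderiv).symm)

theorem integral_curl {f : Eu n → ℝ} {C : ℝ≥0} (hf : LipschitzWith C f) {ζ : Eu n → ℝ}
    (hζ : ContDiff ℝ 2 ζ) (hc : HasCompactSupport ζ) (i j : Fin n) :
    ∫ x, fderiv ℝ f x (ee j) * fderiv ℝ ζ x (ee i) = ∫ x, fderiv ℝ f x (ee i) * fderiv ℝ ζ x (ee j) := by
  have hd : ∀ i, ContDiff ℝ 1 fun x => fderiv ℝ ζ x (ee i) := fun i =>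
    (hζ.fderiv_right (m := 1) (by norm_num)).clm_apply contDiff_const
  have hdc : ∀ i, HasCompactSupport fun x => fderiv ℝ ζ x (ee i) := fun i => hc.fderiv_apply ℝ (ee i)
  have key : ∀ i j, ∫ x, fderiv ℝ f x (ee j) * fderiv ℝ ζ x (ee i) =
      ∫ x, -(fderiv ℝ (fderiv ℝ ζ) x (ee j) (ee i)) * f x := fun i j => by
    obtain ⟨D, hD⟩ := (hd i).lipschitzWith_of_hasCompactSupport (hdc i) one_ne_zero
    have h1 := hf.integral_lineDeriv_mul_eq (μ := volume) hD (hdc i) (ee j)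
    have h2 : ∫ x, fderiv ℝ f x (ee j) * fderiv ℝ ζ x (ee i) =
        ∫ x, lineDeriv ℝ f x (ee j) * fderiv ℝ ζ x (ee i) := by
      refine integral_congr_ae ?_
      filter_upwards [hf.ae_differentiableAt] with x hx
      rw [hx.lineDeriv_eq_fderiv]
    rw [h2, h1]
    refine integral_congr_ae (Eventually.of_forall fun x => ?_)
    have h3 : DifferentiableAt ℝ (fderiv ℝ ζ) x :=
      (hζ.fderiv_right (m := 1) (by norm_num)).differentiable one_ne_zero x
    simp only
    rw [((hd i).differentiable one_ne_zero x).lineDeriv_eq_fderiv, map_neg,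
      fderiv_clm_apply h3 (differentiableAt_const _)]
    simp
  rw [key i j, key j i]
  refine integral_congr_ae (Eventually.of_forall fun x => ?_)
  have := (hζ.contDiffAt (x := x)).isSymmSndFDerivAt (by simp)
  simp only
  rw [this.eq]

theorem HasL2Deriv.integral_eq_zero {f g : Eu n → ℝ} {e : Eu n} {x₀ : Eu n} {R : ℝ}
    (H : HasL2Deriv f g e) (hf : ∀ x ∉ closedBall x₀ R, f x = 0) : ∫ x, g x = 0 := by
  have := sum_integral_mul_eq_zero (ι := Unit) (q := fun _ _ => 1) (g := fun _ => g) (e := fun _ => e)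
    (f := f) (x₀ := x₀) (M := 1) (lt_add_one R) (fun _ => measurable_const) (fun _ _ => by simp)
    (fun ζ hζ h0 => by
      simp only [Finset.univ_unique, Finset.sum_singleton, one_mul]
      exact integral_fderiv_eq_zero (by exact_mod_cast contDiff_infty.1 hζ 1)
        (HasCompactSupport.intro (isCompact_closedBall x₀ (R + 1)) h0) e) hf (fun _ => H)
  simpa using this


theorem fderiv_mul_coord {T : Mat n N → ℝ} (hT : ContDiff ℝ 1 T) (q : Fin n × Fin N) (z v : Mat n N) :
    fderiv ℝ (fun z => T z * z q) z v = fderiv ℝ T z v * z q + T z * v q := by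
  have h := ((hT.differentiable one_ne_zero z).hasFDerivAt).mul
    (EuclideanSpace.proj q : Mat n N →L[ℝ] ℝ).hasFDerivAt
  have h' : HasFDerivAt (fun z : Mat n N => T z * z q) _ z := h
  rw [h'.fderiv]
  simp; ring

theorem contDiff_mul_coord {T : Mat n N → ℝ} (hT : ContDiff ℝ 1 T) (q : Fin n × Fin N) :
    ContDiff ℝ 1 fun z => T z * z q :=
  hT.mul (EuclideanSpace.proj q : Mat n N →L[ℝ] ℝ).contDiff

theorem SecDer.symm {p : ℝ} (hp : 1 < p) {U : Fin N → Eu n → ℝ} {x₀ : Eu n} {r M : ℝ}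
    (H : LMin p U x₀ r M) {ρ : ℝ} {B : Fin n → Eu n → Mat n N} {h : ℕ → ℝ} (S : SecDer U x₀ ρ B h)
    {ρ' : ℝ} (hρ0 : 0 < ρ') (hρ' : ρ' < ρ) (hρ : ρ < r) (i j : Fin n) (α : Fin N) :
    ∀ᵐ x, x ∈ ball x₀ ρ' → 2 < ‖grd U x‖ → B i x (j, α) = B j x (i, α) := by
  set T : Mat n N → ℝ := fun z => ppow 2 (‖z‖ ^ 2 - 4) with hTd
  have hT : ContDiff ℝ 1 T := (contDiff_ppow one_lt_two).comp ((contDiff_norm_sq ℝ).sub contDiff_const)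
  have hT0 : ∀ z : Mat n N, ‖z‖ ≤ 2 → T z = 0 := fun z hz =>
    ppow_of_nonpos two_pos (by nlinarith [norm_nonneg z])
  obtain ⟨C, hC⟩ := H.lip α
  have hgb : ∀ q x, |grd U x q| ≤ M := fun q x => (abs_apply_le _ _).trans (H.bdd x)
  have hgm : ∀ q, Measurable fun x => grd U x q := fun q => (measurable_coord q).comp (measurable_grd U)
  have key : ∀ ζ : Eu n → ℝ, ContDiff ℝ (⊤ : ℕ∞) ζ → ∀ R, 0 < R → R < ρ → (∀ x ∉ closedBall x₀ R, ζ x = 0) →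
      ∀ i j, Integrable (fun x => ζ x * (T (grd U x) * B i x (j, α))) ∧
      ∫ x, ζ x * (T (grd U x) * B i x (j, α)) = -∫ x, grd U x (j, α) *
        (fderiv ℝ ζ x (ee i) * T (grd U x) + ζ x * fderiv ℝ T (grd U x) (B i x)) := by
    intro ζ hζ R hR0 hR hζ0 i j
    have hζ1 : ContDiff ℝ 1 ζ := by exact_mod_cast contDiff_infty.1 hζ 1
    have hD := S.chain hp H hT hT0 hR0 hR hρ hζ1 hζ0 i
    have hE := S.chain hp H (contDiff_mul_coord hT (j, α)) (fun z hz => by rw [hT0 z hz, zero_mul])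
      hR0 hR hρ hζ1 hζ0 i
    have hDi := integrable_of_memLp_two hD.memLp_deriv (hD.ae_eq_zero fun x hx => by rw [hζ0 x hx, zero_mul])
    have hEi := integrable_of_memLp_two hE.memLp_deriv (hE.ae_eq_zero fun x hx => by rw [hζ0 x hx, zero_mul])
    have hgD : Integrable (fun x => grd U x (j, α) *
        (fderiv ℝ ζ x (ee i) * T (grd U x) + ζ x * fderiv ℝ T (grd U x) (B i x))) :=
      hDi.bdd_mul (hgm (j, α)).aestronglyMeasurable (Eventually.of_forall fun x => hgb (j, α) x)
    have he : (fun x => ζ x * (T (grd U x) * B i x (j, α))) = fun x =>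
        (fderiv ℝ ζ x (ee i) * (T (grd U x) * grd U x (j, α)) +
          ζ x * fderiv ℝ (fun z => T z * z (j, α)) (grd U x) (B i x)) - grd U x (j, α) *
        (fderiv ℝ ζ x (ee i) * T (grd U x) + ζ x * fderiv ℝ T (grd U x) (B i x)) := by
      ext x
      rw [fderiv_mul_coord hT]
      ring
    refine ⟨?_, ?_⟩
    · rw [he]; exact hEi.sub hgD
    · rw [he, integral_sub hEi hgD, hE.integral_eq_zero fun x hx => by rw [hζ0 x hx, zero_mul], zero_sub]
  have key2 : ∀ ζ : Eu n → ℝ, ContDiff ℝ (⊤ : ℕ∞) ζ → ∀ R, 0 < R → R < ρ → (∀ x ∉ closedBall x₀ R, ζ x = 0) →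
      ∫ x, ζ x * (T (grd U x) * (B i x (j, α) - B j x (i, α))) = 0 := by
    intro ζ hζ R hR0 hR hζ0
    have hζ1 : ContDiff ℝ 1 ζ := by exact_mod_cast contDiff_infty.1 hζ 1
    obtain ⟨h1, h2⟩ := key ζ hζ R hR0 hR hζ0 i j
    obtain ⟨h3, h4⟩ := key ζ hζ R hR0 hR hζ0 j i
    have h5 := sum_integral_mul_eq_zero (ι := Bool)
      (q := fun b x => bif b then grd U x (j, α) else -grd U x (i, α))
      (g := fun b x => bif b then (fderiv ℝ ζ x (ee i) * T (grd U x) + ζ x * fderiv ℝ T (grd U x) (B i x))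
        else (fderiv ℝ ζ x (ee j) * T (grd U x) + ζ x * fderiv ℝ T (grd U x) (B j x)))
      (e := fun b => bif b then ee i else ee j) (f := fun x => ζ x * T (grd U x)) (x₀ := x₀) (M := M)
      (lt_add_one R) (by
        rintro (_ | _)
        · exact (hgm _).neg
        · exact hgm _) (by
        rintro (_ | _) x
        · simpa using hgb _ x
        · exact hgb _ x) (by
        intro θ hθ hθ0
        have hc := integral_curl hC (by exact_mod_cast contDiff_infty.1 hθ 2)
          (HasCompactSupport.intro (isCompact_closedBall x₀ (R + 1)) hθ0) i j
        simp only [Fintype.sum_bool, cond_true, cond_false, grd_apply, neg_mul, integral_neg]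
        rw [hc]; ring) (fun x hx => by rw [hζ0 x hx, zero_mul]) (by
        rintro (_ | _)
        · exact S.chain hp H hT hT0 hR0 hR hρ hζ1 hζ0 j
        · exact S.chain hp H hT hT0 hR0 hR hρ hζ1 hζ0 i)
    simp only [Fintype.sum_bool, cond_true, cond_false, neg_mul, integral_neg] at h5
    have h6 : (fun x => ζ x * (T (grd U x) * (B i x (j, α) - B j x (i, α)))) = fun x =>
        ζ x * (T (grd U x) * B i x (j, α)) - ζ x * (T (grd U x) * B j x (i, α)) := by
      ext x; ring
    rw [h6, integral_sub h1 h3, h2, h4]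
    linarith
  obtain ⟨R, hR1, hR2⟩ := exists_between hρ'
  have hloc : IntegrableOn (fun x => T (grd U x) * (B i x (j, α) - B j x (i, α))) (ball x₀ ρ') := by
    obtain ⟨_, _, hcut⟩ := exists_cutoff
    obtain ⟨ζ, hζ, -, -, hζρ, hζR, -⟩ := hcut n x₀ ρ' R hρ0 hR1
    have h1 := ((key ζ hζ R (hρ0.trans hR1) hR2 hζR i j).1.sub
      (key ζ hζ R (hρ0.trans hR1) hR2 hζR j i).1).integrableOn (s := ball x₀ ρ')
    refine h1.congr_fun (fun x hx => ?_) measurableSet_ball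
    simp only [Pi.sub_apply]
    rw [hζρ x (ball_subset_closedBall hx)]; ring
  have h0 := isOpen_ball.ae_eq_zero_of_integral_contDiff_smul_eq_zero hloc.locallyIntegrableOn
    (fun ζ hζ _ hsub => by
      simp only [smul_eq_mul]
      refine key2 ζ (by exact_mod_cast hζ) ρ' hρ0 hρ' fun x hx => ?_
      exact image_eq_zero_of_notMem_tsupport fun h => hx (ball_subset_closedBall (hsub h)))
  filter_upwards [h0] with x hx hxρ h2
  have hpos : 0 < T (grd U x) := by
    have : 0 < ‖grd U x‖ ^ 2 - 4 := by nlinarith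
    rw [hTd]; simp only
    rw [ppow_of_pos this.le]; positivity
  have := (mul_eq_zero.1 (hx hxρ)).resolve_left hpos.ne'
  linarith

end

section

open Filter Topology

variable {n N : ℕ}

/-- A sequence bounded in `L²` and converging almost everywhere converges weakly in `L²`. -/
theorem tendsto_integral_mul_of_bounded {X : Type*} [MeasurableSpace X] {μ : Measure X} [IsFiniteMeasure μ]
    {q : ℕ → X → ℝ} {q' g : X → ℝ} {K : ℝ≥0} (hq : ∀ k, AEStronglyMeasurable (q k) μ)
    (hK : ∀ k, eLpNorm (q k) 2 μ ≤ K) (hlim : ∀ᵐ x ∂μ, Tendsto (fun k => q k x) atTop (𝓝 (q' x)))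
    (hg : MemLp g 2 μ) :
    Integrable (fun x => q' x * g x) μ ∧
      Tendsto (fun k => ∫ x, q k x * g x ∂μ) atTop (𝓝 (∫ x, q' x * g x ∂μ)) := by
  have hq' : MemLp q' 2 μ := by
    refine ⟨aestronglyMeasurable_of_tendsto_ae atTop hq hlim, ?_⟩
    refine (Lp.eLpNorm_lim_le_liminf_eLpNorm hq q' hlim).trans_lt ?_
    refine lt_of_le_of_lt (liminf_le_of_le (a := (K : ℝ≥0∞)) (by isBoundedDefault) fun b hb => ?_)
      ENNReal.coe_lt_top
    obtain ⟨k, hk⟩ := hb.exists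
    exact hk.trans (hK k)
  have hqk : ∀ k, MemLp (q k) 2 μ := fun k => ⟨hq k, (hK k).trans_lt ENNReal.coe_lt_top⟩
  have hi : Integrable (fun x => q' x * g x) μ := hq'.integrable_mul hg
  have hik : ∀ k, Integrable (fun x => q k x * g x) μ := fun k => (hqk k).integrable_mul hg
  refine ⟨hi, tendsto_integral_of_L1' _ hi.aestronglyMeasurable (Eventually.of_forall hik) ?_⟩
  refine tendsto_Lp_finite_of_tendsto_ae le_rfl ENNReal.one_ne_top (fun k => (hik k).aestronglyMeasurable)
    (memLp_one_iff_integrable.2 hi) ?_ ?_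
  · intro ε hε
    obtain ⟨δ, hδ, h⟩ := hg.eLpNorm_indicator_le one_le_two ENNReal.ofNat_ne_top
      (ε := ε / (K + 1)) (by positivity)
    refine ⟨δ, hδ, fun k s hs hμ => ?_⟩
    have e : s.indicator (fun x => q k x * g x) = q k • s.indicator g := by
      ext x
      by_cases hx : x ∈ s <;> simp [hx]
    rw [e]
    refine (eLpNorm_smul_le_mul_eLpNorm (hg.1.indicator hs) (hq k) (p := 2) (q := 2)).trans ?_
    refine (mul_le_mul' (hK k) (h s hs hμ)).trans ?_
    rw [← ENNReal.ofReal_coe_nnreal, ← ENNReal.ofReal_mul (NNReal.coe_nonneg K)]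
    refine ENNReal.ofReal_le_ofReal ?_
    rw [mul_div_assoc', div_le_iff₀ (by positivity)]
    nlinarith [K.2]
  · filter_upwards [hlim] with x hx
    exact hx.mul_const _

theorem fderiv_eq_zero_of_norm_le {V : Type*} [NormedAddCommGroup V] [NormedSpace ℝ V] {T : V → ℝ}
    (hT : ContDiff ℝ 1 T) {c : ℝ} (hc : 0 < c)
    (hT0 : ∀ z, ‖z‖ ≤ c → T z = 0) {z : V} (hz : ‖z‖ ≤ c) : fderiv ℝ T z = 0 := by
  have hcl : IsClosed {z : V | fderiv ℝ T z = 0} :=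
    isClosed_eq (hT.continuous_fderiv one_ne_zero) continuous_const
  have hsub : ball (0 : V) c ⊆ {z : V | fderiv ℝ T z = 0} := fun y hy => by
    have : T =ᶠ[𝓝 y] fun _ => 0 := by
      filter_upwards [isOpen_ball.mem_nhds hy] with w hw
      exact hT0 w (mem_ball_zero_iff.1 hw).le
    simp [this.fderiv_eq]
  have := hcl.closure_subset_iff.2 hsub
  rw [closure_ball _ hc.ne'] at this
  exact this (by simpa using hz)

theorem fderiv_eq_zero_of_notMem {ζ : Eu n → ℝ} {x₀ : Eu n} {R : ℝ}
    (hζ0 : ∀ x ∉ closedBall x₀ R, ζ x = 0) {x : Eu n} (hx : x ∉ closedBall x₀ R) : fderiv ℝ ζ x = 0 := by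
  have : ζ =ᶠ[𝓝 x] fun _ => 0 := by
    filter_upwards [isClosed_closedBall.isOpen_compl.mem_nhds hx] with w hw
    exact hζ0 w hw
  simp [this.fderiv_eq]

theorem LMin.euler_translate {p : ℝ} (hp : 1 < p) {U : Fin N → Eu n → ℝ} {x₀ : Eu n} {r M : ℝ}
    (H : LMin p U x₀ r M) (α : Fin N) {ρ : ℝ} {ζ : Eu n → ℝ} (hζ : ContDiff ℝ 1 ζ)
    (hζ0 : ∀ x ∉ closedBall x₀ ρ, ζ x = 0) {v : Eu n} (hv : ρ + ‖v‖ < r) :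
    ∑ i, ∫ x, sig p (grd U (x + v)) (i, α) * fderiv ℝ ζ x (ee i) = 0 := by
  have h := H.euler hp α hv (ζ := fun x => ζ (x - v)) (hζ.comp (contDiff_id.sub contDiff_const))
    fun x hx => hζ0 _ fun h => hx ?_
  · rw [← h]
    refine Finset.sum_congr rfl fun i _ => ?_
    rw [← integral_add_right_eq_self (fun x => sig p (grd U x) (i, α) *
      fderiv ℝ (fun x => ζ (x - v)) x (ee i)) v]
    refine integral_congr_ae (Eventually.of_forall fun x => ?_)
    simp only [fderiv_comp_sub, add_sub_cancel_right]
  · rw [mem_closedBall, dist_eq_norm] at h ⊢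
    have := norm_add_le (x - v - x₀) v
    rw [show x - v - x₀ + v = x - x₀ by abel] at this
    linarith

theorem SecDer.linearized {p : ℝ} (hp : 1 < p) {U : Fin N → Eu n → ℝ} {x₀ : Eu n} {r M : ℝ}
    (H : LMin p U x₀ r M) {ρ : ℝ} {B : Fin n → Eu n → Mat n N}
    {h : ℕ → ℝ} (S : SecDer U x₀ ρ B h) {T : Mat n N → ℝ} (hT : ContDiff ℝ 1 T)
    (hT0 : ∀ z, ‖z‖ ≤ 2 → T z = 0) {ρ' : ℝ} (hρ0 : 0 < ρ') (hρ' : ρ' < ρ) (hρ : ρ < r) {ζ : Eu n → ℝ}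
    (hζ : ContDiff ℝ 1 ζ) (hζ0 : ∀ x ∉ closedBall x₀ ρ', ζ x = 0) (s : Fin n) (α : Fin N) :
    (∀ i, Integrable fun x => fderiv ℝ (sig p) (grd U x) (B s x) (i, α) *
      (fderiv ℝ ζ x (ee i) * T (grd U x) + ζ x * fderiv ℝ T (grd U x) (B i x))) ∧
    ∑ i, ∫ x, fderiv ℝ (sig p) (grd U x) (B s x) (i, α) *
      (fderiv ℝ ζ x (ee i) * T (grd U x) + ζ x * fderiv ℝ T (grd U x) (B i x)) = 0 := by
  obtain ⟨C, hC, δ, hδ, hgap⟩ := H.integral_gap_le hp (hρ0.trans hρ') hρ s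
  obtain ⟨C₁, hC₁, hsig⟩ := norm_sig_sub_le (V := Mat n N) hp M
  set g : Fin n → Eu n → ℝ := fun i x =>
    fderiv ℝ ζ x (ee i) * T (grd U x) + ζ x * fderiv ℝ T (grd U x) (B i x) with hg
  have hgL : ∀ i, HasL2Deriv (fun x => ζ x * T (grd U x)) (g i) (ee i) := fun i =>
    S.chain hp H hT hT0 hρ0 hρ' hρ hζ hζ0 i
  set E : Set (Eu n) := ball x₀ ρ ∩ {x | 2 < ‖grd U x‖} with hE
  have hEm : MeasurableSet E := measurableSet_ball.inter (measurableSet_lt measurable_const (measurable_grd U).norm)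
  have : IsFiniteMeasure (volume.restrict E) := ⟨by
    rw [Measure.restrict_apply_univ]
    exact (measure_mono inter_subset_left).trans_lt measure_ball_lt_top⟩
  have hg0 : ∀ i x, x ∉ E → g i x = 0 := fun i x hx => by
    by_cases h1 : ‖grd U x‖ ≤ 2
    · simp [hg, hT0 _ h1, fderiv_eq_zero_of_norm_le hT two_pos hT0 h1]
    · have h2 : x ∉ closedBall x₀ ρ' := fun h => hx ⟨closedBall_subset_ball hρ' h, not_le.1 h1⟩
      simp [hg, hζ0 x h2, fderiv_eq_zero_of_notMem hζ0 h2]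
  set q : ℝ → Fin n → Eu n → ℝ := fun t i x =>
    t⁻¹ * (sig p (grd U (x + t • ee s)) (i, α) - sig p (grd U x) (i, α)) with hq
  have hsm : ∀ v i, Measurable fun x => sig p (grd U (x + v)) (i, α) := fun v i =>
    (measurable_coord (i, α)).comp ((measurable_sig hp).comp ((measurable_grd U).comp
      (measurable_id.add_const v)))
  have hsm0 : ∀ i, Measurable fun x => sig p (grd U x) (i, α) := fun i =>
    (measurable_coord (i, α)).comp ((measurable_sig hp).comp (measurable_grd U))
  have hsb : ∀ x i, |sig p (grd U x) (i, α)| ≤ p * M ^ (p - 1) * Real.exp (M ^ p) := fun x i =>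
    (abs_apply_le _ _).trans (norm_sig_le hp (H.bdd x))
  have hqm : ∀ t i, Measurable (q t i) := fun t i => ((hsm _ i).sub (hsm0 i)).const_mul _
  obtain ⟨R, hR1, hR2⟩ := exists_between hρ'
  have hR3 : R < r := hR2.trans hρ
  have hzero : ∀ t, |t| < r - R → ∑ i, ∫ x, q t i x * g i x = 0 := fun t ht => by
    refine sum_integral_mul_eq_zero (M := |t⁻¹| * (2 * (p * M ^ (p - 1) * Real.exp (M ^ p)))) hR1 (hqm t)
      (fun i x => ?_) (fun θ hθ hθ0 => ?_)
      (fun x hx => by rw [hζ0 x hx, zero_mul]) hgL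
    · simp only [hq, abs_mul]
      gcongr
      refine (abs_sub _ _).trans ?_
      linarith [hsb x i, hsb (x + t • ee s) i]
    · have hθ1 : ContDiff ℝ 1 θ := by exact_mod_cast contDiff_infty.1 hθ 1
      have h1 := H.euler_translate hp α hθ1 hθ0 (v := t • ee s) (by
        rw [norm_smul, norm_ee, Real.norm_eq_abs]; linarith)
      have h2 := H.euler hp α hR3 hθ1 hθ0
      have hci : ∀ i, Integrable fun x => fderiv ℝ θ x (ee i) := fun i =>
        ((hθ1.continuous_fderiv one_ne_zero).clm_apply continuous_const).integrable_of_hasCompactSupport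
          ((HasCompactSupport.intro (isCompact_closedBall x₀ R) hθ0).fderiv_apply ℝ (ee i))
      have h3 : ∀ i, ∫ x, q t i x * fderiv ℝ θ x (ee i) =
          t⁻¹ * (∫ x, sig p (grd U (x + t • ee s)) (i, α) * fderiv ℝ θ x (ee i)) -
          t⁻¹ * ∫ x, sig p (grd U x) (i, α) * fderiv ℝ θ x (ee i) := fun i => by
        rw [← integral_const_mul, ← integral_const_mul, ← integral_sub]
        · congr 1; ext x; simp only [hq]; ring
        · exact ((hci i).bdd_mul (hsm _ i).aestronglyMeasurable
            (Eventually.of_forall fun x => hsb (x + t • ee s) i)).const_mul _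
        · exact ((hci i).bdd_mul (hsm0 i).aestronglyMeasurable
            (Eventually.of_forall fun x => hsb x i)).const_mul _
      simp only [h3, Finset.sum_sub_distrib, ← Finset.mul_sum, h1, h2, mul_zero, sub_zero]
  have hql : ∀ i t, t ≠ 0 → |t| < δ → eLpNorm (q t i) 2 (volume.restrict E) ≤ (Real.toNNReal (C₁ * √C) : ℝ≥0) := by
    intro i t ht0 ht
    have hb : MemLp (q t i) 2 (volume.restrict E) := MemLp.of_bound (hqm t i).aestronglyMeasurable
      (|t⁻¹| * (2 * (p * M ^ (p - 1) * Real.exp (M ^ p)))) (Eventually.of_forall fun x => by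
        simp only [hq, norm_mul, Real.norm_eq_abs]
        gcongr
        refine (abs_sub _ _).trans ?_
        linarith [hsb x i, hsb (x + t • ee s) i])
    rw [eLpNorm_two_eq hb]
    refine ENNReal.ofReal_le_ofReal ?_
    refine Real.sqrt_le_iff.2 ⟨by positivity, ?_⟩
    rw [mul_pow, Real.sq_sqrt hC]
    have hgi : IntegrableOn (fun x => gap U (x + t • ee s) x) (ball x₀ ρ) := by
      simpa using integrableOn_gap H.bdd (t • ee s) 0 x₀ ρ
    calc ∫ x in E, q t i x ^ 2 ≤ ∫ x in E, C₁ ^ 2 * (t ^ 2)⁻¹ * gap U (x + t • ee s) x := by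
          refine setIntegral_mono_on hb.integrable_sq ((hgi.mono_set inter_subset_left).const_mul _) hEm fun x hx => ?_
          have h2 : 2 < ‖grd U x‖ := hx.2
          have h1 : (1 : ℝ) ≤ ‖grd U x‖ := by linarith
          have h3 := hsig _ (grd U (x + t • ee s)) h1 (H.bdd x) (H.bdd _)
          have h4 : |sig p (grd U (x + t • ee s)) (i, α) - sig p (grd U x) (i, α)| ≤
              C₁ * ‖grd U (x + t • ee s) - grd U x‖ := (abs_apply_le (sig p (grd U (x + t • ee s)) - sig p (grd U x)) (i, α)).trans h3
          rw [gap, if_pos (Or.inr h1)]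
          simp only [hq, mul_pow, inv_pow]
          rw [mul_comm (C₁ ^ 2), mul_assoc, ← mul_pow]
          refine mul_le_mul_of_nonneg_left ?_ (by positivity)
          rw [← sq_abs]
          exact pow_le_pow_left₀ (abs_nonneg _) h4 2
      _ ≤ ∫ x in ball x₀ ρ, C₁ ^ 2 * (t ^ 2)⁻¹ * gap U (x + t • ee s) x :=
          setIntegral_mono_set (hgi.const_mul _) (Eventually.of_forall fun x => by
            have := gap_nonneg U (x + t • ee s) x
            simp only [Pi.zero_apply]; positivity) inter_subset_left.eventuallyLE
      _ = C₁ ^ 2 * (t ^ 2)⁻¹ * ∫ x in ball x₀ ρ, gap U (x + t • ee s) x := integral_const_mul _ _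
      _ ≤ C₁ ^ 2 * (t ^ 2)⁻¹ * (C * t ^ 2) := by
          gcongr
          exact hgap t ht
      _ = C₁ ^ 2 * C := by field_simp
  obtain ⟨k₀, hk₀⟩ : ∃ k₀, ∀ k ≥ k₀, |h k| < min δ (r - R) := by
    have : ∀ᶠ k in atTop, |h k| < min δ (r - R) := by
      have h1 := S.lim.abs
      rw [abs_zero] at h1
      exact h1.eventually (gt_mem_nhds (lt_min hδ (by linarith)))
    exact eventually_atTop.1 this
  have hT1 : Tendsto (fun k : ℕ => k + k₀) atTop atTop := tendsto_add_atTop_nat k₀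
  have hlim : ∀ i, ∀ᵐ x ∂volume.restrict E, Tendsto (fun k => q (h (k + k₀)) i x) atTop
      (𝓝 (fderiv ℝ (sig p) (grd U x) (B s x) (i, α))) := fun i => by
    rw [ae_restrict_iff' hEm]
    filter_upwards [S.large s] with x hx hxE
    have h2 : 2 < ‖grd U x‖ := hxE.2
    have h3 := hx hxE.1 (by linarith)
    have h4 := tendsto_sub_nhds_zero_iff.2 (tendsto_of_quot S.ne S.lim h3)
    have hne : grd U x ≠ 0 := norm_pos_iff.1 (by linarith)
    have h5 := (((contDiffAt_sig hp hne).differentiableAt one_ne_zero).hasFDerivAt.hasFDerivWithinAt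
      (s := univ)).lim h4 (Eventually.of_forall fun _ => mem_univ _) h3
    have h6 := ((EuclideanSpace.proj (i, α) : Mat n N →L[ℝ] ℝ).continuous.tendsto _).comp h5
    refine (h6.comp hT1).congr fun k => ?_
    simp [hq]
  have hW := fun i => tendsto_integral_mul_of_bounded (μ := volume.restrict E)
    (fun k => (hqm (h (k + k₀)) i).aestronglyMeasurable)
    (fun k => hql i _ (S.ne _) ((hk₀ _ (Nat.le_add_left _ _)).trans_le (min_le_left _ _))) (hlim i)
    ((hgL i).memLp_deriv.restrict E)
  have hset : ∀ (f : Eu n → ℝ) i, ∫ x in E, f x * g i x = ∫ x, f x * g i x := fun f i =>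
    setIntegral_eq_integral_of_forall_compl_eq_zero fun x hx => by rw [hg0 i x hx, mul_zero]
  refine ⟨fun i => ?_, ?_⟩
  · have := (hW i).1
    refine (integrableOn_iff_integrable_of_support_subset fun x hx => ?_).1 this
    by_contra hxE
    exact hx (mul_eq_zero_of_right _ (hg0 i x hxE))
  · have h1 := tendsto_finsetSum Finset.univ fun i _ => (hW i).2
    simp only [hset] at h1
    refine tendsto_nhds_unique (h1.congr fun k => ?_) tendsto_const_nhds
    exact hzero _ ((hk₀ _ (Nat.le_add_left _ _)).trans_le (min_le_right _ _))

end

section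

open Filter Topology

variable {n N : ℕ}

theorem sum_mul_sum_eq_inner (c : Fin n → ℝ) (ξ : Mat n N) (B : Fin n → Mat n N) :
    ∑ s, ∑ α, ∑ i, c s * (ξ (i, α) * B s (i, α)) = ∑ s, c s * inner ℝ ξ (B s) := by
  refine Finset.sum_congr rfl fun s _ => ?_
  rw [PiLp.inner_apply, Fintype.sum_prod_type, Finset.mul_sum, Finset.sum_comm]
  refine Finset.sum_congr rfl fun i _ => ?_
  rw [Finset.mul_sum]
  refine Finset.sum_congr rfl fun α _ => ?_
  simp [mul_comm]

theorem sum_mul_sum_eq_inner' (c : Fin n → ℝ) (ξ : Mat n N) (B : Fin n → Mat n N) :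
    ∑ s, ∑ α, ∑ i, c i * (ξ (s, α) * B i (s, α)) = ∑ s, c s * inner ℝ ξ (B s) := by
  rw [← sum_mul_sum_eq_inner, Finset.sum_comm, Finset.sum_comm (s := Finset.univ (α := Fin n))]
  exact Finset.sum_congr rfl fun α _ => Finset.sum_comm

theorem sum_mul_sum_eq_sum_mul (c d : Fin n → ℝ) (ξ : Mat n N) :
    ∑ s, ∑ α, ∑ i, (c s * ξ (s, α)) * (d i * ξ (i, α)) =
      ∑ α, (∑ s, c s * ξ (s, α)) * (∑ i, d i * ξ (i, α)) := by
  rw [Finset.sum_comm]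
  refine Finset.sum_congr rfl fun α _ => ?_
  rw [Finset.sum_mul_sum]

theorem sum_sq_contraction_le (y : Fin n → ℝ) (ξ : Mat n N) :
    ∑ α, (∑ i, y i * ξ (i, α)) ^ 2 ≤ ‖ξ‖ ^ 2 * ∑ i, y i ^ 2 := by
  calc ∑ α, (∑ i, y i * ξ (i, α)) ^ 2 ≤ ∑ α, (∑ i, y i ^ 2) * ∑ i, ξ (i, α) ^ 2 :=
        Finset.sum_le_sum fun α _ => Finset.sum_mul_sq_le_sq_mul_sq _ _ _
    _ = ‖ξ‖ ^ 2 * ∑ i, y i ^ 2 := by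
        rw [← Finset.mul_sum, EuclideanSpace.real_norm_sq_eq, Fintype.sum_prod_type, Finset.sum_comm, mul_comm]

theorem caccioppoli_algebra {ξ : Mat n N} {B : Fin n → Mat n N}
    (hB : ∀ i j α, B i (j, α) = B j (i, α)) {a k η Y v m : ℝ} (ha : 0 < a) (hk : 0 ≤ k)
    (hv : 0 ≤ v) (hm : 3 / 2 ≤ m) (y w : Fin n → ℝ) (hw : ∀ i, w i = a * inner ℝ ξ (B i)) :
    ∑ i, (y i * (v * Y) + η * (m * Y * w i)) ^ 2 ≤
      7 * (1 + k * ‖ξ‖ ^ 2) * (v * Y) ^ 2 * ∑ i, y i ^ 2 +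
      4 * m ^ 2 / (2 * m - 1) * ∑ s, ∑ α, ∑ i, (a * B s (i, α) + k * w s * ξ (i, α)) *
        (2 * η * y i * (v * Y ^ 2 * ξ (s, α)) +
          η ^ 2 * ((2 * m - 1) * Y ^ 2 * w i * ξ (s, α) + v * Y ^ 2 * B i (s, α))) := by
  set β := 2 * m - 1 with hβ
  have hβ2 : 2 ≤ β := by linarith
  have hmβ : 8 * m ^ 2 ≤ 5 * β ^ 2 := by
    rw [hβ]
    nlinarith [mul_nonneg (show 0 ≤ 12 * m - 2 by linarith) (show 0 ≤ m - 3 / 2 by linarith)]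
  set A := ∑ s, ∑ α, ∑ i, (B i (s, α)) ^ 2 with hA
  set W := ∑ i, w i ^ 2 with hW
  set VV := ∑ α, (∑ i, w i * ξ (i, α)) ^ 2 with hVV
  set WY := ∑ i, w i * y i with hWY
  set VY := ∑ α, (∑ i, w i * ξ (i, α)) * (∑ i, y i * ξ (i, α)) with hVY
  set Y2 := ∑ i, y i ^ 2 with hY2
  set VY2 := ∑ α, (∑ i, y i * ξ (i, α)) ^ 2 with hVY2
  have hQ : ∑ s, ∑ α, ∑ i, (a * B s (i, α) + k * w s * ξ (i, α)) *
        (2 * η * y i * (v * Y ^ 2 * ξ (s, α)) +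
          η ^ 2 * (β * Y ^ 2 * w i * ξ (s, α) + v * Y ^ 2 * B i (s, α))) =
      a * η ^ 2 * v * Y ^ 2 * A + k * η ^ 2 * v * Y ^ 2 / a * W + η ^ 2 * β * Y ^ 2 * W +
        k * η ^ 2 * β * Y ^ 2 * VV + 2 * η * v * Y ^ 2 * WY + 2 * η * v * Y ^ 2 * k * VY := by
    have e2 := sum_mul_sum_eq_inner w ξ B
    have e3 := sum_mul_sum_eq_inner' w ξ B
    have e5 := sum_mul_sum_eq_inner' y ξ B
    have e4 := sum_mul_sum_eq_sum_mul w w ξ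
    have e6 := sum_mul_sum_eq_sum_mul w y ξ
    have hW' : W = a * ∑ i, w i * inner ℝ ξ (B i) := by
      rw [hW, Finset.mul_sum]
      exact Finset.sum_congr rfl fun i _ => by
        calc w i ^ 2 = w i * w i := sq _
          _ = _ := by nth_rewrite 2 [hw i]; ring
    have hWY' : WY = a * ∑ i, y i * inner ℝ ξ (B i) := by
      rw [hWY, Finset.mul_sum]
      exact Finset.sum_congr rfl fun i _ => by rw [hw i]; ring
    have hVV' : VV = ∑ α, (∑ s, w s * ξ (s, α)) * (∑ i, w i * ξ (i, α)) :=
      Finset.sum_congr rfl fun α _ => sq _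
    have h2 : k * η ^ 2 * v * Y ^ 2 / a * W = k * η ^ 2 * v * Y ^ 2 * ∑ s, ∑ α, ∑ i, w s * (ξ (i, α) * B s (i, α)) := by
      rw [hW', e2]; field_simp
    rw [h2, hVV', ← e4, hW', ← e3, hWY', ← e5, hVY, ← e6, hA]
    simp only [Finset.mul_sum, ← Finset.sum_add_distrib]
    refine Finset.sum_congr rfl fun s _ => Finset.sum_congr rfl fun α _ => Finset.sum_congr rfl fun i _ => ?_
    rw [hB s i α]; ring
  rw [hQ]
  have hA0 : 0 ≤ A := by positivity
  have hW0 : 0 ≤ W := by positivity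
  have hY20 : 0 ≤ Y2 := by positivity
  have hV2 : VY2 ≤ ‖ξ‖ ^ 2 * Y2 := sum_sq_contraction_le y ξ
  have key : ∀ {ι : Type} [Fintype ι] (f g : ι → ℝ), 0 ≤ β / 2 * η ^ 2 * Y ^ 2 * ∑ i, f i ^ 2 +
      2 * η * v * Y ^ 2 * ∑ i, f i * g i + 2 / β * v ^ 2 * Y ^ 2 * ∑ i, g i ^ 2 := by
    intro ι _ f g
    have : β / 2 * η ^ 2 * Y ^ 2 * ∑ i, f i ^ 2 +
      2 * η * v * Y ^ 2 * ∑ i, f i * g i + 2 / β * v ^ 2 * Y ^ 2 * ∑ i, g i ^ 2 =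
        ∑ i, 2 / β * Y ^ 2 * (β / 2 * η * f i + v * g i) ^ 2 := by
      simp only [Finset.mul_sum, ← Finset.sum_add_distrib]
      refine Finset.sum_congr rfl fun i _ => ?_
      field_simp; ring
    rw [this]; positivity
  have k1 : 0 ≤ β / 2 * η ^ 2 * Y ^ 2 * W + 2 * η * v * Y ^ 2 * WY + 2 / β * v ^ 2 * Y ^ 2 * Y2 := key w y
  have k2 : 0 ≤ β / 2 * η ^ 2 * Y ^ 2 * VV + 2 * η * v * Y ^ 2 * VY + 2 / β * v ^ 2 * Y ^ 2 * VY2 :=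
    key (fun α => ∑ i, w i * ξ (i, α)) (fun α => ∑ i, y i * ξ (i, α))
  have hVV0 : 0 ≤ VV := by positivity
  have hD : ∑ i, (y i * (v * Y) + η * (m * Y * w i)) ^ 2 ≤
      2 * (v * Y) ^ 2 * Y2 + 2 * η ^ 2 * m ^ 2 * Y ^ 2 * W := by
    rw [hY2, hW]
    simp only [Finset.mul_sum, ← Finset.sum_add_distrib]
    refine Finset.sum_le_sum fun i _ => ?_
    nlinarith [sq_nonneg (y i * (v * Y) - η * (m * Y * w i))]
  refine hD.trans ?_
  clear hD key hQ
  clear_value A W VV WY VY Y2 VY2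
  have hQ2 : β / 2 * η ^ 2 * Y ^ 2 * W ≤ (a * η ^ 2 * v * Y ^ 2 * A + k * η ^ 2 * v * Y ^ 2 / a * W + η ^ 2 * β * Y ^ 2 * W +
        k * η ^ 2 * β * Y ^ 2 * VV + 2 * η * v * Y ^ 2 * WY + 2 * η * v * Y ^ 2 * k * VY) +
        2 / β * v ^ 2 * Y ^ 2 * (1 + k * ‖ξ‖ ^ 2) * Y2 := by
    have t1 : 0 ≤ a * η ^ 2 * v * Y ^ 2 * A := by positivity
    have t2 : 0 ≤ k * η ^ 2 * v * Y ^ 2 / a * W := by positivity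
    have t3 := mul_nonneg hk k2
    have t4 : 0 ≤ k * (β / 2 * η ^ 2 * Y ^ 2 * VV) := by positivity
    have t5 : k * (2 / β * v ^ 2 * Y ^ 2 * VY2) ≤ k * (2 / β * v ^ 2 * Y ^ 2 * (‖ξ‖ ^ 2 * Y2)) := by gcongr
    linarith
  set Q := a * η ^ 2 * v * Y ^ 2 * A + k * η ^ 2 * v * Y ^ 2 / a * W + η ^ 2 * β * Y ^ 2 * W +
        k * η ^ 2 * β * Y ^ 2 * VV + 2 * η * v * Y ^ 2 * WY + 2 * η * v * Y ^ 2 * k * VY with hQd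
  have hmul := mul_le_mul_of_nonneg_left hQ2 (show 0 ≤ 4 * m ^ 2 / β by positivity)
  have e1 : 4 * m ^ 2 / β * (β / 2 * η ^ 2 * Y ^ 2 * W) = 2 * η ^ 2 * m ^ 2 * Y ^ 2 * W := by
    field_simp; ring
  have e2 : 4 * m ^ 2 / β * (2 / β * v ^ 2 * Y ^ 2 * (1 + k * ‖ξ‖ ^ 2) * Y2) ≤
      5 * ((1 + k * ‖ξ‖ ^ 2) * (v * Y) ^ 2 * Y2) := by
    have : 4 * m ^ 2 / β * (2 / β * v ^ 2 * Y ^ 2 * (1 + k * ‖ξ‖ ^ 2) * Y2) =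
        (8 * m ^ 2 / β ^ 2) * ((1 + k * ‖ξ‖ ^ 2) * (v * Y) ^ 2 * Y2) := by
      field_simp; ring
    rw [this]
    gcongr
    rwa [div_le_iff₀ (by positivity)]
  have e3 : 2 * (v * Y) ^ 2 * Y2 ≤ 2 * ((1 + k * ‖ξ‖ ^ 2) * (v * Y) ^ 2 * Y2) := by
    have : 0 ≤ k * ‖ξ‖ ^ 2 * ((v * Y) ^ 2 * Y2) := by positivity
    linarith
  rw [mul_add, e1] at hmul
  linarith

theorem fderiv_sig {V : Type*} [NormedAddCommGroup V] [InnerProductSpace ℝ V] {p : ℝ} (hp : 1 < p)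
    {z : V} (hz : z ≠ 0) (w : V) : fderiv ℝ (sig p) z w =
      aa p z • w + ((p - 2 + p * ‖z‖ ^ p) / ‖z‖ ^ 2 * (aa p z * inner ℝ z w)) • z := by
  have hn : 0 < ‖z‖ := norm_pos_iff.2 hz
  have h1 : HasFDerivAt (fun z : V => ‖z‖ ^ (p - 2)) (((p - 2) * ‖z‖ ^ (p - 4)) • innerSL ℝ z) z := by
    have h := ((hasStrictFDerivAt_norm_sq z).hasFDerivAt).rpow_const (p := (p - 2) / 2)
      (Or.inl (by positivity))
    have e : (fun x : V => (‖x‖ ^ 2) ^ ((p - 2) / 2)) = fun x => ‖x‖ ^ (p - 2) := by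
      ext x
      rw [← Real.rpow_natCast_mul (norm_nonneg x)]; congr 1; push_cast; ring
    rw [e] at h
    refine h.congr_fderiv ?_
    rw [← Real.rpow_natCast_mul hn.le, ← Nat.cast_smul_eq_nsmul ℝ, smul_smul]
    congr 1
    push_cast
    rw [show (2 : ℝ) * ((p - 2) / 2 - 1) = p - 4 by ring]; ring
  have h2 : HasFDerivAt (sig p : V → V) _ z :=
    (((h1.const_mul p).mul (hasFDerivAt_FF hp z)).smul (hasFDerivAt_id z))
  rw [h2.fderiv]
  simp only [_root_.add_apply, _root_.smul_apply, ContinuousLinearMap.smulRight_apply, innerSL_apply_apply,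
    ContinuousLinearMap.id_apply, smul_eq_mul]
  have e4 : ‖z‖ ^ (p - 2) = ‖z‖ ^ (p - 4) * ‖z‖ ^ 2 := by
    rw [← Real.rpow_natCast, ← Real.rpow_add hn]; norm_num; congr 1; ring
  have e5 : ‖z‖ ^ p = ‖z‖ ^ (p - 4) * ‖z‖ ^ 4 := by
    rw [← Real.rpow_natCast, ← Real.rpow_add hn]; norm_num
  congr 2
  simp only [aa, e4, e5]
  field_simp
  ring

end

section

open Filter Topology

variable {n N : ℕ}

/-- Powers of the excess of the integrand over the level `exp (2 ^ p)`. -/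
def tt (p m : ℝ) (z : Mat n N) : ℝ := ppow m (FF p z - Real.exp (2 ^ p))

theorem contDiff_tt {p m : ℝ} (hp : 1 < p) (hm : 1 < m) : ContDiff ℝ 1 (tt p m : Mat n N → ℝ) :=
  (contDiff_ppow hm).comp ((contDiff_FF hp).sub contDiff_const)

theorem tt_eq_zero {p m : ℝ} (hp : 1 < p) (hm : 0 < m) {z : Mat n N} (hz : ‖z‖ ≤ 2) : tt p m z = 0 := by
  refine ppow_of_nonpos hm (sub_nonpos.2 (Real.exp_le_exp.2 ?_))
  exact Real.rpow_le_rpow (norm_nonneg z) hz (by linarith)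

theorem tt_nonneg (p m : ℝ) (z : Mat n N) : 0 ≤ tt p m z := ppow_nonneg _ _

theorem fderiv_tt {p m : ℝ} (hp : 1 < p) (hm : 1 < m) (z w : Mat n N) :
    fderiv ℝ (tt p m) z w = m * tt p (m - 1) z * (aa p z * inner ℝ z w) := by
  have h : HasFDerivAt (tt p m : Mat n N → ℝ) _ z :=
    (hasDerivAt_ppow hm _).comp_hasFDerivAt z ((hasFDerivAt_FF hp z).sub_const (Real.exp (2 ^ p)))
  rw [h.fderiv]
  simp [tt]

theorem tt_add {p l m : ℝ} (hl : 0 < l) (hm : 0 < m) (z : Mat n N) :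
    tt p (l + m) z = tt p l z * tt p m z := by
  rcases le_or_gt (FF p z - Real.exp (2 ^ p)) 0 with h | h
  · rw [tt, tt, ppow_of_nonpos (by linarith) h, ppow_of_nonpos hl h, zero_mul]
  · rw [tt, tt, tt, ppow_of_pos h.le, ppow_of_pos h.le, ppow_of_pos h.le, Real.rpow_add h]

theorem SecDer.caccioppoli {p : ℝ} (hp : 1 < p) {U : Fin N → Eu n → ℝ} {x₀ : Eu n} {r M : ℝ}
    (H : LMin p U x₀ r M) {ρ : ℝ} {B : Fin n → Eu n → Mat n N}
    {h : ℕ → ℝ} (S : SecDer U x₀ ρ B h) {ρ' : ℝ} (hρ0 : 0 < ρ') (hρ' : ρ' < ρ) (hρ : ρ < r) {η : Eu n → ℝ}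
    (hη : ContDiff ℝ 1 η) (hη0 : ∀ x ∉ closedBall x₀ ρ', η x = 0) {m L D : ℝ} (hm : 3 / 2 ≤ m)
    (hL : ∀ᵐ x, x ∈ closedBall x₀ ρ' → ‖grd U x‖ ^ p ≤ L) (hD : ∀ x, ‖fderiv ℝ η x‖ ≤ D) :
    ∑ i, ∫ x, (fderiv ℝ η x (ee i) * tt p m (grd U x) + η x * fderiv ℝ (tt p m) (grd U x) (B i x)) ^ 2 ≤
      7 * (p - 1 + p * L) * (n * D ^ 2) * ∫ x in closedBall x₀ ρ', tt p m (grd U x) ^ 2 := by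
  have hm1 : 1 < m := by linarith
  have hβ1 : 1 < 2 * m - 1 := by linarith
  set T : Fin n → Fin N → Mat n N → ℝ := fun s α z => tt p (2 * m - 1) z * z (s, α) with hT
  have hTc : ∀ s α, ContDiff ℝ 1 (T s α) := fun s α => contDiff_mul_coord (contDiff_tt hp hβ1) (s, α)
  have hT0 : ∀ s α z, ‖z‖ ≤ 2 → T s α z = 0 := fun s α z hz => by
    simp only [hT, tt_eq_zero hp (show 0 < 2 * m - 1 by linarith) hz, zero_mul]
  have hη2 : ContDiff ℝ 1 fun x => η x ^ 2 := hη.pow 2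
  have hη20 : ∀ x ∉ closedBall x₀ ρ', η x ^ 2 = 0 := fun x hx => by rw [hη0 x hx]; norm_num
  have hlin := fun s α => S.linearized hp H (hTc s α) (hT0 s α) hρ0 hρ' hρ hη2 hη20 s α
  set G : Fin n → Fin N → Fin n → Eu n → ℝ := fun s α i x => fderiv ℝ (sig p) (grd U x) (B s x) (i, α) *
      (fderiv ℝ (fun x => η x ^ 2) x (ee i) * T s α (grd U x) + η x ^ 2 * fderiv ℝ (T s α) (grd U x) (B i x))
    with hG
  have hGi : ∀ s α i, Integrable (G s α i) := fun s α i => (hlin s α).1 i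
  have hGs : ∫ x, ∑ s, ∑ α, ∑ i, G s α i x = 0 := by
    rw [integral_finsetSum _ fun s _ => integrable_finsetSum _ fun α _ => integrable_finsetSum _ fun i _ => hGi s α i]
    refine Finset.sum_eq_zero fun s _ => ?_
    rw [integral_finsetSum _ fun α _ => integrable_finsetSum _ fun i _ => hGi s α i]
    refine Finset.sum_eq_zero fun α _ => ?_
    rw [integral_finsetSum _ fun i _ => hGi s α i]
    exact (hlin s α).2
  have hGsi : Integrable fun x => ∑ s, ∑ α, ∑ i, G s α i x :=
    integrable_finsetSum _ fun s _ => integrable_finsetSum _ fun α _ => integrable_finsetSum _ fun i _ => hGi s α i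
  obtain ⟨ρ₁, hρ₁, hρ₂⟩ := exists_between hρ'
  have hsymm : ∀ᵐ x, ∀ i j α, x ∈ ball x₀ ρ₁ → 2 < ‖grd U x‖ → B i x (j, α) = B j x (i, α) := by
    simp only [ae_all_iff]
    exact fun i j α => S.symm hp H (hρ0.trans hρ₁) hρ₂ hρ i j α
  have hDl := fun i => (S.chain hp H (contDiff_tt hp hm1) (fun z hz => tt_eq_zero hp (by linarith) hz)
    hρ0 hρ' hρ hη hη0 i).memLp_deriv
  set Di : Fin n → Eu n → ℝ := fun i x => fderiv ℝ η x (ee i) * tt p m (grd U x) +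
    η x * fderiv ℝ (tt p m) (grd U x) (B i x) with hDi
  have hDsq : ∀ i, Integrable fun x => Di i x ^ 2 := fun i => (hDl i).integrable_sq
  rw [← integral_finsetSum _ fun i _ => hDsq i]
  have htm : Measurable fun x => tt p m (grd U x) :=
    (contDiff_tt hp hm1).continuous.measurable.comp (measurable_grd U)
  have htb : ∃ K, ∀ x, |tt p m (grd U x)| ≤ K := by
    obtain ⟨K, hK⟩ := (isCompact_closedBall (0 : Mat n N) M).exists_bound_of_continuousOn
      (contDiff_tt (p := p) hp hm1).continuous.continuousOn
    exact ⟨K, fun x => hK _ (mem_closedBall_zero_iff.2 (H.bdd x))⟩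
  obtain ⟨K, hK⟩ := htb
  have : IsFiniteMeasure (volume.restrict (closedBall x₀ ρ')) := ⟨by
    rw [Measure.restrict_apply_univ]; exact measure_closedBall_lt_top⟩
  have hti : IntegrableOn (fun x => tt p m (grd U x) ^ 2) (closedBall x₀ ρ') :=
    (MemLp.of_bound htm.aestronglyMeasurable K (Eventually.of_forall hK)).integrable_sq
  rw [← integrable_indicator_iff measurableSet_closedBall] at hti
  rw [← integral_indicator measurableSet_closedBall]
  have key : ∀ᵐ x, ∑ i, Di i x ^ 2 ≤ 7 * (p - 1 + p * L) * (n * D ^ 2) *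
      (closedBall x₀ ρ').indicator (fun x => tt p m (grd U x) ^ 2) x +
      4 * m ^ 2 / (2 * m - 1) * ∑ s, ∑ α, ∑ i, G s α i x := by
    filter_upwards [hsymm, hL] with x hx hxL
    by_cases hxρ : x ∈ closedBall x₀ ρ'
    · rw [indicator_of_mem hxρ]
      rcases le_or_gt ‖grd U x‖ 2 with h2 | h2
      · have e1 : ∀ i, Di i x = 0 := fun i => by
          simp [hDi, tt_eq_zero hp (show 0 < m by linarith) h2, fderiv_eq_zero_of_norm_le (contDiff_tt hp hm1) two_pos
            (fun z hz => tt_eq_zero hp (by linarith) hz) h2]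
        have e2 : ∀ s α i, G s α i x = 0 := fun s α i => by
          simp [hG, hT0 s α _ h2, fderiv_eq_zero_of_norm_le (hTc s α) two_pos (hT0 s α) h2]
        simp [e1, e2, tt_eq_zero hp (show 0 < m by linarith) h2]
      · have hn1 : (1 : ℝ) < ‖grd U x‖ := by linarith
        have hne : grd U x ≠ 0 := norm_pos_iff.1 (by linarith)
        have ht1 : (1 : ℝ) ≤ ‖grd U x‖ ^ p := Real.one_le_rpow hn1.le (by linarith)
        have hL' := hxL hxρ
        set k := (p - 2 + p * ‖grd U x‖ ^ p) / ‖grd U x‖ ^ 2 with hk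
        have hk0 : 0 ≤ k := div_nonneg (by nlinarith) (by positivity)
        have hkξ : 1 + k * ‖grd U x‖ ^ 2 = p - 1 + p * ‖grd U x‖ ^ p := by
          rw [hk]; field_simp; ring
        have ha : 0 < aa p (grd U x) := by
          unfold aa
          have := FF_pos p (grd U x)
          positivity
        have halg := caccioppoli_algebra (ξ := grd U x) (B := fun i => B i x)
          (fun i j α => hx i j α (closedBall_subset_ball hρ₁ hxρ) h2) (η := η x) (Y := tt p (m - 1) (grd U x)) ha
          hk0 (tt_nonneg p 1 (grd U x)) hm (fun i => fderiv ℝ η x (ee i)) _ (fun i => rfl)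
        have et : tt p m (grd U x) = tt p 1 (grd U x) * tt p (m - 1) (grd U x) := by
          rw [← tt_add one_pos (by linarith)]; congr 1; ring
        have et1 : tt p (2 * m - 1 - 1) (grd U x) = tt p (m - 1) (grd U x) ^ 2 := by
          rw [sq, ← tt_add (by linarith) (by linarith)]; congr 1; ring
        have et2 : tt p (2 * m - 1) (grd U x) = tt p 1 (grd U x) * tt p (m - 1) (grd U x) ^ 2 := by
          rw [← et1, ← tt_add one_pos (by linarith)]; congr 1; ring
        have eD : ∀ i, Di i x = fderiv ℝ η x (ee i) * (tt p 1 (grd U x) * tt p (m - 1) (grd U x)) +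
            η x * (m * tt p (m - 1) (grd U x) * (aa p (grd U x) * inner ℝ (grd U x) (B i x))) := fun i => by
          simp only [hDi]
          rw [fderiv_tt hp hm1, et]
        have eη : fderiv ℝ (fun x => η x ^ 2) x = (2 * η x) • fderiv ℝ η x := by
          have h : HasFDerivAt (fun x => η x ^ 2) _ x := ((hη.differentiable one_ne_zero x).hasFDerivAt).pow 2
          rw [h.fderiv]; simp
        have eG : ∀ s α i, G s α i x = (aa p (grd U x) * B s x (i, α) +
            k * (aa p (grd U x) * inner ℝ (grd U x) (B s x)) * grd U x (i, α)) *
            (2 * η x * fderiv ℝ η x (ee i) * (tt p 1 (grd U x) * tt p (m - 1) (grd U x) ^ 2 * grd U x (s, α)) +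
            η x ^ 2 * ((2 * m - 1) * tt p (m - 1) (grd U x) ^ 2 * (aa p (grd U x) * inner ℝ (grd U x) (B i x)) *
              grd U x (s, α) + tt p 1 (grd U x) * tt p (m - 1) (grd U x) ^ 2 * B i x (s, α))) := fun s α i => by
          simp only [hG, hT]
          rw [fderiv_sig hp hne, eη, fderiv_mul_coord (contDiff_tt hp hβ1), fderiv_tt hp hβ1, et1, et2]
          simp only [PiLp.add_apply, PiLp.smul_apply, smul_eq_mul, _root_.smul_apply, ← hk]
        simp only [eD, eG]
        refine halg.trans (add_le_add_left ?_ _)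
        rw [hkξ, ← et]
        have hs : ∑ i, fderiv ℝ η x (ee i) ^ 2 ≤ n * D ^ 2 := by
          calc ∑ i, fderiv ℝ η x (ee i) ^ 2 ≤ ∑ _i : Fin n, D ^ 2 := Finset.sum_le_sum fun i _ => by
                rw [← sq_abs]
                refine pow_le_pow_left₀ (abs_nonneg _) ?_ 2
                have := (fderiv ℝ η x).le_opNorm (ee i)
                rw [norm_ee, mul_one] at this
                exact this.trans (hD x)
            _ = n * D ^ 2 := by simp
        calc 7 * (p - 1 + p * ‖grd U x‖ ^ p) * tt p m (grd U x) ^ 2 * ∑ i, fderiv ℝ η x (ee i) ^ 2 ≤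
            7 * (p - 1 + p * L) * tt p m (grd U x) ^ 2 * (n * D ^ 2) := by
              have h1 : 0 ≤ p - 1 + p * ‖grd U x‖ ^ p := by nlinarith
              have h2 : p - 1 + p * ‖grd U x‖ ^ p ≤ p - 1 + p * L := by gcongr
              have h3 : 0 ≤ 7 * (p - 1 + p * L) * tt p m (grd U x) ^ 2 := mul_nonneg (by linarith) (sq_nonneg _)
              gcongr
          _ = _ := by ring
    · rw [indicator_of_notMem hxρ]
      have e1 : ∀ i, Di i x = 0 := fun i => by
        simp [hDi, hη0 x hxρ, fderiv_eq_zero_of_notMem hη0 hxρ]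
      have e2 : ∀ s α i, G s α i x = 0 := fun s α i => by
        simp [hG, hη0 x hxρ, fderiv_eq_zero_of_notMem hη20 hxρ]
      simp [e1, e2]
  refine (integral_mono_ae (integrable_finsetSum _ fun i _ => hDsq i)
    ((hti.const_mul _).add (hGsi.const_mul _)) key).trans (le_of_eq ?_)
  simp only [Pi.add_apply]
  rw [integral_add (hti.const_mul _) (hGsi.const_mul _), integral_const_mul, integral_const_mul, hGs, mul_zero,
    add_zero]

end

section

open Filter Topology

variable {n N : ℕ}

theorem tt_eq_rpow {p m : ℝ} (z : Mat n N) : tt p m z = ‖tt p 1 z‖ ^ m := by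
  rw [Real.norm_of_nonneg (tt_nonneg _ _ _), tt, tt, ppow, ppow, Real.rpow_one]

theorem continuous_tt {p m : ℝ} (hp : 1 < p) (hm : 0 < m) : Continuous (tt p m : Mat n N → ℝ) :=
  (continuous_ppow hm).comp ((continuous_FF hp).sub continuous_const)

theorem eLpNorm_tt {p m q : ℝ} (hm : 0 < m) (hq : 0 ≤ q) (U : Fin N → Eu n → ℝ) (μ : Measure (Eu n)) :
    eLpNorm (fun x => tt p m (grd U x)) (ENNReal.ofReal q) μ =
      eLpNorm (fun x => tt p 1 (grd U x)) (ENNReal.ofReal (q * m)) μ ^ m := by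
  rw [ENNReal.ofReal_mul hq, ← eLpNorm_norm_rpow _ hm]
  congr 1; ext x; exact tt_eq_rpow _

/-- One step of the Moser iteration. -/
theorem exists_moser_step (hn : 2 < n) (N : ℕ) {p : ℝ} (hp : 1 < p) : ∃ C > 0, ∀ (U : Fin N → Eu n → ℝ) (x₀ : Eu n) (r M : ℝ),
    LMin p U x₀ r M → ∀ ρ R L m : ℝ, 0 < ρ → ρ < R → R < r → 0 ≤ L → 3 / 2 ≤ m →
    (∀ᵐ x, x ∈ closedBall x₀ R → ‖grd U x‖ ^ p ≤ L) →
    eLpNorm (fun x => tt p 1 (grd U x)) (ENNReal.ofReal (2 * m * (n / (n - 2)))) (volume.restrict (closedBall x₀ ρ)) ^ m ≤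
      ENNReal.ofReal (C * √(1 + L) / (R - ρ)) *
      eLpNorm (fun x => tt p 1 (grd U x)) (ENNReal.ofReal (2 * m)) (volume.restrict (closedBall x₀ R)) ^ m := by
  obtain ⟨Cs, hCs⟩ := exists_sobolev hn
  obtain ⟨Cη, hCη, hcut⟩ := exists_cutoff
  have hn2 : (0 : ℝ) < n - 2 := by
    have : (2 : ℝ) < n := by exact_mod_cast hn
    linarith
  have hn0 : (0 : ℝ) < n := by linarith
  refine ⟨(Cs + 1) * n * (√(7 * p * n) * Cη), by positivity, fun U x₀ r M H ρ R L m hρ0 hρ hR hL0 hm hL => ?_⟩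
  have hRρ : 0 < R - ρ := by linarith
  obtain ⟨R', hR1, hR2⟩ := exists_between hR
  obtain ⟨B, h, S⟩ := H.exists_secDer hp ((hρ0.trans hρ).trans hR1) hR2
  obtain ⟨η, hη, -, -, hηρ, hηR, hηD⟩ := hcut n x₀ ρ R hρ0 hρ
  have hη1 : ContDiff ℝ 1 η := by exact_mod_cast contDiff_infty.1 hη 1
  have hm1 : 1 < m := by linarith
  have hcac := S.caccioppoli hp H (hρ0.trans hρ) hR1 hR2 hη1 hηR hm hL hηD
  have hch := fun i => S.chain hp H (contDiff_tt hp hm1) (fun z hz => tt_eq_zero hp (by linarith) hz)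
    (hρ0.trans hρ) hR1 hR2 hη1 hηR i
  have hsob := hCs _ _ x₀ R (fun x hx => by rw [hηR x hx, zero_mul]) hch
  set I := ∫ x in closedBall x₀ R, tt p m (grd U x) ^ 2 with hI
  have hI0 : 0 ≤ I := integral_nonneg fun x => sq_nonneg _
  have hfin : IsFiniteMeasure (volume.restrict (closedBall x₀ R)) := ⟨by
    rw [Measure.restrict_apply_univ]; exact measure_closedBall_lt_top⟩
  have htL2 : MemLp (fun x => tt p m (grd U x)) 2 (volume.restrict (closedBall x₀ R)) := by
    obtain ⟨K, hK⟩ := (isCompact_closedBall (0 : Mat n N) M).exists_bound_of_continuousOn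
      (continuous_tt (p := p) hp (show 0 < m by linarith)).continuousOn
    exact MemLp.of_bound (((continuous_tt hp (by linarith)).measurable.comp
      (measurable_grd U)).aestronglyMeasurable) K
      (Eventually.of_forall fun x => hK _ (mem_closedBall_zero_iff.2 (H.bdd x)))
  have hb : ∀ i, eLpNorm (fun x => fderiv ℝ η x (ee i) * tt p m (grd U x) +
      η x * fderiv ℝ (tt p m) (grd U x) (B i x)) 2 volume ≤
      ENNReal.ofReal (√(7 * p * n) * Cη * √(1 + L) / (R - ρ) * √I) := fun i => by
    rw [eLpNorm_two_eq (hch i).memLp_deriv]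
    refine ENNReal.ofReal_le_ofReal (Real.sqrt_le_iff.2 ⟨by positivity, ?_⟩)
    refine (Finset.single_le_sum (f := fun i => ∫ x, (fderiv ℝ η x (ee i) * tt p m (grd U x) +
      η x * fderiv ℝ (tt p m) (grd U x) (B i x)) ^ 2) (fun i _ => integral_nonneg fun x => sq_nonneg _)
      (Finset.mem_univ i)).trans (hcac.trans ?_)
    have e : (√(7 * p * n) * Cη * √(1 + L) / (R - ρ) * √I) ^ 2 =
        √(7 * p * n) ^ 2 * Cη ^ 2 * √(1 + L) ^ 2 / (R - ρ) ^ 2 * √I ^ 2 := by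
      rw [mul_pow _ (√I), div_pow, mul_pow, mul_pow]
    rw [e, Real.sq_sqrt (by positivity), Real.sq_sqrt (by positivity), Real.sq_sqrt hI0, div_pow]
    refine mul_le_mul_of_nonneg_right ?_ hI0
    calc 7 * (p - 1 + p * L) * (n * (Cη ^ 2 / (R - ρ) ^ 2)) ≤
        7 * (p * (1 + L)) * (n * (Cη ^ 2 / (R - ρ) ^ 2)) := by gcongr; linarith
      _ = _ := by ring
  have hexp : ((2 * n / (n - 2) : ℝ≥0) : ℝ≥0∞) = ENNReal.ofReal (2 * (n / (n - 2))) := by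
    rw [ENNReal.ofReal]
    congr 1
    rw [← NNReal.coe_inj, Real.coe_toNNReal _ (by positivity)]
    push_cast
    rw [NNReal.coe_sub (by exact_mod_cast hn.le)]
    push_cast; ring
  have h1 : eLpNorm (fun x => tt p m (grd U x)) (ENNReal.ofReal (2 * (n / (n - 2))))
      (volume.restrict (closedBall x₀ ρ)) ≤ eLpNorm (fun x => η x * tt p m (grd U x))
      ((2 * n / (n - 2) : ℝ≥0) : ℝ≥0∞) volume := by
    rw [hexp]
    refine (eLpNorm_congr_ae ?_).trans_le (eLpNorm_mono_measure _ Measure.restrict_le_self)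
    refine (ae_restrict_iff' measurableSet_closedBall).2 (Eventually.of_forall fun x hx => ?_)
    simp only [hηρ x hx, one_mul]
  have h2 : eLpNorm (fun x => tt p m (grd U x)) (ENNReal.ofReal 2) (volume.restrict (closedBall x₀ R)) =
      ENNReal.ofReal √I := by
    rw [ENNReal.ofReal_ofNat, eLpNorm_two_eq htL2]
  rw [eLpNorm_tt (by linarith) (by positivity)] at h1 h2
  rw [show 2 * m * ((n : ℝ) / (n - 2)) = 2 * (n / (n - 2)) * m by ring, h2]
  refine h1.trans (hsob.trans ?_)
  refine (mul_le_mul_right (Finset.sum_le_sum fun i _ => hb i) _).trans ?_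
  rw [Finset.sum_const, Finset.card_univ, Fintype.card_fin, nsmul_eq_mul, ← ENNReal.ofReal_coe_nnreal,
    ← ENNReal.ofReal_natCast, ← ENNReal.ofReal_mul (by positivity), ← ENNReal.ofReal_mul (by positivity),
    ← ENNReal.ofReal_mul (by positivity)]
  refine ENNReal.ofReal_le_ofReal ?_
  calc (Cs : ℝ) * (n * (√(7 * p * n) * Cη * √(1 + L) / (R - ρ) * √I)) ≤
      (Cs + 1) * (n * (√(7 * p * n) * Cη * √(1 + L) / (R - ρ) * √I)) := by gcongr; linarith
    _ = _ := by ring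

end

section

open Filter Topology

variable {n N : ℕ}

theorem exists_moser_product {s θ : ℝ} (hs : 0 < s) (hθ0 : 0 < θ) (hθ1 : θ < 1) :
    ∃ C > 0, ∀ b > 0, ∀ y : ℕ → ℝ, (∀ j, 0 ≤ y j) →
      (∀ j, y (j + 1) ≤ (b * 2 ^ (j + 1)) ^ (s * θ ^ j) * y j) →
      ∀ J, y J ≤ b ^ (s * ∑ j ∈ Finset.range J, θ ^ j) * C * y 0 := by
  have hsum : Summable fun j : ℕ => ((j : ℝ) + 1) * θ ^ j := by
    have h1 := summable_pow_mul_geometric_of_norm_lt_one (R := ℝ) 1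
      (show ‖θ‖ < 1 by rwa [Real.norm_of_nonneg hθ0.le])
    have h2 := summable_geometric_of_lt_one hθ0.le hθ1
    refine (h1.add h2).congr fun j => ?_
    rw [pow_one]; ring
  refine ⟨2 ^ (s * ∑' j : ℕ, ((j : ℝ) + 1) * θ ^ j), by positivity, fun b hb y hy h J => ?_⟩
  have key : y J ≤ b ^ (s * ∑ j ∈ Finset.range J, θ ^ j) *
      2 ^ (s * ∑ j ∈ Finset.range J, ((j : ℝ) + 1) * θ ^ j) * y 0 := by
    induction J with
    | zero => simp
    | succ J ih =>
      refine (h J).trans ((mul_le_mul_of_nonneg_left ih (by positivity)).trans_eq ?_)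
      rw [Finset.sum_range_succ, Finset.sum_range_succ, mul_add, mul_add, Real.rpow_add hb,
        Real.rpow_add two_pos, Real.mul_rpow hb.le (by positivity),
        show ((2 : ℝ) ^ (J + 1)) = 2 ^ ((J : ℝ) + 1) by exact_mod_cast (Real.rpow_natCast 2 (J + 1)).symm,
        ← Real.rpow_mul two_pos.le, show ((J : ℝ) + 1) * (s * θ ^ J) = s * (((J : ℝ) + 1) * θ ^ J) by ring]
      ring
  refine key.trans (mul_le_mul_of_nonneg_right (mul_le_mul_of_nonneg_left
    (Real.rpow_le_rpow_of_exponent_le one_le_two (mul_le_mul_of_nonneg_left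
      (hsum.sum_le_tsum _ fun j _ => by positivity) hs.le)) (by positivity)) (hy 0))

theorem ae_le_of_eLpNorm_le {α : Type*} [MeasurableSpace α] {μ : Measure α} [IsFiniteMeasure μ]
    {v : α → ℝ} (hv : AEStronglyMeasurable v μ) {q Y : ℕ → ℝ} {K : ℝ} (hq0 : ∀ j, 0 < q j)
    (hq : Tendsto q atTop atTop) (hY0 : ∀ j, 0 ≤ Y j) (hY : Tendsto Y atTop (𝓝 K))
    (h : ∀ j, eLpNorm v (ENNReal.ofReal (q j)) μ ≤ ENNReal.ofReal (Y j)) : ∀ᵐ x ∂μ, v x ≤ K := by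
  have hK : 0 ≤ K := ge_of_tendsto' hY hY0
  have main : ∀ l > K, μ {x | l ≤ v x} = 0 := fun l hl => by
    by_contra hne
    have hl0 : 0 < l := hK.trans_lt hl
    set δ := μ.real {x | l ≤ v x} with hδ
    have hδ0 : 0 < δ := (measureReal_nonneg).lt_of_ne fun h0 => hne
      ((measureReal_eq_zero_iff (measure_ne_top _ _)).1 h0.symm)
    have step : ∀ j, l * δ ^ (1 / q j) ≤ Y j := fun j => by
      have h1 := mul_meas_ge_le_pow_eLpNorm' μ (p := ENNReal.ofReal (q j))
        (ENNReal.ofReal_pos.2 (hq0 j)).ne' ENNReal.ofReal_ne_top hv (ENNReal.ofReal l)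
      rw [ENNReal.toReal_ofReal (hq0 j).le] at h1
      have h2 : ENNReal.ofReal l ^ q j * μ {x | l ≤ v x} ≤ ENNReal.ofReal (Y j) ^ q j := by
        refine le_trans (mul_le_mul_right (measure_mono fun x hx => ?_) _)
          (h1.trans (ENNReal.rpow_le_rpow (h j) (hq0 j).le))
        rw [mem_ofPred_eq, ← ofReal_norm]
        exact ENNReal.ofReal_le_ofReal (le_trans hx (Real.le_norm_self _))
      have h3 := ENNReal.toReal_mono (ENNReal.rpow_ne_top_of_nonneg (hq0 j).le ENNReal.ofReal_ne_top) h2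
      rw [ENNReal.toReal_mul, ← ENNReal.toReal_rpow, ← ENNReal.toReal_rpow, ENNReal.toReal_ofReal hl0.le,
        ENNReal.toReal_ofReal (hY0 j)] at h3
      change l ^ q j * δ ≤ Y j ^ q j at h3
      have h4 := Real.rpow_le_rpow (by positivity) h3 (one_div_nonneg.2 (hq0 j).le)
      rw [Real.mul_rpow (by positivity) hδ0.le, ← Real.rpow_mul hl0.le, ← Real.rpow_mul (hY0 j),
        mul_one_div_cancel (hq0 j).ne', Real.rpow_one, Real.rpow_one] at h4
      exact h4
    have hlim : Tendsto (fun j => l * δ ^ (1 / q j)) atTop (𝓝 (l * δ ^ (0 : ℝ))) :=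
      ((Real.continuousAt_const_rpow hδ0.ne').tendsto.comp
        ((tendsto_const_nhds (x := (1 : ℝ))).div_atTop hq)).const_mul l
    rw [Real.rpow_zero, mul_one] at hlim
    exact absurd (le_of_tendsto_of_tendsto' hlim hY step) (not_le.2 hl)
  have h' : ∀ k : ℕ, ∀ᵐ x ∂μ, v x < K + 1 / ((k : ℝ) + 1) := fun k => by
    have := main (K + 1 / ((k : ℝ) + 1)) (by linarith [Nat.one_div_pos_of_nat (α := ℝ) (n := k)])
    rw [ae_iff]; simpa only [not_lt] using this
  filter_upwards [ae_all_iff.2 h'] with x hx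
  have hlim := (tendsto_one_div_add_atTop_nhds_zero_nat (𝕜 := ℝ)).const_add K
  rw [add_zero] at hlim
  exact ge_of_tendsto' hlim fun k => (hx k).le

end

section

open Filter Topology

variable {n N : ℕ}

theorem tt_one_le {p : ℝ} (z : Mat n N) : tt p 1 z ≤ FF p z := by
  rw [tt, ppow, Real.rpow_one]
  exact max_le (by linarith [Real.exp_pos (2 ^ p)]) (FF_pos p z).le

theorem FF_le_tt_one_add {p : ℝ} (z : Mat n N) : FF p z ≤ tt p 1 z + Real.exp (2 ^ p) := by
  rw [tt, ppow, Real.rpow_one]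
  linarith [le_max_left (FF p z - Real.exp (2 ^ p)) 0]

theorem LMin.integrable_FF {p : ℝ} (hp : 1 < p) {U : Fin N → Eu n → ℝ} {x₀ : Eu n} {r M : ℝ}
    (H : LMin p U x₀ r M) {s : Set (Eu n)} (hs : volume s ≠ ∞) :
    IntegrableOn (fun x => FF p (grd U x)) s := by
  have : IsFiniteMeasure (volume.restrict s) := ⟨by rw [Measure.restrict_apply_univ]; exact hs.lt_top⟩
  exact Integrable.of_bound (((continuous_FF hp).measurable.comp (measurable_grd U)).aestronglyMeasurable)
    (Real.exp (M ^ p)) (Eventually.of_forall fun x => by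
      rw [Real.norm_of_nonneg (FF_pos _ _).le]; exact FF_le hp (H.bdd x))

theorem LMin.eLpNorm_three_le {p : ℝ} (hp : 1 < p) {U : Fin N → Eu n → ℝ} {x₀ : Eu n} {r M : ℝ}
    (H : LMin p U x₀ r M) {R L : ℝ} (hR : R < r)
    (hL : ∀ᵐ x, x ∈ closedBall x₀ R → ‖grd U x‖ ^ p ≤ L) :
    eLpNorm (fun x => tt p 1 (grd U x)) (ENNReal.ofReal 3) (volume.restrict (closedBall x₀ R)) ≤
      ENNReal.ofReal ((Real.exp (2 * L) * ∫ x in ball x₀ r, FF p (grd U x)) ^ (1 / 3 : ℝ)) := by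
  have hI0 : 0 ≤ ∫ x in ball x₀ r, FF p (grd U x) := integral_nonneg fun x => (FF_pos _ _).le
  rw [eLpNorm_eq_lintegral_rpow_enorm_toReal (by simp) (by simp),
    ← ENNReal.ofReal_rpow_of_nonneg (by positivity) (by norm_num), ENNReal.toReal_ofReal (by norm_num)]
  refine ENNReal.rpow_le_rpow ?_ (by norm_num)
  rw [← integral_const_mul, ofReal_integral_eq_lintegral_ofReal
    ((H.integrable_FF hp measure_ball_lt_top.ne).const_mul _)
    (Eventually.of_forall fun x => mul_nonneg (Real.exp_pos _).le (FF_pos _ _).le)]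
  refine (lintegral_mono_ae ?_).trans (lintegral_mono_set (closedBall_subset_ball hR))
  filter_upwards [(ae_restrict_iff' measurableSet_closedBall).2 hL] with x hx
  rw [← ofReal_norm, ENNReal.ofReal_rpow_of_nonneg (norm_nonneg _) (by norm_num)]
  refine ENNReal.ofReal_le_ofReal ?_
  rw [Real.norm_of_nonneg (tt_nonneg _ _ _), Real.rpow_ofNat]
  have h1 : FF p (grd U x) ≤ Real.exp L := Real.exp_le_exp.2 hx
  have h0 := FF_pos p (grd U x)
  calc tt p 1 (grd U x) ^ 3 ≤ FF p (grd U x) ^ 3 := by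
        gcongr
        · exact tt_nonneg _ _ _
        · exact tt_one_le _
    _ = FF p (grd U x) ^ 2 * FF p (grd U x) := by ring
    _ ≤ Real.exp L ^ 2 * FF p (grd U x) := by gcongr
    _ = _ := by rw [two_mul, Real.exp_add]; ring

theorem exists_sup_estimate (hn : 2 < n) (N : ℕ) {p : ℝ} (hp : 1 < p) : ∃ C > 0,
    ∀ (U : Fin N → Eu n → ℝ) (x₀ : Eu n) (r M : ℝ), LMin p U x₀ r M →
    ∀ ρ R L : ℝ, 0 < ρ → ρ < R → R < r → 0 ≤ L →
    (∀ᵐ x, x ∈ closedBall x₀ R → ‖grd U x‖ ^ p ≤ L) →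
    ∀ᵐ x, x ∈ closedBall x₀ ρ → tt p 1 (grd U x) ≤
      C * (√(1 + L) / (R - ρ)) ^ (n / 3 : ℝ) *
        (Real.exp (2 * L) * ∫ x in ball x₀ r, FF p (grd U x)) ^ (1 / 3 : ℝ) := by
  have hn2 : (0 : ℝ) < n - 2 := by
    have : (2 : ℝ) < n := by exact_mod_cast hn
    linarith
  have hn0 : (0 : ℝ) < n := by linarith
  obtain ⟨C, hC, hstep⟩ := exists_moser_step hn N hp
  set θ : ℝ := (n - 2) / n with hθ
  set χ : ℝ := n / (n - 2) with hχ
  have hθχ : ∀ j : ℕ, θ ^ j * χ ^ j = 1 := fun j => by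
    rw [← mul_pow, hθ, hχ, div_mul_div_comm, mul_comm, div_self (by positivity), one_pow]
  have hθ0 : 0 < θ := by positivity
  have hθ1 : θ < 1 := by rw [hθ, div_lt_one hn0]; linarith
  have hχ1 : 1 < χ := by rw [hχ, one_lt_div hn2]; linarith
  obtain ⟨C', hC', hprod⟩ := exists_moser_product (s := 2 / 3) (by norm_num) hθ0 hθ1
  refine ⟨C ^ (n / 3 : ℝ) * C', by positivity, fun U x₀ r M H ρ R L hρ0 hρ hR hL0 hL => ?_⟩
  have hRρ : 0 < R - ρ := by linarith
  set v : Eu n → ℝ := fun x => tt p 1 (grd U x) with hv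
  have hvm : AEStronglyMeasurable v volume :=
    ((continuous_tt hp one_pos).measurable.comp (measurable_grd U)).aestronglyMeasurable
  set t : ℕ → ℝ := fun j => ρ + (R - ρ) / 2 ^ j with ht
  set e : ℕ → ℝ≥0∞ := fun j => eLpNorm v (ENNReal.ofReal (3 * χ ^ j)) (volume.restrict (closedBall x₀ (t j)))
    with he
  have htR : ∀ j, t j ≤ R := fun j => by
    have : (R - ρ) / 2 ^ j ≤ R - ρ := div_le_self hRρ.le (one_le_pow₀ one_le_two)
    simp only [ht]; linarith
  have htρ : ∀ j, ρ < t j := fun j => by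
    have : 0 < (R - ρ) / 2 ^ j := by positivity
    simp only [ht]; linarith
  have htd : ∀ j, t j - t (j + 1) = (R - ρ) / 2 ^ (j + 1) := fun j => by
    simp only [ht, pow_succ]; field_simp; ring
  have hfin : ∀ j, IsFiniteMeasure (volume.restrict (closedBall x₀ (t j))) := fun j => ⟨by
    rw [Measure.restrict_apply_univ]; exact measure_closedBall_lt_top⟩
  have hefin : ∀ j, e j ≠ ∞ := fun j => by
    obtain ⟨K, hK⟩ := (isCompact_closedBall (0 : Mat n N) M).exists_bound_of_continuousOn
      (continuous_tt (p := p) hp one_pos).continuousOn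
    exact (MemLp.of_bound hvm.restrict K
      (Eventually.of_forall fun x => hK _ (mem_closedBall_zero_iff.2 (H.bdd x)))).eLpNorm_ne_top
  have hb : 0 < C * √(1 + L) / (R - ρ) := by positivity
  have hy : ∀ j, (e (j + 1)).toReal ≤ (C * √(1 + L) / (R - ρ) * 2 ^ (j + 1)) ^ (2 / 3 * θ ^ j) * (e j).toReal := by
    intro j
    have hm : (3 / 2 : ℝ) ≤ 3 / 2 * χ ^ j := le_mul_of_one_le_right (by norm_num) (one_le_pow₀ hχ1.le)
    have hm0 : 0 < 3 / 2 * χ ^ j := by positivity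
    have hLj : ∀ᵐ x, x ∈ closedBall x₀ (t j) → ‖grd U x‖ ^ p ≤ L := by
      filter_upwards [hL] with x hx hxj using hx (closedBall_subset_closedBall (htR j) hxj)
    have hlt : t (j + 1) < t j := by
      have : 0 < (R - ρ) / 2 ^ (j + 1) := by positivity
      linarith [htd j]
    have h1 := hstep U x₀ r M H (t (j + 1)) (t j) L (3 / 2 * χ ^ j) (hρ0.trans (htρ _)) hlt
      ((htR j).trans_lt hR) hL0 hm hLj
    rw [show 2 * (3 / 2 * χ ^ j) = 3 * χ ^ j by ring, show 3 * χ ^ j * χ = 3 * χ ^ (j + 1) by ring,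
      htd] at h1
    change e (j + 1) ^ (3 / 2 * χ ^ j) ≤ _ * e j ^ (3 / 2 * χ ^ j) at h1
    have h2 := ENNReal.toReal_mono (ENNReal.mul_ne_top ENNReal.ofReal_ne_top
      (ENNReal.rpow_ne_top_of_nonneg hm0.le (hefin j))) h1
    rw [ENNReal.toReal_mul, ← ENNReal.toReal_rpow, ← ENNReal.toReal_rpow,
      ENNReal.toReal_ofReal (by positivity)] at h2
    have h3 := Real.rpow_le_rpow (by positivity) h2 (show 0 ≤ 2 / 3 * θ ^ j by positivity)
    have hone : 3 / 2 * χ ^ j * (2 / 3 * θ ^ j) = 1 := by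
      linear_combination hθχ j
    rw [Real.mul_rpow (by positivity) (by positivity), ← Real.rpow_mul ENNReal.toReal_nonneg,
      ← Real.rpow_mul ENNReal.toReal_nonneg, hone, Real.rpow_one, Real.rpow_one] at h3
    refine h3.trans_eq ?_
    congr 2
    field_simp
  have hJ := hprod _ hb (fun j => (e j).toReal) (fun j => ENNReal.toReal_nonneg) hy
  have hSlim : Tendsto (fun J => (C * √(1 + L) / (R - ρ)) ^ (2 / 3 * ∑ j ∈ Finset.range J, θ ^ j) * C' *
      (e 0).toReal) atTop (𝓝 ((C * √(1 + L) / (R - ρ)) ^ (n / 3 : ℝ) * C' * (e 0).toReal)) := by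
    have h1 := ((hasSum_geometric_of_lt_one hθ0.le hθ1).tendsto_sum_nat).const_mul (2 / 3 : ℝ)
    have h2 : (2 / 3 : ℝ) * (1 - θ)⁻¹ = n / 3 := by
      rw [hθ]; field_simp; ring
    rw [h2] at h1
    exact (((Real.continuousAt_const_rpow hb.ne').tendsto.comp h1).mul_const _).mul_const _
  have hfinρ : IsFiniteMeasure (volume.restrict (closedBall x₀ ρ)) := ⟨by
    rw [Measure.restrict_apply_univ]; exact measure_closedBall_lt_top⟩
  have hae := ae_le_of_eLpNorm_le (μ := volume.restrict (closedBall x₀ ρ)) hvm.restrict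
    (q := fun j => 3 * χ ^ j) (fun j => by positivity)
    ((tendsto_pow_atTop_atTop_of_one_lt hχ1).const_mul_atTop (by norm_num))
    (fun J => by positivity) hSlim fun J => by
      refine (eLpNorm_mono_measure _ (Measure.restrict_mono_set _
        (closedBall_subset_closedBall (htρ J).le))).trans ?_
      change e J ≤ _
      rw [← ENNReal.ofReal_toReal (hefin J)]
      exact ENNReal.ofReal_le_ofReal (hJ J)
  filter_upwards [(ae_restrict_iff' measurableSet_closedBall).1 hae] with x hx hxρ
  refine (hx hxρ).trans ?_
  have he0 : (e 0).toReal ≤ (Real.exp (2 * L) * ∫ x in ball x₀ r, FF p (grd U x)) ^ (1 / 3 : ℝ) := by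
    refine ENNReal.toReal_le_of_le_ofReal (Real.rpow_nonneg (mul_nonneg (Real.exp_pos _).le
      (integral_nonneg fun x => (FF_pos _ _).le)) _) ?_
    have := H.eLpNorm_three_le hp hR hL
    simp only [he, ht, pow_zero, mul_one, div_one, add_sub_cancel]
    exact this
  refine (mul_le_mul_of_nonneg_left he0 (by positivity)).trans_eq ?_
  rw [mul_div_assoc, Real.mul_rpow hC.le (by positivity)]
  ring

end

section

open Filter Topology

variable {n N : ℕ}

theorem one_add_rpow_le (hn : 0 < n) {L : ℝ} (hL : 0 ≤ L) :
    (1 + L) ^ (n / 6 : ℝ) ≤ (n : ℝ) ^ (n / 6 : ℝ) * Real.exp (L / 6) := by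
  have hn1 : (1 : ℝ) ≤ n := by exact_mod_cast hn
  have h : 1 + L ≤ n * Real.exp (L / n) := by
    have h1 := Real.add_one_le_exp (L / n)
    calc 1 + L ≤ n * (L / n + 1) := by field_simp; linarith
      _ ≤ _ := by gcongr
  refine (Real.rpow_le_rpow (by positivity) h (by positivity)).trans_eq ?_
  rw [Real.mul_rpow (by positivity) (by positivity), ← Real.exp_mul]
  congr 2
  field_simp

theorem measureReal_ball_pos (x₀ : Eu n) {r : ℝ} (hr : 0 < r) : 0 < volume.real (ball x₀ r) :=
  ENNReal.toReal_pos (measure_ball_pos _ _ hr).ne' measure_ball_lt_top.ne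

theorem LMin.volume_le_integral {p : ℝ} (hp : 1 < p) {U : Fin N → Eu n → ℝ} {x₀ : Eu n} {r M : ℝ}
    (H : LMin p U x₀ r M) : volume.real (ball x₀ r) ≤ ∫ x in ball x₀ r, FF p (grd U x) := by
  have h1 : ∫ x in ball x₀ r, (1 : ℝ) ≤ ∫ x in ball x₀ r, FF p (grd U x) :=
    integral_mono (integrable_const_iff.2 (Or.inr ⟨by
      rw [Measure.restrict_apply_univ]; exact measure_ball_lt_top⟩))
      (H.integrable_FF hp measure_ball_lt_top.ne) fun x => one_le_FF _ _
  rwa [setIntegral_const, smul_eq_mul, mul_one] at h1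

theorem LMin.one_le_average {p : ℝ} (hp : 1 < p) {U : Fin N → Eu n → ℝ} {x₀ : Eu n} {r M : ℝ}
    (H : LMin p U x₀ r M) (hr : 0 < r) : 1 ≤ ⨍ x in ball x₀ r, FF p (grd U x) := by
  rw [setAverage_eq, smul_eq_mul, ← div_eq_inv_mul, one_le_div (measureReal_ball_pos _ hr)]
  exact H.volume_le_integral hp

theorem exists_log_step (hn : 2 < n) (N : ℕ) {p : ℝ} (hp : 1 < p) : ∃ g ≥ 0, ∃ D ≥ 0,
    ∀ (U : Fin N → Eu n → ℝ) (x₀ : Eu n) (r M : ℝ), LMin p U x₀ r M → 0 < r → ∀ (k : ℕ) (L : ℝ), 0 ≤ L →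
    (∀ᵐ x, x ∈ closedBall x₀ (r * (1 - (1 / 2) ^ (k + 2))) → ‖grd U x‖ ^ p ≤ L) →
    ∀ᵐ x, x ∈ closedBall x₀ (r * (1 - (1 / 2) ^ (k + 1))) → ‖grd U x‖ ^ p ≤
      5 / 6 * L + (Real.log (⨍ x in ball x₀ r, FF p (grd U x)) / 3 + g) + D * k := by
  obtain ⟨C, hC, hsup⟩ := exists_sup_estimate hn N hp
  have hn0 : (0 : ℝ) < n := by exact_mod_cast (by omega : 0 < n)
  have : Nonempty (Fin n) := ⟨⟨0, by omega⟩⟩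
  set ω := volume.real (ball (0 : Eu n) 1) with hω
  have hω0 : 0 < ω := measureReal_ball_pos _ one_pos
  set κ := Real.exp (2 ^ p) with hκ
  have hκ1 : 1 ≤ κ := Real.one_le_exp (by positivity)
  set C₁ := C * (n : ℝ) ^ (n / 6 : ℝ) * (4 : ℝ) ^ (n / 3 : ℝ) * ω ^ (1 / 3 : ℝ) with hC₁
  have hC₁0 : 0 < C₁ := by positivity
  refine ⟨Real.log (C₁ + κ), Real.log_nonneg (by linarith), n / 3 * Real.log 2,
    mul_nonneg (by positivity) (Real.log_nonneg one_le_two), fun U x₀ r M H hr k L hL0 hL => ?_⟩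
  set I := ∫ x in ball x₀ r, FF p (grd U x) with hI
  set A := Real.log (⨍ x in ball x₀ r, FF p (grd U x)) with hA
  have hV : volume.real (ball x₀ r) = ω * r ^ n := by
    rw [measureReal_def, Measure.addHaar_ball _ _ hr.le, ENNReal.toReal_mul, ENNReal.toReal_ofReal (by positivity),
      finrank_euclideanSpace, Fintype.card_fin, hω, measureReal_def, mul_comm]
  have hV0 : 0 < ω * r ^ n := by positivity
  have hIV : ω * r ^ n ≤ I := hV ▸ H.volume_le_integral hp
  have havg : ⨍ x in ball x₀ r, FF p (grd U x) = I / (ω * r ^ n) := by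
    rw [setAverage_eq, hV, smul_eq_mul, div_eq_inv_mul]
  have hA0 : 0 ≤ A := Real.log_nonneg (H.one_le_average hp hr)
  have hIA : I = Real.exp A * (ω * r ^ n) := by
    rw [hA, havg, Real.exp_log (div_pos (hV0.trans_le hIV) hV0), div_mul_cancel₀ _ hV0.ne']
  have hpow : ((1 : ℝ) / 2) ^ (k + 1) ≤ 1 / 2 := by
    rw [pow_succ]; exact mul_le_of_le_one_left (by norm_num) (pow_le_one₀ (by norm_num) (by norm_num))
  have hpow0 : (0 : ℝ) < (1 / 2) ^ (k + 2) := by positivity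
  have hpow2 : ((1 : ℝ) / 2) ^ (k + 1) = 2 * (1 / 2) ^ (k + 2) := by ring
  have hd : r * (1 - (1 / 2) ^ (k + 2)) - r * (1 - (1 / 2) ^ (k + 1)) = r / (4 * 2 ^ k) := by
    rw [hpow2]
    have : ((1 : ℝ) / 2) ^ (k + 2) = 1 / (4 * 2 ^ k) := by
      rw [div_pow, one_pow, pow_add]; norm_num [mul_comm]
    rw [this]; ring
  have hk := hsup U x₀ r M H (r * (1 - (1 / 2) ^ (k + 1))) (r * (1 - (1 / 2) ^ (k + 2))) L
    (mul_pos hr (by linarith)) (mul_lt_mul_of_pos_left (by linarith) hr)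
    (mul_lt_of_lt_one_right hr (by linarith)) hL0 hL
  filter_upwards [hk] with x hx hxk
  have h1 := hx hxk
  have h2 : C * (√(1 + L) / (r * (1 - (1 / 2) ^ (k + 2)) - r * (1 - (1 / 2) ^ (k + 1)))) ^ (n / 3 : ℝ) *
      (Real.exp (2 * L) * I) ^ (1 / 3 : ℝ) ≤
      C₁ * Real.exp (5 / 6 * L + A / 3 + n / 3 * Real.log 2 * k) := by
    rw [hd, hIA]
    have e1 : (√(1 + L) / (r / (4 * 2 ^ k))) ^ (n / 3 : ℝ) =
        (1 + L) ^ (n / 6 : ℝ) * 4 ^ (n / 3 : ℝ) * Real.exp (n / 3 * Real.log 2 * k) / r ^ (n / 3 : ℝ) := by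
      have : √(1 + L) / (r / (4 * 2 ^ k)) = √(1 + L) * 4 * 2 ^ k / r := by field_simp
      rw [this, Real.div_rpow (by positivity) hr.le, Real.mul_rpow (by positivity) (by positivity),
        Real.mul_rpow (by positivity) (by positivity), Real.sqrt_eq_rpow, ← Real.rpow_mul (by positivity),
        show (1 / 2 * (n / 3) : ℝ) = n / 6 by ring]
      congr 2
      rw [← Real.rpow_natCast, ← Real.rpow_mul two_pos.le, Real.rpow_def_of_pos two_pos]
      congr 1; ring
    have e2 : (Real.exp (2 * L) * (Real.exp A * (ω * r ^ n))) ^ (1 / 3 : ℝ) =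
        Real.exp (2 / 3 * L) * Real.exp (A / 3) * ω ^ (1 / 3 : ℝ) * r ^ (n / 3 : ℝ) := by
      rw [Real.mul_rpow (by positivity) (by positivity), Real.mul_rpow (by positivity) (by positivity),
        Real.mul_rpow (by positivity) (by positivity), ← Real.exp_mul, ← Real.exp_mul, ← Real.rpow_natCast,
        ← Real.rpow_mul hr.le, show 2 * L * (1 / 3) = 2 / 3 * L by ring, show A * (1 / 3) = A / 3 by ring,
        show (n : ℝ) * (1 / 3) = n / 3 by ring]
      ring
    rw [e1, e2]
    have hr' : r ^ (n / 3 : ℝ) ≠ 0 := (Real.rpow_pos_of_pos hr _).ne'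
    have h3 := one_add_rpow_le (n := n) (by omega) hL0
    calc _ = C * (1 + L) ^ (n / 6 : ℝ) * 4 ^ (n / 3 : ℝ) * ω ^ (1 / 3 : ℝ) * (Real.exp (n / 3 * Real.log 2 * k) *
          Real.exp (2 / 3 * L) * Real.exp (A / 3)) := by field_simp
      _ ≤ C * ((n : ℝ) ^ (n / 6 : ℝ) * Real.exp (L / 6)) * 4 ^ (n / 3 : ℝ) * ω ^ (1 / 3 : ℝ) *
          (Real.exp (n / 3 * Real.log 2 * k) * Real.exp (2 / 3 * L) * Real.exp (A / 3)) := by gcongr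
      _ = C₁ * (Real.exp (L / 6) * Real.exp (2 / 3 * L) * Real.exp (A / 3) *
          Real.exp (n / 3 * Real.log 2 * k)) := by rw [hC₁]; ring
      _ = _ := by
        rw [← Real.exp_add, ← Real.exp_add, ← Real.exp_add]
        congr 2; ring
  have hE : 0 ≤ 5 / 6 * L + A / 3 + n / 3 * Real.log 2 * k := by
    have := Real.log_nonneg one_le_two
    positivity
  have h4 : FF p (grd U x) ≤ (C₁ + κ) * Real.exp (5 / 6 * L + A / 3 + n / 3 * Real.log 2 * k) := by
    have h5 := FF_le_tt_one_add (p := p) (grd U x)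
    have h6 : κ ≤ κ * Real.exp (5 / 6 * L + A / 3 + n / 3 * Real.log 2 * k) :=
      le_mul_of_one_le_right (by positivity) (Real.one_le_exp hE)
    rw [add_mul]; linarith
  have h7 := Real.log_le_log (FF_pos _ _) h4
  rw [FF, Real.log_exp, Real.log_mul (by positivity) (Real.exp_pos _).ne', Real.log_exp] at h7
  linarith

theorem exists_log_estimate (hn : 2 < n) (N : ℕ) {p : ℝ} (hp : 1 < p) : ∃ c ≥ 0,
    ∀ (U : Fin N → Eu n → ℝ) (x₀ : Eu n) (r M : ℝ), LMin p U x₀ r M → 0 < r →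
    ∀ᵐ x, x ∈ closedBall x₀ (r / 2) → ‖grd U x‖ ^ p ≤
      2 * Real.log (⨍ x in ball x₀ r, FF p (grd U x)) + c := by
  obtain ⟨g, hg, D, hD, hstep⟩ := exists_log_step hn N hp
  refine ⟨6 * g + 30 * D, by positivity, fun U x₀ r M H hr => ?_⟩
  set A := Real.log (⨍ x in ball x₀ r, FF p (grd U x)) with hA
  set S := 2 * A + (6 * g + 30 * D) with hS
  have hM : 0 ≤ M := (norm_nonneg _).trans (H.bdd 0)
  have hA0 : 0 ≤ A := Real.log_nonneg (H.one_le_average hp hr)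
  have hS0 : 0 ≤ S := by positivity
  have key : ∀ J k : ℕ, ∀ᵐ x, x ∈ closedBall x₀ (r * (1 - (1 / 2) ^ (k + 1))) →
      ‖grd U x‖ ^ p ≤ S + 6 * D * k + (5 / 6) ^ J * M ^ p := fun J => by
    induction J with
    | zero =>
      refine fun k => Eventually.of_forall fun x _ => ?_
      have h1 : ‖grd U x‖ ^ p ≤ M ^ p := Real.rpow_le_rpow (norm_nonneg _) (H.bdd x) (by linarith)
      have h2 : 0 ≤ S + 6 * D * k := by positivity
      rw [pow_zero]; linarith
    | succ J ih =>
      intro k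
      have hk := hstep U x₀ r M H hr k _ (by positivity) (ih (k + 1))
      filter_upwards [hk] with x hx hxk
      refine (hx hxk).trans_eq ?_
      rw [hS]; push_cast; ring
  filter_upwards [ae_all_iff.2 fun J => key J 0] with x hx hxr
  have hlim : Tendsto (fun J : ℕ => S + (5 / 6 : ℝ) ^ J * M ^ p) atTop (𝓝 (S + 0 * M ^ p)) :=
    ((tendsto_pow_atTop_nhds_zero_of_lt_one (by norm_num) (by norm_num)).mul_const _).const_add _
  rw [zero_mul, add_zero] at hlim
  refine ge_of_tendsto' hlim fun J => ?_
  have h1 := hx J (by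
    rw [zero_add, pow_one, show r * (1 - 1 / 2) = r / 2 by ring]; exact hxr)
  simpa using h1

end

section

open Filter Topology

variable {n N : ℕ}

theorem norm_sq_eq_sum_fderiv (f : Eu n → ℝ) (x : Eu n) :
    ‖gradient f x‖ ^ 2 = ∑ i, fderiv ℝ f x (ee i) ^ 2 := by
  rw [EuclideanSpace.norm_sq_eq]
  refine Finset.sum_congr rfl fun i _ => ?_
  rw [Real.norm_eq_abs, sq_abs]
  congr 1
  have h := InnerProductSpace.toDual_symm_apply (𝕜 := ℝ) (x := ee i) (y := fderiv ℝ f x)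
  rw [← h, ee, EuclideanSpace.inner_single_right]
  simp [gradient]

theorem jacNorm_eq_norm_grd {u : Eu n → Eu N} {U : Fin N → Eu n → ℝ} {x : Eu n}
    (h : ∀ α, (fun y => u y α) =ᶠ[𝓝 x] U α) : jacNorm u x = ‖grd U x‖ := by
  rw [jacNorm, EuclideanSpace.norm_eq, Fintype.sum_prod_type_right]
  congr 1
  refine Finset.sum_congr rfl fun α _ => ?_
  rw [norm_sq_eq_sum_fderiv, (h α).fderiv_eq]
  refine Finset.sum_congr rfl fun i _ => ?_
  rw [grd_apply, Real.norm_eq_abs, sq_abs]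

theorem exists_lipschitzWith_toLp {V : Fin N → Eu n → ℝ} (hV : ∀ α, ∃ C, LipschitzWith C (V α)) :
    ∃ C, LipschitzWith C (fun x => (WithLp.toLp 2 fun α => V α x : Eu N)) := by
  choose C hC using hV
  have h : LipschitzWith (∑ α, C α) fun x => fun α => V α x := fun x y =>
    edist_pi_le_iff.2 fun α => (hC α x y).trans (by
      gcongr; exact Finset.single_le_sum (f := C) (fun _ _ => zero_le) (Finset.mem_univ α))
  exact ⟨_, (PiLp.lipschitzWith_toLp 2 fun _ : Fin N => ℝ).comp h⟩

theorem exists_lMin {Ω : Set (Eu n)} {p : ℝ} {u : Eu n → Eu N} (hu : LocLipOn Ω u)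
    (hmin : IsLocMinimizerExp Ω p u) {x₀ : Eu n} {r : ℝ} (hr : 0 < r) (hΩ : closedBall x₀ r ⊆ Ω) :
    ∃ (U : Fin N → Eu n → ℝ) (M : ℝ), LMin p U x₀ r M ∧ ∀ x ∈ ball x₀ r, jacNorm u x = ‖grd U x‖ := by
  obtain ⟨C, hC⟩ := hu _ (isCompact_closedBall x₀ r) hΩ
  have hex : ∀ α : Fin N, ∃ g, LipschitzWith C g ∧ EqOn (fun y => u y α) g (closedBall x₀ r) := fun α => by
    refine LipschitzOnWith.extend_real fun x hx y hy => le_trans ?_ (hC hx hy)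
    exact PiLp.edist_apply_le _ _ _
  choose U hU hUu using hex
  have hjac : ∀ x ∈ ball x₀ r, jacNorm u x = ‖grd U x‖ := fun x hx =>
    jacNorm_eq_norm_grd fun α => by
      filter_upwards [isOpen_ball.mem_nhds hx] with y hy using hUu α (ball_subset_closedBall hy)
  obtain ⟨M, hM⟩ := exists_norm_grd_le fun α => ⟨C, hU α⟩
  refine ⟨U, M, ⟨fun α => ⟨C, hU α⟩, hM, fun W hW ρ hρ hWU => ?_⟩, hjac⟩
  set w : Eu n → Eu N := fun y => u y + WithLp.toLp 2 fun α => W α y - U α y with hw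
  have hwW : ∀ x ∈ ball x₀ r, jacNorm w x = ‖grd W x‖ := fun x hx =>
    jacNorm_eq_norm_grd fun α => by
      filter_upwards [isOpen_ball.mem_nhds hx] with y hy
      have h := hUu α (ball_subset_closedBall hy)
      simp only [hw, PiLp.add_apply]
      simp only at h
      rw [h]; ring
  have hwlip : LocLipOn Ω w := fun K hK hKΩ => by
    obtain ⟨C₁, h₁⟩ := hu K hK hKΩ
    obtain ⟨C₂, h₂⟩ := exists_lipschitzWith_toLp (V := fun α y => W α y - U α y) fun α => by
      obtain ⟨C₃, h₃⟩ := hW α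
      exact ⟨_, h₃.sub (hU α)⟩
    exact ⟨_, h₁.add h₂.lipschitzOnWith⟩
  have hsub : closure {x | w x ≠ u x} ⊆ closedBall x₀ ρ :=
    closure_minimal (fun x hx => by
      by_contra hxρ
      refine hx ?_
      ext α
      simp [hw, hWU α x hxρ]) isClosed_closedBall
  have h := hmin (ball x₀ r) isOpen_ball (by rw [closure_ball _ hr.ne']; exact isCompact_closedBall _ _)
    (by rwa [closure_ball _ hr.ne']) w hwlip
    ((isCompact_closedBall x₀ ρ).of_isClosed_subset isClosed_closure hsub)
    (hsub.trans (closedBall_subset_ball hρ))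
  have h₁ : ∫ x in ball x₀ r, Real.exp (jacNorm u x ^ p) = ∫ x in ball x₀ r, FF p (grd U x) :=
    setIntegral_congr_fun measurableSet_ball fun x hx => by simp only [FF, hjac x hx]
  have h₂ : ∫ x in ball x₀ r, Real.exp (jacNorm w x ^ p) = ∫ x in ball x₀ r, FF p (grd W x) :=
    setIntegral_congr_fun measurableSet_ball fun x hx => by simp only [FF, hwW x hx]
  rwa [h₁, h₂] at h

end

end ExpLip

/-- Exponential estimate: a local minimizer of `w ↦ ∫ exp(|Dw|^p) dx`
satisfies `‖Du‖_{L^∞(B/2)}^p ≤ c·log(⨍_B exp(|Du|^p) dx) + c` with `c = c(n,N,p)`. -/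
theorem exponential_lipschitz_estimate (n N : ℕ) (hn : 2 < n) (hN : 1 ≤ N)
    (p : ℝ) (hp : 1 < p) :
    ∃ c : ℝ, 0 < c ∧
      ∀ (Ω : Set (EuclideanSpace ℝ (Fin n))), IsOpen Ω →
      ∀ u : EuclideanSpace ℝ (Fin n) → EuclideanSpace ℝ (Fin N), LocLipOn Ω u →
        IsLocMinimizerExp Ω p u →
      ∀ (x₀ : EuclideanSpace ℝ (Fin n)) (r : ℝ), 0 < r → closure (ball x₀ r) ⊆ Ω →
        (essSup (fun x => ENNReal.ofReal (jacNorm u x))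
            (volume.restrict (ball x₀ (r / 2)))) ^ p ≤
          ENNReal.ofReal
            (c * Real.log (⨍ x in ball x₀ r, Real.exp (jacNorm u x ^ p)) + c) := by
  obtain ⟨c, hc, hest⟩ := ExpLip.exists_log_estimate hn N hp
  refine ⟨c + 2, by linarith, fun Ω _ u hu hmin x₀ r hr hΩ => ?_⟩
  rw [closure_ball _ hr.ne'] at hΩ
  obtain ⟨U, M, H, hjac⟩ := ExpLip.exists_lMin hu hmin hr hΩ
  have h := hest U x₀ r M H hr
  have havg : ⨍ x in ball x₀ r, Real.exp (jacNorm u x ^ p) = ⨍ x in ball x₀ r, ExpLip.FF p (ExpLip.grd U x) := by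
    rw [setAverage_eq, setAverage_eq]
    congr 1
    exact setIntegral_congr_fun measurableSet_ball fun x hx => by simp only [ExpLip.FF, hjac x hx]
  rw [havg]
  set A := Real.log (⨍ x in ball x₀ r, ExpLip.FF p (ExpLip.grd U x)) with hA
  have hA0 : 0 ≤ A := Real.log_nonneg (H.one_le_average hp hr)
  have hK : 0 ≤ (c + 2) * A + (c + 2) := by positivity
  have hp0 : 0 < p := by linarith
  have hess : essSup (fun x => ENNReal.ofReal (jacNorm u x)) (volume.restrict (ball x₀ (r / 2))) ≤
      ENNReal.ofReal (((c + 2) * A + (c + 2)) ^ (1 / p)) := by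
    refine essSup_le_of_ae_le _ ?_
    filter_upwards [ae_restrict_of_ae h, ae_restrict_mem measurableSet_ball] with x hx hxr
    rw [hjac x (ball_subset_ball (by linarith) hxr)]
    refine ENNReal.ofReal_le_ofReal ?_
    have h1 : ‖ExpLip.grd U x‖ ^ p ≤ (c + 2) * A + (c + 2) := by
      nlinarith [hx (ball_subset_closedBall hxr), mul_nonneg hc hA0]
    calc ‖ExpLip.grd U x‖ = (‖ExpLip.grd U x‖ ^ p) ^ (1 / p) := by
          rw [← Real.rpow_mul (norm_nonneg _), mul_one_div_cancel hp0.ne', Real.rpow_one]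
      _ ≤ _ := by gcongr
  refine (ENNReal.rpow_le_rpow hess hp0.le).trans_eq ?_
  rw [ENNReal.ofReal_rpow_of_nonneg (by positivity) hp0.le, ← Real.rpow_mul hK,
    one_div_mul_cancel hp0.ne', Real.rpow_one]
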